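/- Let α be a nonzero integer with a = v_p(α) (the p-adic valuation of α) satisfying 0 ≤ a ≤ n−1. Then the conductor of F((p^α)^{1/p^n})/F is f_n(p^α) = p^{n−1}(p+1) if a = 0, and f_n(p^α) = 2·p^{n−a} if 1 ≤ a ≤ n−1. -/

import Mathlib

/-- Membership in the group `F^r`: `x ∈ F^×` such that for every `σ ∈ Gal(F/E)`,
`σ(x)·x^{-c_σ^r} ∈ F^{×p^n}`, where `c_σ` is the cyclotomic character value of `σ`
(encoded as a unit of `ZMod (p^n)`). -/
def memFr (p n : ℕ) (E : Type) {F : Type} [Field E] [Field F] [Algebra E F]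
    (ζ : F) (r : ℤ) (x : F) : Prop :=
  x ≠ 0 ∧ ∀ (σ : F ≃ₐ[E] F) (u : (ZMod (p ^ n))ˣ),
    σ ζ = ζ ^ ((u : ZMod (p ^ n)).val) →
      ∃ w : F, σ x * (x ^ (((u ^ r : (ZMod (p ^ n))ˣ) : ZMod (p ^ n)).val))⁻¹ = w ^ (p ^ n)

/-- `b` is a norm from `F(y)` down to `F`. -/
def isNormFrom {F : Type} [Field F] (y : AlgebraicClosure F) (b : F) : Prop :=
  ∃ z : IntermediateField.adjoin F {y}, Algebra.norm F z = b

/-- The set of integers `f ≥ 0` such that every unit `u` of `F` with `v(u-1) ≥ f`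
is a norm from `F(y)`; its least element is the conductor of `F(y)/F`. -/
def condSet {F : Type} [Field F] (v : AddValuation F (WithTop ℤ))
    (y : AlgebraicClosure F) : Set ℕ :=
  {f : ℕ | ∀ u : F, v u = 0 → ((f : ℤ) : WithTop ℤ) ≤ v (u - 1) → isNormFrom y u}

section

open IntermediateField Polynomial

theorem Subgroup.relIndex_sup_range_comap_eq {G : Type*} [CommGroup G] (W : Subgroup G)
    [W.FiniteIndex] (D N : G →* G) (hD : W ≤ W.comap D) (hN : W ≤ W.comap N)
    (hDN : ∀ g, D (N g) = 1) (hND : ∀ g, N (D g) = 1) :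
    (W ⊔ N.range).relIndex (W.comap D) = (W ⊔ D.range).relIndex (W.comap N) := by
  have key : ∀ D N : G →* G, W ≤ W.comap D → (∀ g, D (N g) = 1) →
      W.index = W.relIndex N.range * (W ⊔ N.range).relIndex (W.comap D) * W.relIndex D.range := by
    intro D N hD hDN
    have h1 : W ⊔ N.range ≤ W.comap D := by
      refine sup_le hD ?_
      rintro _ ⟨g, rfl⟩
      simp [Subgroup.mem_comap, hDN, W.one_mem]
    rw [← Subgroup.index_comap W D, mul_assoc, Subgroup.relIndex_mul_index h1,
      ← Subgroup.relIndex_sup_right N.range W, sup_comm N.range W,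
      Subgroup.relIndex_mul_index le_sup_left]
  have h1 := key D N hD hDN
  have h2 := key N D hN hND
  have h0 : W.index ≠ 0 := Subgroup.FiniteIndex.index_ne_zero
  have hne : W.relIndex N.range * W.relIndex D.range ≠ 0 := by
    intro h
    apply h0
    rw [h1, mul_right_comm, h, zero_mul]
  apply Nat.eq_of_mul_eq_mul_left (Nat.pos_of_ne_zero hne)
  rw [mul_right_comm, ← h1, h2]
  ring

section

variable {p : ℕ} [Fact p.Prime]

theorem norm_algEquiv_apply_padic {K L : Type*} [Field K] [Algebra ℚ_[p] K] [NormedField L]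
    [NormedAlgebra ℚ_[p] L] [Algebra.IsAlgebraic ℚ_[p] L] [Algebra K L] [IsScalarTower ℚ_[p] K L]
    (σ : L ≃ₐ[K] L) (x : L) : ‖σ x‖ = ‖x‖ := by
  rw [NormedAlgebra.norm_eq_spectralNorm ℚ_[p], NormedAlgebra.norm_eq_spectralNorm ℚ_[p] x]
  unfold spectralNorm
  have := minpoly.algEquiv_eq (σ.restrictScalars ℚ_[p]) x
  rw [AlgEquiv.restrictScalars_apply] at this
  rw [this]

theorem norm_natCast_prime_padic {L : Type*} [NormedField L] [NormedAlgebra ℚ_[p] L] :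
    ‖(p : L)‖ = (p : ℝ)⁻¹ := by
  rw [← map_natCast (algebraMap ℚ_[p] L) p, norm_algebraMap', Padic.norm_p]

theorem expSeries_radius_pos_padic {L : Type*} [NormedField L] [NormedAlgebra ℚ_[p] L] :
    0 < (NormedSpace.expSeries ℚ_[p] L).radius := by
  have hp : 0 < p := (Fact.out : p.Prime).pos
  have hp' : (0 : ℝ) < p := by exact_mod_cast hp
  have : ((p : NNReal)⁻¹ : NNReal) ≤ (NormedSpace.expSeries ℚ_[p] L).radius := by
    apply FormalMultilinearSeries.le_radius_of_bound _ 1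
    intro n
    rw [NormedSpace.expSeries, norm_smul]
    have h1 : ‖(n.factorial⁻¹ : ℚ_[p])‖ ≤ (p : ℝ) ^ n := by
      rw [norm_inv]
      have h2 : ‖(n.factorial : ℚ_[p])‖ = (p : ℝ) ^ (-(padicValNat p n.factorial : ℤ)) := by
        rw [Padic.norm_eq_zpow_neg_valuation (by exact_mod_cast n.factorial_ne_zero)]
        simp
      rw [h2, ← zpow_neg, neg_neg, zpow_natCast]
      apply pow_le_pow_right₀ (by exact_mod_cast hp)
      have := sub_one_mul_padicValNat_factorial (p := p) n
      have h3 := (Fact.out : p.Prime).two_le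
      calc padicValNat p n.factorial ≤ (p - 1) * padicValNat p n.factorial :=
            Nat.le_mul_of_pos_left _ (by omega)
        _ ≤ n := by omega
    have h2 : ‖ContinuousMultilinearMap.mkPiAlgebraFin ℚ_[p] n L‖ ≤ 1 := by
      simp
    calc ‖(n.factorial⁻¹ : ℚ_[p])‖ * ‖ContinuousMultilinearMap.mkPiAlgebraFin ℚ_[p] n L‖
          * ((p : NNReal)⁻¹ : NNReal) ^ n ≤ (p : ℝ) ^ n * 1 * ((p : NNReal)⁻¹ : NNReal) ^ n := by
            gcongr
      _ = 1 := by
        simp [hp'.ne']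
  refine lt_of_lt_of_le ?_ this
  simp

end

theorem IsGalois.normalBasis_repr_algEquiv {K L : Type*} [Field K] [Field L] [Algebra K L]
    [IsGalois K L] [FiniteDimensional K L] (σ g : L ≃ₐ[K] L) (x : L) :
    (IsGalois.normalBasis K L).repr (σ x) (σ * g) = (IsGalois.normalBasis K L).repr x g := by
  classical
  set b := IsGalois.normalBasis K L
  have : (Finsupp.lapply (σ * g) ∘ₗ b.repr.toLinearMap) ∘ₗ σ.toLinearMap =
      Finsupp.lapply g ∘ₗ b.repr.toLinearMap := by
    apply b.ext
    intro h
    have h1 : σ (b h) = b (σ * h) := by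
      rw [IsGalois.normalBasis_apply h, IsGalois.normalBasis_apply (σ * h)]; rfl
    simp [h1, Finsupp.single_apply]
  exact LinearMap.congr_fun this x

theorem IsGalois.normalBasis_repr_trace {K L : Type*} [Field K] [Field L] [Algebra K L]
    [IsGalois K L] [FiniteDimensional K L] (g : L ≃ₐ[K] L) (x : L) :
    (IsGalois.normalBasis K L).repr (algebraMap K L (Algebra.trace K L x)) g =
      ∑ h, (IsGalois.normalBasis K L).repr x h := by
  rw [trace_eq_sum_automorphisms, map_sum, Finsupp.finsetSum_apply]
  refine Fintype.sum_equiv ((Equiv.inv _).trans (Equiv.mulRight g)) _ _ ?_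
  intro σ
  have := IsGalois.normalBasis_repr_algEquiv σ (σ⁻¹ * g) x
  rw [mul_inv_cancel_left] at this
  rw [this]
  simp

theorem exists_sub_eq_of_sum_eq_zero {G K : Type*} [Group G] [Fintype G] [NormedField K]
    [IsUltrametricDist K] {τ : G} (hτ : ∀ x, x ∈ Subgroup.zpowers τ) (c : G → K)
    (hc : ∑ g, c g = 0) {r : ℝ} (hr : 0 ≤ r) (hcr : ∀ g, ‖c g‖ ≤ r) :
    ∃ b : G → K, (∀ g, ‖b g‖ ≤ r) ∧ ∀ g, b (τ⁻¹ * g) - b g = c g := by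
  classical
  have hfin : IsOfFinOrder τ := isOfFinOrder_of_finite τ
  have hex : ∀ g : G, ∃ i < orderOf τ, τ ^ i = g := by
    intro g
    have := hτ g
    rw [← mem_powers_iff_mem_zpowers, hfin.mem_powers_iff_mem_range_orderOf] at this
    simpa using this
  choose i hi hig using hex
  have hiu : ∀ j < orderOf τ, i (τ ^ j) = j := fun j hj =>
    pow_injOn_Iio_orderOf (by simpa using hi _) (by simpa using hj) (hig _)
  set s : ℕ → K := fun j => -∑ k ∈ Finset.range (j + 1), c (τ ^ k) with hs
  refine ⟨fun g => s (i g), fun g => ?_, fun g => ?_⟩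
  · simp only [hs, norm_neg]
    exact IsUltrametricDist.norm_sum_le_of_forall_le_of_nonneg hr (fun k _ => hcr _)
  · dsimp only
    rcases Nat.eq_zero_or_pos (i g) with h0 | h0
    · have hg : g = 1 := by rw [← hig g, h0, pow_zero]
      have hpos : 0 < orderOf τ := hfin.orderOf_pos
      have h1 : i (τ⁻¹ * g) = orderOf τ - 1 := by
        rw [← hiu (orderOf τ - 1) (by omega)]
        congr 1
        rw [hg, mul_one, inv_eq_iff_mul_eq_one, ← pow_succ', Nat.sub_add_cancel hpos,
          pow_orderOf_eq_one]
      have h2 : ∑ k ∈ Finset.range (orderOf τ), c (τ ^ k) = ∑ g, c g := by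
        refine Finset.sum_nbij' (fun k => τ ^ k) i ?_ ?_ ?_ ?_ ?_
        · simp
        · simpa using hi
        · intro k hk; exact hiu k (by simpa using hk)
        · intro g _; exact hig g
        · simp
      rw [h1, h0, hs]
      simp only [Nat.sub_add_cancel hpos, h2, hc, hg]
      simp
    · have h1 : i (τ⁻¹ * g) = i g - 1 := by
        rw [← hiu (i g - 1) (by have := hi g; omega)]
        congr 1
        rw [inv_mul_eq_iff_eq_mul, ← pow_succ', Nat.sub_add_cancel h0, hig]
      rw [h1, hs]
      simp only [Nat.sub_add_cancel h0, Finset.sum_range_succ, hig]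
      ring

theorem exists_trivial_addSubgroup {p : ℕ} [Fact p.Prime] {K L : Type*} [NormedField K]
    [NormedField L] [NormedAlgebra ℚ_[p] K] [NormedAlgebra ℚ_[p] L] [FiniteDimensional ℚ_[p] L]
    [NormedAlgebra K L] [IsScalarTower ℚ_[p] K L] [FiniteDimensional K L] [IsGalois K L]
    {τ : L ≃ₐ[K] L} (hτ : ∀ x, x ∈ Subgroup.zpowers τ) {δ : ℝ} (hδ : 0 < δ) :
    ∃ A : AddSubgroup L, (∃ ε > 0, ∀ x : L, ‖x‖ < ε → x ∈ A) ∧ (∀ x ∈ A, ‖x‖ < δ) ∧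
      (∀ x ∈ A, τ x ∈ A) ∧
      (∀ x ∈ A, Algebra.trace K L x = 0 → ∃ y ∈ A, τ y - y = x) ∧
      (∀ x ∈ A, τ x = x → ∃ y ∈ A, algebraMap K L (Algebra.trace K L y) = x) := by
  classical
  have : IsUltrametricDist K := IsUltrametricDist.of_normedAlgebra ℚ_[p]
  set b := IsGalois.normalBasis K L with hb
  set C : ℝ := ∑ g, ‖b g‖ + 1 with hC
  have hC0 : 0 < C := by positivity
  set r := δ / C with hr
  have hr0 : 0 < r := by positivity
  let A : AddSubgroup L :=
    { carrier := {x | ∀ g, ‖b.repr x g‖ ≤ r}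
      zero_mem' := by intro g; simp [hr0.le]
      add_mem' := by
        intro x y hx hy g
        rw [map_add, Finsupp.add_apply]
        exact (IsUltrametricDist.norm_add_le_max _ _).trans (max_le (hx g) (hy g))
      neg_mem' := by
        intro x hx g
        rw [map_neg, Finsupp.neg_apply, norm_neg]
        exact hx g }
  have hA : ∀ x, x ∈ A ↔ ∀ g, ‖b.repr x g‖ ≤ r := fun x => Iff.rfl
  refine ⟨A, ?_, ?_, ?_, ?_, ?_⟩
  · have hcont : ∀ g, Continuous fun x => b.repr x g := by
      intro g
      exact LinearMap.continuous_of_finiteDimensional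
        ((Finsupp.lapply g ∘ₗ b.repr.toLinearMap).restrictScalars ℚ_[p])
    have hopen : IsOpen {x : L | ∀ g, ‖b.repr x g‖ < r} := by
      rw [Set.ofPred_forall]
      exact isOpen_iInter_of_finite fun g => isOpen_lt (hcont g).norm continuous_const
    obtain ⟨ε, hε, hsub⟩ := Metric.isOpen_iff.1 hopen 0 (by simp [hr0])
    refine ⟨ε, hε, fun x hx g => ?_⟩
    exact (hsub (by simpa using hx : x ∈ Metric.ball 0 ε) g).le
  · intro x hx
    calc ‖x‖ = ‖∑ g, b.repr x g • b g‖ := by rw [b.sum_repr]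
      _ ≤ ∑ g, r * ‖b g‖ := by
        refine norm_sum_le_of_le _ fun g _ => ?_
        rw [norm_smul]
        exact mul_le_mul_of_nonneg_right (hx g) (norm_nonneg _)
      _ = r * ∑ g, ‖b g‖ := by rw [Finset.mul_sum]
      _ < r * C := by
        apply mul_lt_mul_of_pos_left _ hr0
        simp [hC]
      _ = δ := by rw [hr]; field_simp
  · intro x hx g
    have := IsGalois.normalBasis_repr_algEquiv τ (τ⁻¹ * g) x
    rw [mul_inv_cancel_left] at this
    rw [hb, this]
    exact hx _
  · intro x hx htr
    have hsum : ∑ g, b.repr x g = 0 := by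
      rw [← IsGalois.normalBasis_repr_trace 1 x, htr]; simp
    obtain ⟨c, hc, hcx⟩ := exists_sub_eq_of_sum_eq_zero hτ _ hsum hr0.le hx
    refine ⟨∑ g, c g • b g, fun g => by rw [b.repr_sum_self]; exact hc g, ?_⟩
    apply b.repr.injective
    ext g
    have := IsGalois.normalBasis_repr_algEquiv τ (τ⁻¹ * g) (∑ g, c g • b g)
    rw [mul_inv_cancel_left] at this
    rw [map_sub, Finsupp.sub_apply, this, b.repr_sum_self]
    exact hcx g
  · intro x hx hfix
    have hconst : ∀ g, b.repr x g = b.repr x 1 := by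
      intro g
      have hsub : ∀ σ ∈ Subgroup.zpowers τ, σ x = x := by
        have : Subgroup.zpowers τ ≤ MulAction.stabilizer (L ≃ₐ[K] L) x := by
          rw [Subgroup.zpowers_le]; exact hfix
        exact fun σ hσ => this hσ
      have := IsGalois.normalBasis_repr_algEquiv g 1 x
      rw [hsub g (hτ g), mul_one] at this
      exact this
    refine ⟨b.repr x 1 • b 1, fun g => ?_, ?_⟩
    · rw [map_smul, b.repr_self, Finsupp.smul_single, Finsupp.single_apply]
      split_ifs
      · simpa using hx 1
      · simpa using hr0.le
    · apply b.repr.injective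
      ext g
      rw [IsGalois.normalBasis_repr_trace, hconst g, ← hb]
      simp [Finsupp.single_apply]

theorem exists_exp_ball_padic {p : ℕ} [Fact p.Prime] {L : Type*} [NormedField L]
    [NormedAlgebra ℚ_[p] L] [FiniteDimensional ℚ_[p] L] :
    ∃ δ > 0, (∀ x y : L, ‖x‖ < δ → ‖y‖ < δ →
        NormedSpace.exp (x + y) = NormedSpace.exp x * NormedSpace.exp y) ∧
      (∀ σ : L ≃ₐ[ℚ_[p]] L, ∀ x, ‖x‖ < δ → σ (NormedSpace.exp x) = NormedSpace.exp (σ x)) ∧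
      (∀ x y : L, ‖x‖ < δ → ‖y‖ < δ → NormedSpace.exp x = NormedSpace.exp y → x = y) ∧
      (∀ x : L, ‖x‖ < δ → ‖NormedSpace.exp x - 1‖ < 1) ∧
      ∀ η > 0, ∃ ε > 0, ∀ u : L, ‖u - 1‖ < ε → ∃ x, ‖x‖ < η ∧ NormedSpace.exp x = u := by
  have : CompleteSpace L := FiniteDimensional.complete ℚ_[p] L
  have hrad := expSeries_radius_pos_padic (p := p) (L := L)
  have hder : HasStrictFDerivAt (NormedSpace.exp : L → L)
      (ContinuousLinearEquiv.refl ℚ_[p] L : L →L[ℚ_[p]] L) 0 :=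
    hasStrictFDerivAt_exp_zero_of_radius_pos hrad
  have h1 : ∀ᶠ x in nhds (0 : L), x ∈ Metric.eball 0 (NormedSpace.expSeries ℚ_[p] L).radius :=
    Metric.eball_mem_nhds _ hrad
  have h2 : ∀ᶠ x in nhds (0 : L), x ∈ (hder.toOpenPartialHomeomorph _).source :=
    (hder.toOpenPartialHomeomorph _).open_source.mem_nhds hder.mem_toOpenPartialHomeomorph_source
  have h3 : ∀ᶠ x in nhds (0 : L), ‖NormedSpace.exp x - 1‖ < 1 := by
    have hc : Filter.Tendsto (fun x : L => ‖NormedSpace.exp x - 1‖) (nhds 0) (nhds 0) := by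
      have := hder.continuousAt.sub_const 1 |>.norm
      simpa [ContinuousAt] using this
    exact hc.eventually (gt_mem_nhds one_pos)
  obtain ⟨δ, hδ, hsub⟩ := Metric.eventually_nhds_iff.1 (h1.and (h2.and h3))
  simp only [dist_zero_right] at hsub
  refine ⟨δ, hδ, ?_, ?_, ?_, ?_, ?_⟩
  · intro x y hx hy
    exact NormedSpace.exp_add_of_mem_ball (hsub hx).1 (hsub hy).1
  · intro σ x hx
    refine NormedSpace.map_exp_of_mem_ball (𝕂 := ℚ_[p]) σ ?_ x (hsub hx).1
    exact LinearMap.continuous_of_finiteDimensional σ.toLinearMap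
  · intro x y hx hy hxy
    exact (hder.toOpenPartialHomeomorph _).injOn (hsub hx).2.1 (hsub hy).2.1 hxy
  · intro x hx
    exact (hsub hx).2.2
  · intro η hη
    have hmap := hder.map_nhds_eq_of_equiv
    rw [NormedSpace.exp_zero] at hmap
    have : NormedSpace.exp '' Metric.ball (0 : L) η ∈ nhds (1 : L) := by
      rw [← hmap]
      exact Filter.image_mem_map (Metric.ball_mem_nhds _ hη)
    obtain ⟨ε, hε, hε'⟩ := Metric.mem_nhds_iff.1 this
    refine ⟨ε, hε, fun u hu => ?_⟩
    obtain ⟨x, hx, hxu⟩ := hε' (by simpa [dist_eq_norm] using hu : u ∈ Metric.ball 1 ε)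
    exact ⟨x, by simpa using hx, hxu⟩

/-- An open subgroup of units with trivial Tate cohomology under a cyclic Galois group. -/
theorem exists_trivial_subgroup_units {p : ℕ} [Fact p.Prime] {K L : Type*} [NormedField K]
    [NormedField L] [NormedAlgebra ℚ_[p] K] [NormedAlgebra ℚ_[p] L] [FiniteDimensional ℚ_[p] L]
    [NormedAlgebra K L] [IsScalarTower ℚ_[p] K L] [FiniteDimensional K L] [IsGalois K L]
    {τ : L ≃ₐ[K] L} (hτ : ∀ x, x ∈ Subgroup.zpowers τ) :
    ∃ V : Subgroup Lˣ, (∃ ε > 0, ∀ u : Lˣ, ‖(u : L) - 1‖ < ε → u ∈ V) ∧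
      (∀ u ∈ V, ‖(u : L)‖ = 1) ∧ (∀ u ∈ V, Units.map (τ : L →* L) u ∈ V) ∧
      (∀ u ∈ V, Algebra.norm K (u : L) = 1 → ∃ w ∈ V, τ (w : L) / w = u) ∧
      (∀ u ∈ V, τ (u : L) = u → ∃ w ∈ V, algebraMap K L (Algebra.norm K (w : L)) = u) := by
  classical
  have : IsUltrametricDist L := IsUltrametricDist.of_normedAlgebra ℚ_[p]
  obtain ⟨δ, hδ, hadd, hmap, hinj, hone, hloc⟩ := exists_exp_ball_padic (p := p) (L := L)
  obtain ⟨A, ⟨η, hη, hηA⟩, hAδ, hAτ, hAtr, hAfix⟩ :=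
    exists_trivial_addSubgroup (p := p) hτ hδ
  let f : Multiplicative A →* L :=
    { toFun := fun a => NormedSpace.exp ((Multiplicative.toAdd a : A) : L)
      map_one' := NormedSpace.exp_zero
      map_mul' := fun a b => hadd _ _ (hAδ _ (Multiplicative.toAdd a).2)
        (hAδ _ (Multiplicative.toAdd b).2) }
  have hf : ∀ a (ha : a ∈ A), (f.toHomUnits (Multiplicative.ofAdd ⟨a, ha⟩) : L) =
      NormedSpace.exp a := fun a ha => rfl
  have hV : ∀ u : Lˣ, u ∈ f.toHomUnits.range ↔ ∃ a ∈ A, NormedSpace.exp a = (u : L) := by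
    intro u
    constructor
    · rintro ⟨a, rfl⟩
      exact ⟨_, (Multiplicative.toAdd a).2, rfl⟩
    · rintro ⟨a, ha, hau⟩
      exact ⟨Multiplicative.ofAdd ⟨a, ha⟩, Units.ext hau⟩
  have hτexp : ∀ a ∈ A, τ (NormedSpace.exp a) = NormedSpace.exp (τ a) := fun a ha =>
    hmap (τ.restrictScalars ℚ_[p]) a (hAδ a ha)
  have hnorm : ∀ a ∈ A, ‖algebraMap K L (Algebra.trace K L a)‖ < δ ∧
      algebraMap K L (Algebra.norm K (NormedSpace.exp a)) =
      NormedSpace.exp (algebraMap K L (Algebra.trace K L a)) := by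
    intro a ha
    rw [trace_eq_sum_automorphisms, Algebra.norm_eq_prod_automorphisms]
    have : ∀ s : Finset (L ≃ₐ[K] L), ‖∑ σ ∈ s, σ a‖ < δ ∧
        ∏ σ ∈ s, σ (NormedSpace.exp a) = NormedSpace.exp (∑ σ ∈ s, σ a) := by
      intro s
      induction s using Finset.induction_on with
      | empty => simp [hδ]
      | insert σ s hσ ih =>
        have h1 : ‖σ a‖ < δ := by rw [norm_algEquiv_apply_padic (p := p)]; exact hAδ a ha
        rw [Finset.sum_insert hσ, Finset.prod_insert hσ, ih.2, hadd _ _ h1 ih.1]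
        refine ⟨lt_of_le_of_lt (IsUltrametricDist.norm_add_le_max _ _) (max_lt h1 ih.1), ?_⟩
        exact congrArg (· * _) (hmap (σ.restrictScalars ℚ_[p]) a (hAδ a ha))
    exact this Finset.univ
  refine ⟨f.toHomUnits.range, ?_, ?_, ?_, ?_, ?_⟩
  · obtain ⟨ε, hε, hε'⟩ := hloc η hη
    refine ⟨ε, hε, fun u hu => ?_⟩
    obtain ⟨x, hx, hxu⟩ := hε' u hu
    exact (hV u).2 ⟨x, hηA x hx, hxu⟩
  · intro u hu
    obtain ⟨a, ha, hau⟩ := (hV u).1 hu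
    have := hone a (hAδ a ha)
    rw [hau] at this
    have h2 := IsUltrametricDist.norm_add_eq_max_of_norm_ne_norm
      (x := (u : L) - 1) (y := 1) (by rw [norm_one]; exact this.ne)
    rw [sub_add_cancel, norm_one, max_eq_right this.le] at h2
    exact h2
  · intro u hu
    obtain ⟨a, ha, hau⟩ := (hV u).1 hu
    refine (hV _).2 ⟨τ a, hAτ a ha, ?_⟩
    rw [← hτexp a ha, hau]; rfl
  · intro u hu hu1
    obtain ⟨a, ha, hau⟩ := (hV u).1 hu
    have h1 := (hnorm a ha).2
    rw [hau, hu1, map_one, ← NormedSpace.exp_zero] at h1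
    have h2 := hinj _ _ (by simpa using hδ) (hnorm a ha).1 h1
    have h3 : Algebra.trace K L a = 0 := by
      apply (algebraMap K L).injective; rw [← h2, map_zero]
    obtain ⟨b, hb, hba⟩ := hAtr a ha h3
    refine ⟨f.toHomUnits (Multiplicative.ofAdd ⟨b, hb⟩), ⟨_, rfl⟩, ?_⟩
    have hb0 : NormedSpace.exp b ≠ 0 := (f.toHomUnits (Multiplicative.ofAdd ⟨b, hb⟩)).ne_zero
    rw [hf, hτexp b hb, ← hau, ← hba, div_eq_iff hb0, ← hadd _ _ _ (hAδ b hb), sub_add_cancel]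
    rw [hba]; exact hAδ a ha
  · intro u hu hfix
    obtain ⟨a, ha, hau⟩ := (hV u).1 hu
    have h1 : τ a = a := by
      apply hinj _ _ (hAδ _ (hAτ a ha)) (hAδ a ha)
      rw [← hτexp a ha, hau, hfix]
    obtain ⟨b, hb, hba⟩ := hAfix a ha h1
    refine ⟨f.toHomUnits (Multiplicative.ofAdd ⟨b, hb⟩), ⟨_, rfl⟩, ?_⟩
    rw [hf, (hnorm b hb).2, hba, hau]

theorem finiteIndex_sup_zpowers_of_isOpen {p : ℕ} [Fact p.Prime] {L : Type*} [NormedField L]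
    [NormedAlgebra ℚ_[p] L] [FiniteDimensional ℚ_[p] L] (V : Subgroup Lˣ) {ε : ℝ} (hε : 0 < ε)
    (hV : ∀ u : Lˣ, ‖(u : L) - 1‖ < ε → u ∈ V) (π : Lˣ) (hπ : (π : L) = p) :
    (V ⊔ Subgroup.zpowers π).FiniteIndex := by
  have : ProperSpace L := FiniteDimensional.proper ℚ_[p] L
  have hp1 : (1 : ℝ) < p := by exact_mod_cast (Fact.out : p.Prime).one_lt
  have hp0 : (0 : ℝ) < p := by linarith
  have hcpt : IsCompact {x : L | (p : ℝ)⁻¹ ≤ ‖x‖ ∧ ‖x‖ ≤ 1} := by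
    refine (isCompact_closedBall (0 : L) 1).of_isClosed_subset ?_ ?_
    · exact (isClosed_le continuous_const continuous_norm).inter
        (isClosed_le continuous_norm continuous_const)
    · intro x hx
      simpa using hx.2
  obtain ⟨t, ht, htfin, hcov⟩ := hcpt.finite_cover_balls (e := ε * (p : ℝ)⁻¹) (by positivity)
  have ht0 : ∀ x : t, (x : L) ≠ 0 := by
    intro x hx
    have := (ht x.2).1
    rw [hx, norm_zero] at this
    exact absurd this (not_le.2 (by positivity))
  have : Finite t := htfin
  let f : t → Lˣ ⧸ (V ⊔ Subgroup.zpowers π) := fun x => (Units.mk0 (x : L) (ht0 x) : Lˣ)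
  have hf : Function.Surjective f := by
    intro q
    obtain ⟨g, rfl⟩ := QuotientGroup.mk_surjective q
    obtain ⟨n, hn1, hn2⟩ := exists_mem_Ioc_zpow (x := ‖(g : L)‖) (by simp) hp1
    set h : Lˣ := g * π ^ (n + 1) with hh
    have hnh : ‖(h : L)‖ = ‖(g : L)‖ * ((p : ℝ) ^ (n + 1))⁻¹ := by
      rw [hh, Units.val_mul, norm_mul, Units.val_zpow_eq_zpow_val, norm_zpow, hπ,
        norm_natCast_prime_padic, inv_zpow]
    have hmem : (h : L) ∈ {x : L | (p : ℝ)⁻¹ ≤ ‖x‖ ∧ ‖x‖ ≤ 1} := by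
      constructor
      · rw [hnh, ← div_eq_mul_inv, le_div_iff₀ (by positivity), zpow_add_one₀ hp0.ne']
        field_simp
        exact hn1.le
      · rw [hnh, ← div_eq_mul_inv, div_le_one (by positivity)]
        exact hn2
    have hmem' := hcov hmem
    simp only [Set.mem_iUnion, Metric.mem_ball, exists_prop] at hmem'
    obtain ⟨x, hx, hdist⟩ := hmem'
    refine ⟨⟨x, hx⟩, ?_⟩
    rw [QuotientGroup.eq]
    have h1 : (Units.mk0 x (ht0 ⟨x, hx⟩))⁻¹ * h ∈ V := by
      apply hV
      have h2 : ((((Units.mk0 x (ht0 ⟨x, hx⟩))⁻¹ * h : Lˣ) : L)) - 1 = x⁻¹ * (h - x) := by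
        rw [Units.val_mul, Units.val_inv_eq_inv_val, Units.val_mk0, mul_sub,
          inv_mul_cancel₀ (ht0 ⟨x, hx⟩)]
      rw [h2, norm_mul, norm_inv]
      rw [dist_eq_norm] at hdist
      have h3 : (p : ℝ)⁻¹ ≤ ‖x‖ := (ht hx).1
      have h4 : 0 < ‖x‖ := lt_of_lt_of_le (by positivity) h3
      rw [inv_mul_lt_iff₀ h4]
      calc _ < ε * (p : ℝ)⁻¹ := hdist
        _ ≤ ‖x‖ * ε := by rw [mul_comm]; gcongr
    have h2 : (Units.mk0 x (ht0 ⟨x, hx⟩))⁻¹ * g =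
        ((Units.mk0 x (ht0 ⟨x, hx⟩))⁻¹ * h) * (π ^ (n + 1))⁻¹ := by
      rw [hh]; group
    rw [h2]
    exact Subgroup.mul_mem_sup h1
      (Subgroup.inv_mem _ (Subgroup.zpow_mem _ (Subgroup.mem_zpowers π) _))
  have : Finite (Lˣ ⧸ (V ⊔ Subgroup.zpowers π)) := Finite.of_surjective f hf
  exact Subgroup.finiteIndex_of_finite_quotient

theorem relIndex_zpowers_of_zpow_mem_iff {G : Type*} [CommGroup G] (C : Subgroup G) (ρ : G)
    (M : ℕ) (h : ∀ j : ℤ, ρ ^ j ∈ C ↔ (M : ℤ) ∣ j) :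
    C.relIndex (C ⊔ Subgroup.zpowers ρ) = M := by
  rw [sup_comm, Subgroup.relIndex_sup_right]
  have h1 : Subgroup.zpowers ρ = (zpowersHom G ρ).range := rfl
  rw [h1, ← Subgroup.index_comap]
  have h2 : C.comap (zpowersHom G ρ) = AddSubgroup.toSubgroup (AddSubgroup.zmultiples (M : ℤ)) := by
    ext x
    rw [Subgroup.mem_comap, zpowersHom_apply, h]
    exact Int.mem_zmultiples_iff.symm
  rw [h2, AddSubgroup.index_toSubgroup, Int.index_zmultiples, Int.natAbs_natCast]

/-- The norm index of a cyclic extension in which `p` is the norm of a root of `p`. -/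
theorem index_norm_range_eq_finrank {p : ℕ} [Fact p.Prime] {K L : Type} [NormedField K]
    [NormedField L] [NormedAlgebra ℚ_[p] K] [NormedAlgebra ℚ_[p] L] [FiniteDimensional ℚ_[p] L]
    [NormedAlgebra K L] [IsScalarTower ℚ_[p] K L] [FiniteDimensional K L] [IsGalois K L]
    {τ : L ≃ₐ[K] L} (hτ : ∀ x, x ∈ Subgroup.zpowers τ) {ρ : L}
    (hρ : ρ ^ Module.finrank K L = p) (hρN : Algebra.norm K ρ = p) :
    (Units.map (Algebra.norm K (S := L))).range.index = Module.finrank K L := by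
  classical
  have : IsCyclic (L ≃ₐ[K] L) := ⟨τ, hτ⟩
  obtain ⟨V, ⟨ε, hε, hVε⟩, hV1, hVτ, hVD, hVN⟩ := exists_trivial_subgroup_units (p := p) hτ
  have : CharZero L := charZero_of_injective_algebraMap (algebraMap ℚ_[p] L).injective
  have hp0 : (p : L) ≠ 0 := by exact_mod_cast (Fact.out : p.Prime).ne_zero
  have hM0 : Module.finrank K L ≠ 0 := Module.finrank_pos.ne'
  have hρ0 : ρ ≠ 0 := by
    rintro rfl
    rw [zero_pow hM0] at hρ
    exact hp0 hρ.symm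
  set M := Module.finrank K L with hM
  set π : Lˣ := Units.mk0 (p : L) hp0 with hπ
  set r : Lˣ := Units.mk0 ρ hρ0 with hr
  set T : Lˣ →* Lˣ := Units.map (τ : L →* L) with hT
  set D : Lˣ →* Lˣ := T / MonoidHom.id _ with hD
  set ι : Kˣ →* Lˣ := Units.map (algebraMap K L : K →* L) with hι
  set ν : Lˣ →* Kˣ := Units.map (Algebra.norm K (S := L)) with hν
  set N : Lˣ →* Lˣ := ι.comp ν with hN
  set W := V ⊔ Subgroup.zpowers π with hW
  have : W.FiniteIndex := finiteIndex_sup_zpowers_of_isOpen V hε hVε π rfl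
  have hιinj : Function.Injective ι := Units.map_injective (algebraMap K L).injective
  have hTι : ∀ u, T (ι u) = ι u := fun u => Units.ext (τ.commutes _)
  have hDapp : ∀ g, D g = T g / g := fun g => rfl
  have hNapp : ∀ g, N g = ι (ν g) := fun g => rfl
  have hνT : ∀ g, ν (T g) = ν g := fun g => Units.ext (Algebra.norm_eq_of_algEquiv τ _)
  have hDN : ∀ g, D (N g) = 1 := fun g => by rw [hDapp, hNapp, hTι, div_self']
  have hND : ∀ g, N (D g) = 1 := fun g => by
    rw [hDapp, hNapp, _root_.map_div, hνT, div_self', map_one]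
  have hrM : r ^ M = π := Units.ext ((Units.val_pow_eq_pow_val r M).trans hρ)
  have hπι : ∃ u, ι u = π := by
    refine ⟨Units.mk0 (p : K) ?_, Units.ext (map_natCast (algebraMap K L) p)⟩
    intro h
    apply hp0
    rw [← map_natCast (algebraMap K L), h, map_zero]
  obtain ⟨π₀, hπ₀⟩ := hπι
  have hTπ : T π = π := by rw [← hπ₀, hTι]
  have hNr : N r = π := by
    apply Units.ext
    change algebraMap K L (Algebra.norm K ρ) = _
    rw [hρN, map_natCast]; rfl
  have hWmem : ∀ g, g ∈ W ↔ ∃ v ∈ V, ∃ j : ℤ, v * π ^ j = g := by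
    intro g
    rw [hW, Subgroup.mem_sup]
    simp [Subgroup.mem_zpowers_iff]
  have hVW : V ≤ W := le_sup_left
  have hTpow : ∀ v ∈ V, ∀ σ ∈ Subgroup.zpowers τ, Units.map ((σ : L ≃ₐ[K] L) : L →* L) v ∈ V := by
    intro v hv σ hσ
    rw [← (isOfFinOrder_of_finite τ).mem_powers_iff_mem_zpowers] at hσ
    obtain ⟨i, rfl⟩ := hσ
    induction i with
    | zero =>
      have h0 : Units.map ((τ ^ 0 : L ≃ₐ[K] L) : L →* L) v = v := Units.ext rfl
      exact h0 ▸ hv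
    | succ i ih =>
      have := hVτ _ ih
      have h2 : Units.map ((τ : L ≃ₐ[K] L) : L →* L) (Units.map ((τ ^ i : L ≃ₐ[K] L) : L →* L) v)
          = Units.map ((τ ^ (i + 1) : L ≃ₐ[K] L) : L →* L) v := by
        apply Units.ext; simp [pow_succ']
      rw [← h2]; exact this
  have hNV : ∀ v ∈ V, N v ∈ V := by
    intro v hv
    have : N v = ∏ σ : L ≃ₐ[K] L, Units.map ((σ : L ≃ₐ[K] L) : L →* L) v := by
      apply Units.ext
      rw [Units.coe_prod]
      exact Algebra.norm_eq_prod_automorphisms K (v : L)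
    rw [this]
    exact Subgroup.prod_mem _ fun σ _ => hTpow v hv σ (hτ σ)
  have hNπ : N π = π ^ M := by rw [← hrM, map_pow, hNr, hrM]
  have hDW : W ≤ W.comap D := by
    intro g hg
    obtain ⟨v, hv, j, rfl⟩ := (hWmem g).1 hg
    refine hVW ?_
    rw [map_mul, map_zpow, hDapp π, hTπ, div_self', one_zpow, mul_one]
    exact V.div_mem (hVτ v hv) hv
  have hNW : W ≤ W.comap N := by
    intro g hg
    obtain ⟨v, hv, j, rfl⟩ := (hWmem g).1 hg
    rw [Subgroup.mem_comap, hWmem]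
    refine ⟨N v, hNV v hv, M * j, ?_⟩
    rw [map_mul, map_zpow, hNπ, zpow_mul, zpow_natCast]
  have hιofT : ∀ g, T g = g → ∃ u, ι u = g := by
    intro g hg
    have h1 : ∀ σ : L ≃ₐ[K] L, σ (g : L) = g := by
      have : Subgroup.zpowers τ ≤ MulAction.stabilizer (L ≃ₐ[K] L) (g : L) := by
        rw [Subgroup.zpowers_le]; exact congrArg Units.val hg
      exact fun σ => this (hτ σ)
    obtain ⟨x, hx⟩ := (IsGalois.mem_range_algebraMap_iff_fixed (F := K) (g : L)).2 h1
    refine ⟨Units.mk0 x ?_, Units.ext hx⟩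
    rintro rfl
    exact g.ne_zero (by rw [← hx, map_zero])
  have hnormT : ∀ g, ‖((T g : Lˣ) : L)‖ = ‖(g : L)‖ := fun g =>
    norm_algEquiv_apply_padic (p := p) τ g
  have hπnorm : ‖(π : L)‖ = (p : ℝ)⁻¹ := norm_natCast_prime_padic
  have hπinj : ∀ i j : ℤ, ‖((π ^ i : Lˣ) : L)‖ = ‖((π ^ j : Lˣ) : L)‖ → i = j := by
    intro i j h
    have hp1 : (1 : ℝ) < p := by exact_mod_cast (Fact.out : p.Prime).one_lt
    rw [Units.val_zpow_eq_zpow_val, Units.val_zpow_eq_zpow_val, norm_zpow, norm_zpow, hπnorm] at h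
    exact zpow_right_injective₀ (by positivity) (by simpa using hp1.ne') h
  -- the kernel of `D` modulo `W` comes from the base field
  have hcomapD : W.comap D = W ⊔ ι.range := by
    apply le_antisymm
    · intro g hg
      obtain ⟨v, hv, j, hvj⟩ := (hWmem _).1 hg
      have hj : j = 0 := by
        apply hπinj
        have : ‖((v * π ^ j : Lˣ) : L)‖ = 1 := by
          rw [hvj, hDapp, Units.val_div_eq_div_val, norm_div, hnormT, div_self (by simp)]
        rw [Units.val_mul, norm_mul, hV1 v hv, one_mul] at this
        rw [this]; simp
      rw [hj, zpow_zero, mul_one] at hvj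
      have hNv : Algebra.norm K (v : L) = 1 := by
        have : N v = 1 := by rw [hvj, hND]
        have := hιinj (this.trans (map_one ι).symm)
        exact congrArg Units.val this
      obtain ⟨w, hw, hwv⟩ := hVD v hv hNv
      have hDw : D w = v := by
        apply Units.ext; rw [hDapp, Units.val_div_eq_div_val]; exact hwv
      obtain ⟨u, hu⟩ := hιofT (g / w) (by
        rw [← div_eq_one, ← hDapp, _root_.map_div, hDw, hvj, div_self'])
      have : g = w * ι u := by rw [hu]; simp
      rw [this]
      exact Subgroup.mul_mem_sup (hVW hw) ⟨u, rfl⟩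
    · refine sup_le hDW ?_
      rintro _ ⟨u, rfl⟩
      rw [Subgroup.mem_comap, hDapp, hTι, div_self']
      exact W.one_mem
  have hVfix : ∀ v ∈ V, T v = v → ∃ w ∈ V, N w = v := by
    intro v hv hTv
    obtain ⟨w, hw, hwv⟩ := hVN v hv (congrArg Units.val hTv)
    exact ⟨w, hw, Units.ext hwv⟩
  have hNι : N.range ≤ ι.range := by
    rintro _ ⟨g, rfl⟩
    exact ⟨ν g, rfl⟩
  have hleft : (W ⊔ N.range).relIndex (W.comap D) = ν.range.index := by
    have h1 : W.comap D = ι.range ⊔ (W ⊔ N.range) := by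
      rw [hcomapD, sup_comm ι.range (W ⊔ N.range), sup_assoc W, sup_eq_right.2 hNι]
    have h2 : (W ⊔ N.range) ⊓ ι.range = N.range := by
      apply le_antisymm
      · rintro g ⟨hg, u, rfl⟩
        obtain ⟨w, hw, n, ⟨l, rfl⟩, hwn⟩ := Subgroup.mem_sup.1 hg
        obtain ⟨v, hv, j, rfl⟩ := (hWmem _).1 hw
        have hTv : T v = v := by
          have h3 : v = ι u * (ι (ν l))⁻¹ * (ι π₀ ^ j)⁻¹ := by
            rw [← hwn, ← hNapp, hπ₀]; simp
          rw [h3]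
          simp only [map_mul, map_inv, map_zpow, hTι]
        obtain ⟨v', hv', rfl⟩ := hVfix v hv hTv
        refine ⟨v' * r ^ j * l, ?_⟩
        rw [← hwn, map_mul, map_mul, map_zpow, hNr]
      · exact le_inf le_sup_right hNι
    rw [h1, Subgroup.relIndex_sup_right, ← Subgroup.inf_relIndex_right, h2, ← Subgroup.index_comap]
    congr 1
    ext u
    rw [Subgroup.mem_comap]
    constructor
    · rintro ⟨g, hg⟩
      exact ⟨g, hιinj hg⟩
    · rintro ⟨g, rfl⟩
      exact ⟨g, rfl⟩
  have hcomapN : W.comap N = (W ⊔ D.range) ⊔ Subgroup.zpowers r := by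
    apply le_antisymm
    · intro g hg
      obtain ⟨v, hv, j, hvj⟩ := (hWmem _).1 hg
      have hTv : T v = v := by
        have h3 : v = ι (ν g) * (ι π₀ ^ j)⁻¹ := by
          rw [← hNapp, ← hvj, hπ₀]; simp
        rw [h3]
        simp only [map_mul, map_inv, map_zpow, hTι]
      obtain ⟨v', hv', rfl⟩ := hVfix v hv hTv
      have h4 : N (v' * r ^ j / g) = 1 := by
        rw [_root_.map_div, map_mul, map_zpow, hNr, hvj, div_self']
      have h5 : Algebra.norm K ((v' * r ^ j / g : Lˣ) : L) = 1 :=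
        congrArg Units.val (hιinj (h4.trans (map_one ι).symm))
      obtain ⟨y, hy⟩ := groupCohomology.exists_div_of_norm_eq_one hτ h5
      have h6 : D y = (v' * r ^ j / g)⁻¹ := by
        rw [← inv_inj, inv_inv]
        apply Units.ext
        rw [← hy, hDapp, inv_div, Units.val_div_eq_div_val]
        rfl
      have h7 : g = v' * D y * r ^ j := by
        rw [h6]; simp [div_eq_mul_inv, mul_comm, mul_left_comm]
      rw [h7]
      exact Subgroup.mul_mem_sup (Subgroup.mul_mem_sup (hVW hv') ⟨y, rfl⟩)
        (Subgroup.zpow_mem _ (Subgroup.mem_zpowers r) _)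
    · refine sup_le (sup_le hNW ?_) ?_
      · rintro _ ⟨y, rfl⟩
        rw [Subgroup.mem_comap, hND]
        exact W.one_mem
      · rw [Subgroup.zpowers_le, Subgroup.mem_comap, hNr]
        exact Subgroup.mem_sup_right (Subgroup.mem_zpowers π)
  have hright : (W ⊔ D.range).relIndex (W.comap N) = M := by
    rw [hcomapN]
    apply relIndex_zpowers_of_zpow_mem_iff
    intro j
    constructor
    · intro h
      obtain ⟨w, hw, _, ⟨y, rfl⟩, hwy⟩ := Subgroup.mem_sup.1 h
      obtain ⟨v, hv, i, rfl⟩ := (hWmem _).1 hw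
      have h1 := congrArg N hwy
      rw [map_mul, hND, mul_one, map_mul, map_zpow, map_zpow, hNπ, hNr] at h1
      refine ⟨i, (hπinj _ _ ?_).symm⟩
      rw [← h1, Units.val_mul, norm_mul, hV1 _ (hNV v hv), one_mul, ← zpow_natCast, ← zpow_mul]
    · rintro ⟨i, rfl⟩
      rw [zpow_mul, zpow_natCast, hrM]
      exact Subgroup.mem_sup_left (Subgroup.mem_sup_right
        (Subgroup.zpow_mem _ (Subgroup.mem_zpowers π) _))
  rw [← hleft, ← hright]
  exact Subgroup.relIndex_sup_range_comap_eq W D N hDW hNW hDN hND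

/-- The element `u` of `K` is a norm from `K(ρ)`. -/
def IsNormFromAdjoin (K : Type) {Ω : Type} [Field K] [Field Ω] [Algebra K Ω] (ρ : Ω) (u : K) :
    Prop :=
  ∃ z : IntermediateField.adjoin K {ρ}, Algebra.norm K z = u

theorem IntermediateField.adjoin_gen_eq_top (K : Type*) {Ω : Type*} [Field K] [Field Ω]
    [Algebra K Ω] (ρ : Ω) : K⟮AdjoinSimple.gen K ρ⟯ = ⊤ := by
  apply IntermediateField.lift_injective
  rw [lift_adjoin_simple, lift_top, AdjoinSimple.coe_gen]

theorem exists_generator_of_X_pow_sub_C {K L : Type*} [Field K] [Field L] [Algebra K L] {M : ℕ}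
    {ζ : K} (hζ : IsPrimitiveRoot ζ M) {c : K} (hirr : Irreducible (X ^ M - C c)) {α : L}
    (hα : α ^ M = algebraMap K L c) (htop : K⟮α⟯ = ⊤) :
    FiniteDimensional K L ∧ IsGalois K L ∧ Module.finrank K L = M ∧
      Algebra.norm K α = (-1) ^ (M + 1) * c ∧
      ∃ τ : L ≃ₐ[K] L, (∀ x, x ∈ Subgroup.zpowers τ) ∧ τ α = algebraMap K L ζ * α := by
  have hM0 : M ≠ 0 := ne_zero_of_irreducible_X_pow_sub_C hirr
  have hM : 0 < M := Nat.pos_of_ne_zero hM0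
  have : NeZero M := ⟨hM0⟩
  have hne : (primitiveRoots M K).Nonempty := ⟨ζ, (mem_primitiveRoots hM).2 hζ⟩
  have hroot : aeval α (X ^ M - C c) = 0 := by
    simp [hα]
  have hmin : minpoly K α = X ^ M - C c :=
    (minpoly.eq_of_irreducible_of_monic hirr hroot (monic_X_pow_sub_C _ hM0)).symm
  have hintegral : IsIntegral K α := ⟨_, monic_X_pow_sub_C c hM0, by simpa [aeval_def] using hroot⟩
  have hdim : Module.finrank K L = M := by
    rw [← finrank_top', ← htop, adjoin.finrank hintegral, hmin, natDegree_X_pow_sub_C]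
  have hfin : FiniteDimensional K L := FiniteDimensional.of_finrank_pos (hdim ▸ hM)
  have hne' : (primitiveRoots (Module.finrank K L) K).Nonempty := by rwa [hdim]
  have hsplit : IsSplittingField K L (X ^ M - C c) := by
    have := isSplittingField_X_pow_sub_C_of_root_adjoin_eq_top (a := c) hne'
      (by rw [hdim]; exact hα) htop
    rwa [hdim] at this
  refine ⟨hfin, isGalois_of_isSplittingField_X_pow_sub_C hne hirr L, hdim, ?_, ?_⟩
  · have hat : Algebra.adjoin K {α} = ⊤ := by
      rw [← adjoin_simple_toSubalgebra_of_isAlgebraic hintegral.isAlgebraic, htop, top_toSubalgebra]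
    have h := Algebra.PowerBasis.norm_gen_eq_coeff_zero_minpoly
      ((Algebra.adjoin.powerBasis hintegral).map
        ((Subalgebra.equivOfEq _ _ hat).trans Subalgebra.topEquiv))
    simp only [PowerBasis.map_gen, PowerBasis.map_dim] at h
    have h1 : ((Subalgebra.equivOfEq _ _ hat).trans Subalgebra.topEquiv)
        (Algebra.adjoin.powerBasis hintegral).gen = α := rfl
    rw [h1, Algebra.adjoin.powerBasis_dim, hmin, natDegree_X_pow_sub_C] at h
    rw [h, pow_succ]
    simp [hM0.symm]
  · refine ⟨(autEquivZmod hirr L hζ).symm (Multiplicative.ofAdd 1), ?_, ?_⟩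
    · intro σ
      obtain ⟨m, rfl⟩ := (autEquivZmod hirr L hζ).symm.surjective σ
      refine ⟨(Multiplicative.toAdd m).val, ?_⟩
      dsimp only
      rw [zpow_natCast, ← map_pow, ← ofAdd_nsmul]
      congr 1
      simp
    · have := autEquivZmod_symm_apply_natCast hirr L hα hζ 1
      simpa [Algebra.smul_def] using this

theorem prod_univ_eq_prod_range_orderOf {G R : Type*} [Group G] [Fintype G] [CommMonoid R] {τ : G}
    (hτ : ∀ x, x ∈ Subgroup.zpowers τ) (f : G → R) :
    ∏ g, f g = ∏ i ∈ Finset.range (Fintype.card G), f (τ ^ i) := by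
  classical
  rw [← Nat.card_eq_fintype_card, ← orderOf_eq_card_of_forall_mem_zpowers hτ]
  symm
  refine Finset.prod_bij (fun i _ => τ ^ i) (by simp) ?_ ?_ (by simp)
  · intro i hi j hj h
    exact pow_injOn_Iio_orderOf (by simpa using hi) (by simpa using hj) h
  · intro g _
    have := hτ g
    rw [← (isOfFinOrder_of_finite τ).mem_powers_iff_mem_zpowers,
      (isOfFinOrder_of_finite τ).mem_powers_iff_mem_range_orderOf] at this
    simpa using this

theorem norm_eq_prod_range_pow {K L : Type*} [Field K] [Field L] [Algebra K L]
    [FiniteDimensional K L] [IsGalois K L] {τ : L ≃ₐ[K] L} (hτ : ∀ x, x ∈ Subgroup.zpowers τ)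
    (z : L) :
    algebraMap K L (Algebra.norm K z) = ∏ i ∈ Finset.range (Module.finrank K L), (τ ^ i) z := by
  rw [Algebra.norm_eq_prod_automorphisms, prod_univ_eq_prod_range_orderOf hτ,
    ← Nat.card_eq_fintype_card, IsGalois.card_aut_eq_finrank]

theorem pow_apply_aeval_of_apply_eq_mul {K L : Type*} [Field K] [Field L] [Algebra K L]
    {τ : L ≃ₐ[K] L} {ζ : K} {α : L} (h : τ α = algebraMap K L ζ * α) (i : ℕ) (f : K[X]) :
    (τ ^ i) (aeval α f) = aeval (algebraMap K L (ζ ^ i) * α) f := by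
  have h1 : ∀ i : ℕ, (τ ^ i) α = algebraMap K L (ζ ^ i) * α := by
    intro i
    induction i with
    | zero => simp
    | succ i ih =>
      rw [pow_succ', AlgEquiv.mul_apply, ih, map_mul, h, AlgEquiv.commutes, pow_succ, map_mul]
      ring
  rw [← aeval_algHom_apply (τ ^ i : L ≃ₐ[K] L), h1]

theorem exists_generator_adjoin {K Ω : Type*} [Field K] [Field Ω] [Algebra K Ω] {M : ℕ}
    {ζ : K} (hζ : IsPrimitiveRoot ζ M) {c : K} (hirr : Irreducible (X ^ M - C c)) {ρ : Ω}
    (hρ : ρ ^ M = algebraMap K Ω c) :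
    FiniteDimensional K K⟮ρ⟯ ∧ IsGalois K K⟮ρ⟯ ∧ Module.finrank K K⟮ρ⟯ = M ∧
      Algebra.norm K (AdjoinSimple.gen K ρ) = (-1) ^ (M + 1) * c ∧
      ∃ τ : K⟮ρ⟯ ≃ₐ[K] K⟮ρ⟯, (∀ x, x ∈ Subgroup.zpowers τ) ∧
        τ (AdjoinSimple.gen K ρ) = algebraMap K K⟮ρ⟯ ζ * AdjoinSimple.gen K ρ :=
  exists_generator_of_X_pow_sub_C hζ hirr (Subtype.ext hρ) (adjoin_gen_eq_top K ρ)

theorem norm_adjoin_eq_prod {K Ω : Type*} [Field K] [Field Ω] [Algebra K Ω] {M : ℕ}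
    {ζ : K} (hζ : IsPrimitiveRoot ζ M) {c : K} (hirr : Irreducible (X ^ M - C c)) {ρ : Ω}
    (hρ : ρ ^ M = algebraMap K Ω c) (f : K[X]) :
    algebraMap K Ω (Algebra.norm K (aeval (AdjoinSimple.gen K ρ) f)) =
      ∏ i ∈ Finset.range M, aeval (algebraMap K Ω (ζ ^ i) * ρ) f := by
  obtain ⟨h1, h2, h3, -, τ, hτ, hτρ⟩ := exists_generator_adjoin hζ hirr hρ
  rw [IsScalarTower.algebraMap_apply K K⟮ρ⟯ Ω, norm_eq_prod_range_pow hτ, h3, map_prod]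
  refine Finset.prod_congr rfl fun i _ => ?_
  rw [pow_apply_aeval_of_apply_eq_mul hτρ, ← aeval_algebraMap_apply, map_mul,
    ← IsScalarTower.algebraMap_apply]
  rfl

theorem exists_hilbert90_pow {K L : Type} [Field K] [Field L] [Algebra K L]
    [FiniteDimensional K L] [IsGalois K L] {τ : L ≃ₐ[K] L} (hτ : ∀ x, x ∈ Subgroup.zpowers τ)
    {r q : ℕ} (hrq : Module.finrank K L = r * q) {x : L}
    (hx : ∏ j ∈ Finset.range r, ((τ ^ q) ^ j) x = 1) : ∃ y : Lˣ, (y : L) / (τ ^ q) y = x := by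
  set σ := τ ^ q with hσ
  have hpos : 0 < r * q := hrq ▸ Module.finrank_pos
  have hq : 0 < q := Nat.pos_of_mul_pos_left hpos
  let K₁ := fixedField (Subgroup.zpowers σ)
  have hfix : K₁.fixingSubgroup = Subgroup.zpowers σ := fixingSubgroup_fixedField _
  have hmem : σ ∈ K₁.fixingSubgroup := by rw [hfix]; exact Subgroup.mem_zpowers σ
  let s : L ≃ₐ[K₁] L := fixingSubgroupEquiv K₁ ⟨σ, hmem⟩
  have hs : ∀ g, g ∈ Subgroup.zpowers s := by
    intro g
    obtain ⟨⟨g, hg⟩, rfl⟩ := (fixingSubgroupEquiv K₁).surjective g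
    have hg' := hg
    rw [hfix] at hg'
    obtain ⟨i, rfl⟩ := hg'
    refine ⟨i, ?_⟩
    dsimp only [s]
    rw [← map_zpow]
    rfl
  have hord : orderOf σ = r := by
    have hτM : orderOf τ = r * q := by
      rw [orderOf_eq_card_of_forall_mem_zpowers hτ, IsGalois.card_aut_eq_finrank, hrq]
    rw [hσ, orderOf_pow' _ hq.ne', hτM, Nat.gcd_mul_left_left, Nat.mul_div_cancel _ hq]
  have hdim : Module.finrank K₁ L = r := by
    rw [finrank_fixedField_eq_card, Nat.card_zpowers, hord]
  have : IsCyclic (L ≃ₐ[K₁] L) := ⟨s, hs⟩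
  have hspow : ∀ (j : ℕ) (y : L), (s ^ j) y = (σ ^ j) y := by
    intro j y
    dsimp only [s]
    rw [← map_pow]
    rfl
  have hN : Algebra.norm K₁ x = 1 := by
    apply (algebraMap K₁ L).injective
    rw [norm_eq_prod_range_pow hs, hdim, map_one, ← hx]
    exact Finset.prod_congr rfl fun j _ => hspow j x
  obtain ⟨y, hy⟩ := groupCohomology.exists_div_of_norm_eq_one hs hN
  exact ⟨y, hy⟩

theorem exists_aeval_pow_eq_of_sum {K L : Type*} [Field K] [Field L] [Algebra K L] {p : ℕ}
    (hp : p.Prime) {ω : K} (hω : IsPrimitiveRoot ω p) (α : L) (f : K[X]) :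
    ∃ g : K[X], ∑ j ∈ Finset.range p, aeval (algebraMap K L (ω ^ j) * α) f =
      p * aeval (α ^ p) g := by
  induction f using Polynomial.induction_on' with
  | add f₁ f₂ h₁ h₂ =>
    obtain ⟨g₁, h₁⟩ := h₁
    obtain ⟨g₂, h₂⟩ := h₂
    refine ⟨g₁ + g₂, ?_⟩
    simp only [map_add, Finset.sum_add_distrib, h₁, h₂, mul_add]
  | monomial n a =>
    have key : ∀ j, aeval (algebraMap K L (ω ^ j) * α) (monomial n a) =
        algebraMap K L (a * (ω ^ n) ^ j) * α ^ n := by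
      intro j
      rw [aeval_monomial, map_mul, mul_pow, ← map_pow, pow_right_comm, mul_assoc]
    simp only [key, ← Finset.sum_mul, ← map_sum, ← Finset.mul_sum]
    by_cases hn : p ∣ n
    · obtain ⟨k, rfl⟩ := hn
      refine ⟨monomial k a, ?_⟩
      rw [pow_mul ω, hω.pow_eq_one, aeval_monomial, pow_mul α]
      simp
      ring
    · refine ⟨0, ?_⟩
      have hc : n.Coprime p := ((Nat.Prime.coprime_iff_not_dvd hp).2 hn).symm
      have := (hω.pow_of_coprime n hc).geom_sum_eq_zero hp.one_lt
      rw [this]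
      simp

theorem prod_range_mul {M : Type*} [CommMonoid M] (f : ℕ → M) (q r : ℕ) :
    ∏ i ∈ Finset.range (q * r), f i =
      ∏ j ∈ Finset.range r, ∏ i ∈ Finset.range q, f (q * j + i) := by
  induction r with
  | zero => simp
  | succ r ih => rw [mul_add_one, Finset.prod_range_add, ih, Finset.prod_range_succ]

theorem isNormFromAdjoin_pow_of_pow {K Ω : Type} [Field K] [Field Ω] [Algebra K Ω] {p q : ℕ}
    (hp : p.Prime) (hp0 : (p : K) ≠ 0) {ζ : K} (hζ : IsPrimitiveRoot ζ (p * q)) {c : K}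
    (hirr : Irreducible (X ^ (p * q) - C c)) {ρ : Ω} (hρ : ρ ^ (p * q) = algebraMap K Ω c) {u : K}
    (hu : u ≠ 0) (h : IsNormFromAdjoin K ρ (u ^ p)) : IsNormFromAdjoin K (ρ ^ p) u := by
  obtain ⟨z, hz⟩ := h
  obtain ⟨h1, h2, h3, -, τ, hτ, hτρ⟩ := exists_generator_adjoin hζ hirr hρ
  set α := AdjoinSimple.gen K ρ with hα
  have hpq : 0 < p * q := h3 ▸ Module.finrank_pos
  have hq : 0 < q := Nat.pos_of_mul_pos_left hpq
  have hu' : algebraMap K K⟮ρ⟯ u ≠ 0 := by simpa using hu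
  set c' : K⟮ρ⟯ := ∏ i ∈ Finset.range q, (τ ^ i) z with hc'
  have hnorm : ∏ j ∈ Finset.range p, ((τ ^ q) ^ j) c' = algebraMap K K⟮ρ⟯ u ^ p := by
    rw [← map_pow, ← hz, norm_eq_prod_range_pow hτ, h3, mul_comm p q]
    simp only [hc', map_prod]
    rw [prod_range_mul]
    refine Finset.prod_congr rfl fun j _ => Finset.prod_congr rfl fun i _ => ?_
    rw [pow_add, AlgEquiv.mul_apply, pow_mul', ← pow_mul, ← pow_mul, mul_comm]
  have hH : ∏ j ∈ Finset.range p, ((τ ^ q) ^ j) (c' / algebraMap K K⟮ρ⟯ u) = 1 := by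
    simp only [map_div₀, AlgEquiv.commutes, Finset.prod_div_distrib, hnorm]
    simp [hu]
  obtain ⟨y, hy⟩ := exists_hilbert90_pow hτ h3 hH
  have hy0 : (y : K⟮ρ⟯) ≠ 0 := y.ne_zero
  have hτy0 : ∀ i, (τ ^ i) (y : K⟮ρ⟯) ≠ 0 := fun i => (map_ne_zero_iff _ (τ ^ i).injective).2 hy0
  set z' : K⟮ρ⟯ := z * (τ y / y) with hz'
  have hprod : ∏ i ∈ Finset.range q, (τ ^ i) z' = algebraMap K K⟮ρ⟯ u := by
    have h4 : ∏ i ∈ Finset.range q, (τ ^ i) (τ (y : K⟮ρ⟯) / y) = (τ ^ q) (y : K⟮ρ⟯) / y := by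
      have := Finset.prod_range_div (fun i => Units.mk0 _ (hτy0 i)) q
      have := congrArg Units.val this
      rw [Units.coe_prod] at this
      simp only [Units.val_div_eq_div_val, Units.val_mk0, pow_zero, AlgEquiv.one_apply] at this
      rw [← this]
      refine Finset.prod_congr rfl fun i _ => ?_
      rw [map_div₀, pow_succ, AlgEquiv.mul_apply]
    simp only [hz', map_mul, Finset.prod_mul_distrib, h4, ← hc']
    rw [eq_div_iff hu'] at hy
    rw [← hy]
    field_simp [hτy0 q]
    exact div_self (hτy0 q)
  have hz0 : z' ≠ 0 := by
    intro h0
    apply hu'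
    rw [← hprod, h0]
    simp [Finset.prod_const, hq.ne']
  have hfix : (τ ^ q) z' = z' := by
    have h5 : τ (∏ i ∈ Finset.range q, (τ ^ i) z') = ∏ i ∈ Finset.range q, (τ ^ i) z' := by
      rw [hprod, AlgEquiv.commutes]
    have h6 : τ (∏ i ∈ Finset.range q, (τ ^ i) z') = ∏ i ∈ Finset.range q, (τ ^ (i + 1)) z' := by
      rw [map_prod]
      exact Finset.prod_congr rfl fun i _ => by rw [pow_succ', AlgEquiv.mul_apply]
    have h7 := Finset.prod_range_succ' (fun i => (τ ^ i) z') q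
    rw [Finset.prod_range_succ, ← h6, h5] at h7
    simpa using mul_left_cancel₀ (by rw [hprod]; exact hu') h7
  have hfix' : ∀ j : ℕ, ((τ ^ q) ^ j) z' = z' := by
    intro j
    induction j with
    | zero => simp
    | succ j ih => rw [pow_succ, AlgEquiv.mul_apply, hfix, ih]
  obtain ⟨f, hf⟩ : ∃ f : K[X], z' = aeval α f := by
    have hintegral : IsIntegral K ρ := by
      have := IsIntegral.of_finite K α
      exact this.map (IsScalarTower.toAlgHom K K⟮ρ⟯ Ω)
    exact (adjoin.powerBasis hintegral).exists_eq_aeval' z'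
  have hω : IsPrimitiveRoot (ζ ^ q) p := hζ.pow hpq (mul_comm p q)
  obtain ⟨g, hg⟩ := exists_aeval_pow_eq_of_sum hp hω α f
  have hsum : ∑ j ∈ Finset.range p, aeval (algebraMap K K⟮ρ⟯ ((ζ ^ q) ^ j) * α) f = p * z' := by
    calc _ = ∑ j ∈ Finset.range p, z' := by
          refine Finset.sum_congr rfl fun j _ => ?_
          rw [← pow_mul, ← pow_apply_aeval_of_apply_eq_mul hτρ, ← hf, pow_mul, hfix']
      _ = p * z' := by simp
  have hp0' : (p : K⟮ρ⟯) ≠ 0 := by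
    rw [← map_natCast (algebraMap K K⟮ρ⟯)]
    exact (_root_.map_ne_zero _).2 hp0
  have hgz : z' = aeval (α ^ p) g := mul_left_cancel₀ hp0' (hsum.symm.trans hg)
  have hirr' : Irreducible (X ^ q - C c) := by
    apply of_irreducible_expand hp.ne_zero
    simpa [pow_mul] using hirr
  refine ⟨aeval (AdjoinSimple.gen K (ρ ^ p)) g, ?_⟩
  apply (algebraMap K Ω).injective
  rw [norm_adjoin_eq_prod (hζ.pow hpq rfl) hirr' (by rw [← pow_mul]; exact hρ),
    IsScalarTower.algebraMap_apply K K⟮ρ⟯ Ω, ← hprod, map_prod]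
  refine Finset.prod_congr rfl fun i _ => ?_
  have h8 : z' = aeval α (expand K p g) := by rw [expand_aeval, hgz]
  rw [h8, pow_apply_aeval_of_apply_eq_mul hτρ, expand_aeval, ← aeval_algebraMap_apply]
  congr 2
  rw [map_pow (algebraMap K⟮ρ⟯ Ω), map_mul (algebraMap K⟮ρ⟯ Ω), mul_pow,
    ← IsScalarTower.algebraMap_apply, ← map_pow, pow_right_comm]
  rfl

section

theorem exists_norm_sum_eq_of_norm_ne {L ι : Type*} [NormedField L] [IsUltrametricDist L]
    (s : Finset ι) (f : ι → L)
    (h : ∀ i ∈ s, ∀ j ∈ s, i ≠ j → f i ≠ 0 → ‖f i‖ ≠ ‖f j‖) :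
    (∀ i ∈ s, f i = 0) ∨
      ∃ i ∈ s, f i ≠ 0 ∧ ‖∑ j ∈ s, f j‖ = ‖f i‖ ∧ ∀ j ∈ s, ‖f j‖ ≤ ‖f i‖ := by
  classical
  induction s using Finset.induction_on with
  | empty => simp
  | insert a s ha ih =>
    rw [Finset.sum_insert ha]
    by_cases h0 : f a = 0
    · rcases ih fun i hi j hj => h i (by simp [hi]) j (by simp [hj]) with h1 | ⟨i, hi, h1, h2, h3⟩
      · left
        simp only [Finset.mem_insert, forall_eq_or_imp]
        exact ⟨h0, h1⟩
      · right
        refine ⟨i, by simp [hi], h1, by rw [h0, zero_add, h2], ?_⟩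
        simp only [Finset.mem_insert, forall_eq_or_imp]
        exact ⟨by simp [h0], h3⟩
    · right
      rcases ih fun i hi j hj => h i (by simp [hi]) j (by simp [hj]) with h1 | ⟨i, hi, h1, h2, h3⟩
      · refine ⟨a, by simp, h0, by rw [Finset.sum_eq_zero h1, add_zero], ?_⟩
        simp only [Finset.mem_insert, forall_eq_or_imp, le_refl, true_and]
        intro j hj
        simp [h1 j hj]
      · have hne : ‖f a‖ ≠ ‖f i‖ := h a (by simp) i (by simp [hi]) (by rintro rfl; exact ha hi) h0
        have hmax : ‖f a + ∑ j ∈ s, f j‖ = max ‖f a‖ ‖f i‖ := by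
          rw [IsUltrametricDist.norm_add_eq_max_of_norm_ne_norm (by rwa [h2]), h2]
        rcases lt_or_gt_of_ne hne with hlt | hlt
        · refine ⟨i, by simp [hi], h1, by rw [hmax, max_eq_right hlt.le], ?_⟩
          simp only [Finset.mem_insert, forall_eq_or_imp]
          exact ⟨hlt.le, h3⟩
        · refine ⟨a, by simp, h0, by rw [hmax, max_eq_left hlt.le], ?_⟩
          simp only [Finset.mem_insert, forall_eq_or_imp, le_refl, true_and]
          exact fun j hj => (h3 j hj).trans hlt.le

theorem norm_aeval_of_forall_norm_eq_zpow {k L : Type*} [Field k] [NormedField L]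
    [IsUltrametricDist L] [Algebra k L] {N : ℕ} {x : L} (hx0 : x ≠ 0) (hx1 : ‖x‖ < 1)
    (hk : ∀ c : k, c ≠ 0 → ∃ j : ℤ, ‖algebraMap k L c‖ = (‖x‖ ^ N) ^ j) {f : k[X]}
    (hf : f.natDegree < N) :
    (∀ i, ‖algebraMap k L (f.coeff i)‖ * ‖x‖ ^ i ≤ ‖aeval x f‖) ∧
      (f ≠ 0 → ∃ j : ℤ, ‖aeval x f‖ = ‖x‖ ^ j) := by
  have hpos : 0 < ‖x‖ := norm_pos_iff.2 hx0
  have hval : ∀ i, f.coeff i ≠ 0 →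
      ∃ j : ℤ, ‖algebraMap k L (f.coeff i) * x ^ i‖ = ‖x‖ ^ (N * j + i) := by
    intro i hi
    obtain ⟨j, hj⟩ := hk _ hi
    refine ⟨j, ?_⟩
    rw [norm_mul, hj, norm_pow, zpow_add₀ hpos.ne', zpow_mul, zpow_natCast, zpow_natCast]
  have hsum : aeval x f = ∑ i ∈ Finset.range N, algebraMap k L (f.coeff i) * x ^ i := by
    rw [aeval_eq_sum_range' hf]
    simp only [Algebra.smul_def]
  have hdist := exists_norm_sum_eq_of_norm_ne (Finset.range N)
    (fun i => algebraMap k L (f.coeff i) * x ^ i) (by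
      intro i hi j hj hij h0 heq
      have hi0 : f.coeff i ≠ 0 := by rintro h; simp [h] at h0
      have hj0 : f.coeff j ≠ 0 := by
        intro h
        simp only [h, map_zero, zero_mul, norm_zero, norm_eq_zero] at heq
        exact h0 heq
      obtain ⟨a, ha⟩ := hval i hi0
      obtain ⟨b, hb⟩ := hval j hj0
      rw [ha, hb] at heq
      have := zpow_right_injective₀ hpos hx1.ne heq
      rw [Finset.mem_range] at hi hj
      have h1 : (i : ℤ) % N = j % N := by
        have := congrArg (· % (N : ℤ)) this
        simpa using this
      rw [Int.emod_eq_of_lt (by omega) (by omega), Int.emod_eq_of_lt (by omega) (by omega)] at h1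
      exact hij (by exact_mod_cast h1))
  rw [← hsum] at hdist
  rcases hdist with h1 | ⟨i, hi, h1, h2, h3⟩
  · have hf0 : f = 0 := by
      ext i
      rcases lt_or_ge i N with hi | hi
      · have := h1 i (Finset.mem_range.2 hi)
        simpa [hx0] using this
      · rw [coeff_eq_zero_of_natDegree_lt (by omega), coeff_zero]
    simp [hf0]
  · refine ⟨fun j => ?_, fun _ => ?_⟩
    · rcases lt_or_ge j N with hj | hj
      · have := h3 j (Finset.mem_range.2 hj)
        rw [h2]
        simpa using this
      · rw [coeff_eq_zero_of_natDegree_lt (by omega)]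
        simp
    · obtain ⟨j, hj⟩ := hval i (by rintro h; simp [h] at h1)
      exact ⟨_, h2.trans hj⟩

theorem exists_aeval_one_sub_eq {k L : Type*} [Field k] [Field L] [Algebra k L] {ζ : L}
    (htop : k⟮ζ⟯ = ⊤) {g : k[X]} (hg : g.Monic) (hg0 : 0 < g.natDegree) (hroot : aeval ζ g = 0)
    (x : L) : ∃ f : k[X], f.natDegree < g.natDegree ∧ x = aeval (1 - ζ) f := by
  have hintegral : IsIntegral k ζ := ⟨g, hg, by simpa [aeval_def] using hroot⟩
  have hx : x ∈ Algebra.adjoin k {ζ} := by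
    rw [← adjoin_simple_toSubalgebra_of_isAlgebraic hintegral.isAlgebraic, htop]
    trivial
  rw [Algebra.adjoin_singleton_eq_range_aeval] at hx
  obtain ⟨h, rfl⟩ := hx
  refine ⟨(h %ₘ g).comp (1 - X), ?_, ?_⟩
  · calc _ ≤ (h %ₘ g).natDegree * (1 - X : k[X]).natDegree := natDegree_comp_le
      _ = (h %ₘ g).natDegree := by
        rw [← neg_sub X (1 : k[X]), natDegree_neg, ← C_1, natDegree_X_sub_C, mul_one]
      _ < _ := natDegree_modByMonic_lt h hg (by rintro rfl; simp at hg0)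
  · rw [aeval_comp]
    simp only [map_sub, map_one, aeval_X, sub_sub_cancel]
    exact (aeval_modByMonic_eq_self_of_root hroot).symm

theorem norm_one_sub_le_of_mem_zpowers {L : Type*} [NormedField L] [IsUltrametricDist L] {ζ : L}
    (hζ : ‖ζ‖ ≤ 1) (i : ℕ) : ‖1 - ζ ^ i‖ ≤ ‖1 - ζ‖ := by
  rw [← mul_neg_geom_sum, norm_mul]
  refine mul_le_of_le_one_right (norm_nonneg _) ?_
  refine IsUltrametricDist.norm_sum_le_of_forall_le_of_nonneg zero_le_one fun j _ => ?_
  rw [norm_pow]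
  exact pow_le_one₀ (norm_nonneg _) hζ

theorem norm_eq_one_of_pow_eq_one' {L : Type*} [NormedField L] {ζ : L} {N : ℕ} (hN : N ≠ 0)
    (h : ζ ^ N = 1) : ‖ζ‖ = 1 := by
  have := congrArg norm h
  rw [norm_pow, norm_one] at this
  exact (pow_eq_one_iff_of_nonneg (norm_nonneg _) hN).1 this

theorem norm_one_sub_pow_of_isPrimitiveRoot {p : ℕ} [Fact p.Prime] {L : Type*} [NormedField L]
    [IsUltrametricDist L] {k : ℕ} {ζ : L} (hζ : IsPrimitiveRoot ζ (p ^ (k + 1))) :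
    ‖1 - ζ‖ ^ (p ^ k * (p - 1)) = ‖(p : L)‖ := by
  have hp : p.Prime := Fact.out
  have hN : p ^ (k + 1) ≠ 0 := (pow_pos hp.pos _).ne'
  have : NeZero (p ^ (k + 1)) := ⟨hN⟩
  have h1 := congrArg (Polynomial.eval 1) (cyclotomic_eq_prod_X_sub_primitiveRoots hζ)
  rw [eval_one_cyclotomic_prime_pow, eval_prod] at h1
  rw [h1, norm_prod]
  rw [Finset.prod_congr rfl (g := fun _ => ‖1 - ζ‖)]
  · rw [Finset.prod_const, hζ.card_primitiveRoots, Nat.totient_prime_pow_succ hp]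
  · intro μ hμ
    have hμ' := isPrimitiveRoot_of_mem_primitiveRoots hμ
    obtain ⟨i, -, hi⟩ := hζ.eq_pow_of_pow_eq_one hμ'.pow_eq_one
    obtain ⟨j, -, hj⟩ := hμ'.eq_pow_of_pow_eq_one hζ.pow_eq_one
    simp only [eval_sub, eval_X, eval_C]
    apply le_antisymm
    · rw [← hi]
      exact norm_one_sub_le_of_mem_zpowers (norm_eq_one_of_pow_eq_one' hN hζ.pow_eq_one).le i
    · rw [← hj]
      exact norm_one_sub_le_of_mem_zpowers (norm_eq_one_of_pow_eq_one' hN hμ'.pow_eq_one).le j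

end

section

theorem norm_sub_le_max_of_ultrametric {L : Type*} [SeminormedAddCommGroup L]
    [IsUltrametricDist L] (x y : L) : ‖x - y‖ ≤ max ‖x‖ ‖y‖ := by
  rw [sub_eq_add_neg, ← norm_neg y]
  exact IsUltrametricDist.norm_add_le_max _ _

theorem norm_eq_one_of_norm_sub_one_lt {L : Type*} [NormedField L]
    [IsUltrametricDist L] {w : L} (h : ‖w - 1‖ < 1) : ‖w‖ = 1 := by
  have : ‖(1 : L) + (w - 1)‖ = ‖(1 : L)‖ := by
    have hlt : ‖w - 1‖ < ‖(1 : L)‖ := by rwa [norm_one]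
    rw [IsUltrametricDist.norm_add_eq_max_of_norm_ne_norm hlt.ne', max_eq_left hlt.le]
  rwa [add_sub_cancel, norm_one] at this

theorem norm_add_pow_sub_pow_sub_pow_le {p : ℕ} [Fact p.Prime] {L : Type*} [NormedField L]
    [IsUltrametricDist L] {x y : L} (hx : ‖x‖ ≤ 1) (hy : ‖y‖ ≤ 1) :
    ‖(x + y) ^ p - x ^ p - y ^ p‖ ≤ ‖(p : L)‖ := by
  have hp : p.Prime := Fact.out
  have h1 : (x + y) ^ p - x ^ p - y ^ p =
      ∑ i ∈ Finset.range (p - 1), x ^ (i + 1) * y ^ (p - (i + 1)) * (p.choose (i + 1) : L) := by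
    rw [add_pow, Finset.sum_range_succ]
    have : p = p - 1 + 1 := (Nat.sub_add_cancel hp.one_le).symm
    conv_lhs => rw [this, Finset.sum_range_succ', ← this]
    simp
  rw [h1]
  refine IsUltrametricDist.norm_sum_le_of_forall_le_of_nonneg (norm_nonneg _) fun i hi => ?_
  rw [Finset.mem_range] at hi
  obtain ⟨c, hc⟩ := hp.dvd_choose_self (k := i + 1) (by omega) (by omega)
  rw [hc, Nat.cast_mul, norm_mul, norm_mul, norm_pow, norm_pow, norm_mul, mul_left_comm]
  refine mul_le_of_le_one_right (norm_nonneg _) ?_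
  exact mul_le_one₀ (mul_le_one₀ (pow_le_one₀ (norm_nonneg _) hx) (by positivity)
    (pow_le_one₀ (norm_nonneg _) hy)) (norm_nonneg _) (IsUltrametricDist.norm_natCast_le_one L c)

theorem norm_one_add_pow_sub_one_sub_lt {p : ℕ} [Fact p.Prime] {L : Type*} [NormedField L]
    [IsUltrametricDist L] {x : L} (hx0 : x ≠ 0) (hx1 : ‖x‖ < 1)
    (hx : ‖x‖ ^ (p - 1) < ‖(p : L)‖) :
    ‖(1 + x) ^ p - 1 - p * x‖ < ‖(p : L)‖ * ‖x‖ := by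
  have hp : p.Prime := Fact.out
  have hxpos : 0 < ‖x‖ := norm_pos_iff.2 hx0
  have hppos : 0 < ‖(p : L)‖ := (pow_pos hxpos _).trans hx
  have hmain : ∀ i ∈ Finset.range (p - 1),
      ‖x ^ (i + 2) * (p.choose (i + 2) : L)‖ < ‖(p : L)‖ * ‖x‖ := by
    intro i hi
    rw [Finset.mem_range] at hi
    rcases eq_or_ne (i + 2) p with h | h
    · rw [h, Nat.choose_self, Nat.cast_one, mul_one, norm_pow]
      have : p = p - 1 + 1 := (Nat.sub_add_cancel hp.one_le).symm
      rw [this, pow_succ, ← this]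
      exact mul_lt_mul_of_pos_right hx hxpos
    · obtain ⟨c, hc⟩ := hp.dvd_choose_self (k := i + 2) (by omega) (by omega)
      rw [hc, Nat.cast_mul, norm_mul, norm_pow, norm_mul, mul_comm, mul_assoc]
      refine mul_lt_mul_of_pos_left ?_ hppos
      rw [pow_succ, ← mul_assoc]
      refine mul_lt_of_lt_one_left hxpos ?_
      refine (mul_le_of_le_one_left (by positivity)
        (IsUltrametricDist.norm_natCast_le_one L c)).trans_lt ?_
      exact pow_lt_one₀ hxpos.le hx1 (by omega)
  have h1 : (1 + x) ^ p - 1 - p * x =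
      ∑ i ∈ Finset.range (p - 1), x ^ (i + 2) * (p.choose (i + 2) : L) := by
    rw [add_comm, add_pow]
    have h2 : p + 1 = p - 1 + 1 + 1 := by have := hp.two_le; omega
    rw [h2, Finset.sum_range_succ', Finset.sum_range_succ']
    simp
    ring
  have hne : (Finset.range (p - 1)).Nonempty := by
    have := hp.two_le
    simp; omega
  obtain ⟨i, hi, h⟩ := IsUltrametricDist.exists_norm_finsetSum_le_of_nonempty hne
    (fun i => x ^ (i + 2) * (p.choose (i + 2) : L))
  rw [h1]
  exact h.trans_lt (hmain i hi)

theorem norm_pow_sub_one_le {p : ℕ} [Fact p.Prime] {L : Type*} [NormedField L]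
    [IsUltrametricDist L] {u : L} (hx1 : ‖u - 1‖ < 1) (hx : ‖u - 1‖ ^ (p - 1) < ‖(p : L)‖) :
    ‖u ^ p - 1‖ ≤ ‖(p : L)‖ * ‖u - 1‖ := by
  rcases eq_or_ne u 1 with rfl | h
  · simp
  · have h1 := norm_one_add_pow_sub_one_sub_lt (sub_ne_zero.2 h) hx1 hx
    rw [add_sub_cancel] at h1
    have h2 : u ^ p - 1 = (u ^ p - 1 - p * (u - 1)) + p * (u - 1) := by ring
    rw [h2]
    refine (IsUltrametricDist.norm_add_le_max _ _).trans (max_le h1.le (norm_mul_le _ _))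

theorem exists_pow_eq_of_norm_sub_one_le {p : ℕ} [Fact p.Prime] {L : Type*} [NormedField L]
    [IsUltrametricDist L] [ProperSpace L] {r : ℝ} (hr0 : 0 ≤ r) (hr1 : r < 1)
    (hr : r ^ (p - 1) < ‖(p : L)‖) {u : L} (hu : ‖u - 1‖ ≤ ‖(p : L)‖ * r) :
    ∃ w : L, w ^ p = u ∧ ‖w - 1‖ ≤ r := by
  have hp : p.Prime := Fact.out
  have hppos : 0 < ‖(p : L)‖ := (pow_nonneg hr0 _).trans_lt hr
  have hp0 : (p : L) ≠ 0 := norm_pos_iff.1 hppos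
  have hpow : ∀ w : L, ‖w - 1‖ ≤ r → ‖w ^ p - 1‖ ≤ ‖(p : L)‖ * r := by
    intro w hw
    refine (norm_pow_sub_one_le (hw.trans_lt hr1) ((pow_le_pow_left₀ (norm_nonneg _) hw _).trans_lt
      hr)).trans ?_
    gcongr
  obtain ⟨w, hw, hmin⟩ := (isCompact_closedBall (1 : L) r).exists_isMinOn
    ⟨1, Metric.mem_closedBall_self hr0⟩
    (f := fun w => ‖w ^ p - u‖) (by fun_prop)
  rw [mem_closedBall_iff_norm] at hw
  refine ⟨w, ?_, hw⟩
  by_contra hne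
  have hw1 : ‖w‖ = 1 := norm_eq_one_of_norm_sub_one_lt (hw.trans_lt hr1)
  have hw0 : w ≠ 0 := norm_pos_iff.1 (by rw [hw1]; exact one_pos)
  set x := (u - w ^ p) / (p * w ^ p) with hx
  have hxn : ‖(p : L)‖ * ‖x‖ = ‖w ^ p - u‖ := by
    rw [hx, norm_div, norm_mul, norm_pow, hw1, one_pow, mul_one, mul_div_cancel₀ _ hppos.ne',
      norm_sub_rev]
  have hx0 : x ≠ 0 := by
    rw [hx]
    exact div_ne_zero (sub_ne_zero.2 (Ne.symm hne)) (mul_ne_zero hp0 (pow_ne_zero _ hw0))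
  have hxr : ‖x‖ ≤ r := by
    refine le_of_mul_le_mul_left ?_ hppos
    rw [hxn]
    have : w ^ p - u = (w ^ p - 1) - (u - 1) := by ring
    rw [this]
    exact (norm_sub_le_max_of_ultrametric _ _).trans (max_le (hpow w hw) hu)
  have hlt := norm_one_add_pow_sub_one_sub_lt hx0 (hxr.trans_lt hr1)
    ((pow_le_pow_left₀ (norm_nonneg _) hxr _).trans_lt hr)
  have hmem : w * (1 + x) ∈ Metric.closedBall (1 : L) r := by
    rw [mem_closedBall_iff_norm]
    have : w * (1 + x) - 1 = (w - 1) + w * x := by ring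
    rw [this]
    refine (IsUltrametricDist.norm_add_le_max _ _).trans (max_le hw ?_)
    rw [norm_mul, hw1, one_mul]
    exact hxr
  have h1 := isMinOn_iff.1 hmin _ hmem
  have h2 : (w * (1 + x)) ^ p - u = w ^ p * ((1 + x) ^ p - 1 - p * x) := by
    have : u = w ^ p + p * w ^ p * x := by
      rw [hx]; field_simp; ring
    conv_lhs => rw [this]
    rw [mul_pow]
    ring
  rw [h2, norm_mul, norm_pow, hw1, one_pow, one_mul, ← hxn] at h1
  exact absurd hlt (not_lt.2 h1)

theorem norm_sub_lt_one_of_norm_pow_sub_pow_lt_one {p : ℕ} [Fact p.Prime] {L : Type*}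
    [NormedField L] [IsUltrametricDist L] (hp1 : ‖(p : L)‖ < 1) (s : ℕ) {x y : L}
    (hx : ‖x‖ ≤ 1) (hy : ‖y‖ ≤ 1) (h : ‖x ^ p ^ s - y ^ p ^ s‖ < 1) : ‖x - y‖ < 1 := by
  have hp : p.Prime := Fact.out
  induction s generalizing x y with
  | zero => simpa using h
  | succ s ih =>
    rw [pow_succ', pow_mul, pow_mul] at h
    have h1 := ih (x := x ^ p) (y := y ^ p) (by rw [norm_pow]; exact pow_le_one₀ (norm_nonneg _) hx)
      (by rw [norm_pow]; exact pow_le_one₀ (norm_nonneg _) hy) h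
    have h2 := norm_add_pow_sub_pow_sub_pow_le (p := p) (x := x - y) (y := y)
      ((norm_sub_le_max_of_ultrametric _ _).trans (max_le hx hy)) hy
    rw [sub_add_cancel] at h2
    have h3 : (x - y) ^ p = (x ^ p - y ^ p) - (x ^ p - (x - y) ^ p - y ^ p) := by ring
    have h4 : ‖(x - y) ^ p‖ < 1 := by
      rw [h3]
      exact (norm_sub_le_max_of_ultrametric _ _).trans_lt (max_lt h1 (h2.trans_lt hp1))
    rw [norm_pow] at h4
    exact (pow_lt_one_iff_of_nonneg (norm_nonneg _) hp.ne_zero).1 h4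

theorem exists_norm_pow_sub_lt_one {p : ℕ} [Fact p.Prime] {L : Type*}
    [NormedField L] [IsUltrametricDist L] [ProperSpace L] (hp1 : ‖(p : L)‖ < 1) {a : L}
    (ha : ‖a‖ ≤ 1) : ∃ b : L, ‖b‖ ≤ 1 ∧ ‖b ^ p - a‖ < 1 := by
  have hpow : ∀ s : ℕ, ‖a ^ s‖ ≤ 1 := fun s => by
    rw [norm_pow]; exact pow_le_one₀ (norm_nonneg _) ha
  obtain ⟨c, -, φ, hφ, hlim⟩ := (isCompact_closedBall (0 : L) 1).tendsto_subseq
    (x := fun s => a ^ p ^ s) (fun s => by simpa using hpow (p ^ s))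
  have hc := hlim.cauchySeq
  rw [Metric.cauchySeq_iff'] at hc
  obtain ⟨N, hN⟩ := hc 1 one_pos
  have h1 := hN (N + 1) (Nat.le_succ N)
  have hlt : φ N < φ (N + 1) := hφ (Nat.lt_succ_self N)
  obtain ⟨d, hd⟩ := Nat.exists_eq_add_of_lt hlt
  refine ⟨a ^ p ^ d, hpow _, ?_⟩
  rw [← pow_mul, ← pow_succ]
  apply norm_sub_lt_one_of_norm_pow_sub_pow_lt_one hp1 (φ N) (hpow _) ha
  rw [dist_eq_norm] at h1
  simp only [Function.comp] at h1
  rw [← pow_mul, ← pow_add]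
  rwa [hd, show φ N + d + 1 = d + 1 + φ N by ring] at h1

end

section

theorem norm_prod_one_add_sub_le {p : ℕ} [Fact p.Prime] {L ι : Type*} [NormedField L]
    [IsUltrametricDist L] [CharZero L] [Fintype ι] (hι : Fintype.card ι = p)
    (hpn : ∀ j : ℕ, 0 < j → j < p → ‖(j : L)‖ = 1) (f : ι → L) {c : ℝ} (hc0 : 0 ≤ c)
    (hc1 : c ≤ 1) (hf : ∀ j : ℕ, 0 < j → ‖∑ i, f i ^ j‖ ≤ ‖(p : L)‖ * c ^ j) :
    ‖∏ i, (1 + f i) - 1 - ∑ i, f i - ∏ i, f i‖ ≤ ‖(p : L)‖ * c ^ 2 := by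
  classical
  have hp : p.Prime := Fact.out
  set e : ℕ → L := fun j => ∑ t ∈ Finset.powersetCard j Finset.univ, ∏ i ∈ t, f i with he
  have hprod : ∏ i, (1 + f i) = ∑ j ∈ Finset.range (p + 1), e j := by
    rw [Finset.prod_one_add, Finset.sum_powerset, Finset.card_univ, hι]
  have he0 : e 0 = 1 := by simp [he]
  have he1 : e 1 = ∑ i, f i := by
    simp [he, Finset.powersetCard_one]
  have hep : e p = ∏ i, f i := by
    simp only [he]
    rw [← hι, ← Finset.card_univ, Finset.powersetCard_self, Finset.sum_singleton]
  have hp1 : ‖(p : L)‖ ≤ 1 := IsUltrametricDist.norm_natCast_le_one L p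
  have hnewton : ∀ j : ℕ, (j : L) * e j = (-1) ^ (j + 1) *
      ∑ a ∈ Finset.HasAntidiagonal.antidiagonal j with a.1 < j,
        (-1) ^ a.1 * e a.1 * ∑ i, f i ^ a.2 := by
    intro j
    have := congrArg (MvPolynomial.aeval f) (MvPolynomial.mul_esymm_eq_sum ι ℤ j)
    simpa [MvPolynomial.esymm, MvPolynomial.psum, he] using this
  have hbound : ∀ j, 0 < j → j < p → ‖e j‖ ≤ ‖(p : L)‖ * c ^ j := by
    intro j
    induction j using Nat.strong_induction_on with
    | _ j ih =>
      intro hj hjp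
      have h1 : ‖e j‖ = ‖(j : L) * e j‖ := by rw [norm_mul, hpn j hj hjp, one_mul]
      rw [h1, hnewton, norm_mul, norm_pow, norm_neg, norm_one, one_pow, one_mul]
      refine IsUltrametricDist.norm_sum_le_of_forall_le_of_nonneg (by positivity) fun a ha => ?_
      rw [Finset.mem_filter, Finset.HasAntidiagonal.mem_antidiagonal] at ha
      rw [norm_mul, norm_mul, norm_pow, norm_neg, norm_one, one_pow, one_mul]
      have h2 := hf a.2 (by omega)
      have h3 : ‖e a.1‖ ≤ c ^ a.1 := by
        rcases Nat.eq_zero_or_pos a.1 with h0 | h0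
        · rw [h0, he0, norm_one, pow_zero]
        · exact (ih a.1 ha.2 h0 (by omega)).trans
            (mul_le_of_le_one_left (by positivity) hp1)
      calc ‖e a.1‖ * ‖∑ i, f i ^ a.2‖ ≤ c ^ a.1 * (‖(p : L)‖ * c ^ a.2) := by gcongr
        _ = ‖(p : L)‖ * c ^ j := by rw [← ha.1, pow_add]; ring
  have h2 : p = p - 2 + 1 + 1 := by have := hp.two_le; omega
  have hmain : ∏ i, (1 + f i) - 1 - ∑ i, f i - ∏ i, f i =
      ∑ j ∈ Finset.range (p - 2), e (j + 2) := by
    rw [hprod, Finset.sum_range_succ, hep]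
    conv_lhs => rw [h2, Finset.sum_range_succ', Finset.sum_range_succ']
    simp only [zero_add, he0, he1]
    ring
  rw [hmain]
  refine IsUltrametricDist.norm_sum_le_of_forall_le_of_nonneg (by positivity) fun j hj => ?_
  rw [Finset.mem_range] at hj
  refine (hbound (j + 2) (by omega) (by omega)).trans ?_
  gcongr ?_ * ?_
  exact pow_le_pow_of_le_one hc0 hc1 (by omega)

theorem norm_natCast_eq_one_of_lt {p : ℕ} [Fact p.Prime] {L : Type*} [NormedField L]
    [NormedAlgebra ℚ_[p] L] {j : ℕ} (h0 : 0 < j) (hj : j < p) : ‖(j : L)‖ = 1 := by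
  rw [← map_natCast (algebraMap ℚ_[p] L), norm_algebraMap', Padic.norm_natCast_eq_one_iff]
  exact (Nat.coprime_of_lt_prime h0.ne' hj Fact.out)

theorem trace_aeval_of_pow_eq {K L : Type*} [Field K] [Field L] [Algebra K L] {p : ℕ}
    {ω η : K} {ζ : L} (hω : IsPrimitiveRoot ω p) (hirr : Irreducible (X ^ p - C η))
    (hζ : ζ ^ p = algebraMap K L η) (htop : K⟮ζ⟯ = ⊤) {g : K[X]} (hg : g.natDegree < p) :
    Algebra.trace K L (aeval ζ g) = p * g.coeff 0 := by
  obtain ⟨h1, h2, h3, -, τ, -, hτ⟩ := exists_generator_of_X_pow_sub_C hω hirr hζ htop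
  have htr : ∀ i, 0 < i → i < p → Algebra.trace K L (ζ ^ i) = 0 := by
    intro i h0 hi
    have h4 := Algebra.trace_eq_of_algEquiv τ (ζ ^ i)
    rw [map_pow, hτ, mul_pow, ← map_pow, ← Algebra.smul_def, map_smul, smul_eq_mul] at h4
    have h5 : (ω ^ i - 1) * Algebra.trace K L (ζ ^ i) = 0 := by rw [sub_mul, h4]; ring
    exact (mul_eq_zero.1 h5).resolve_left (sub_ne_zero.2 (hω.pow_ne_one_of_pos_of_lt h0.ne' hi))
  rw [aeval_eq_sum_range' hg, map_sum]
  rw [Finset.sum_eq_single_of_mem 0 (Finset.mem_range.2 (by omega))]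
  · rw [map_smul, pow_zero, ← map_one (algebraMap K L), Algebra.trace_algebraMap, h3]
    simp [mul_comm]
  · intro i hi h0
    rw [map_smul, htr i (by omega) (Finset.mem_range.1 hi), smul_zero]

theorem norm_norm_eq_pow_finrank_padic {p : ℕ} [Fact p.Prime] {K L : Type*} [NormedField K]
    [NormedField L] [NormedAlgebra ℚ_[p] K] [NormedAlgebra ℚ_[p] L] [Algebra.IsAlgebraic ℚ_[p] L]
    [NormedAlgebra K L] [IsScalarTower ℚ_[p] K L] [FiniteDimensional K L] [IsGalois K L] (y : L) :
    ‖Algebra.norm K y‖ = ‖y‖ ^ Module.finrank K L := by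
  rw [← norm_algebraMap' L, Algebra.norm_eq_prod_automorphisms, norm_prod]
  simp only [norm_algEquiv_apply_padic (p := p)]
  rw [Finset.prod_const, Finset.card_univ, ← Nat.card_eq_fintype_card,
    IsGalois.card_aut_eq_finrank]

end

section

variable {p : ℕ} [Fact p.Prime] {K L : Type*} [NormedField K] [NormedField L] [NormedAlgebra K L]
  {ω η : K} {ζ : L} (hω : IsPrimitiveRoot ω p)
  (hζ : ζ ^ p = algebraMap K L η) (htop : K⟮ζ⟯ = ⊤) (hζ1 : ζ ≠ 1) (hζlt : ‖1 - ζ‖ < 1)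
  (hval : ∀ c : K, c ≠ 0 → ∃ j : ℤ, ‖c‖ = (‖1 - ζ‖ ^ p) ^ j)

include hω hζ hζ1 hζlt hval in
theorem irreducible_X_pow_sub_C_of_norm_one_sub : Irreducible (X ^ p - C η) := by
  have hp : p.Prime := Fact.out
  have : NeZero p := ⟨hp.ne_zero⟩
  refine X_pow_sub_C_irreducible_of_prime hp fun b hb => ?_
  have hpos : 0 < ‖1 - ζ‖ := norm_pos_iff.2 (sub_ne_zero.2 hζ1.symm)
  obtain ⟨i, -, hi⟩ : ∃ i < p, (algebraMap K L ω) ^ i * algebraMap K L b = ζ := by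
    have := (hω.map_of_injective (algebraMap K L).injective).nthRoots_eq (n := p)
      (a := algebraMap K L η) (α := algebraMap K L b) (by rw [← map_pow, hb])
    have h2 : ζ ∈ nthRoots p (algebraMap K L η) := (mem_nthRoots hp.pos).2 hζ
    rw [this, Multiset.mem_map] at h2
    obtain ⟨i, hi, h⟩ := h2
    exact ⟨i, Multiset.mem_range.1 hi, h⟩
  have h1 : algebraMap K L (1 - ω ^ i * b) = 1 - ζ := by
    rw [map_sub, map_one, map_mul, map_pow, hi]
  obtain ⟨j, hj⟩ := hval (1 - ω ^ i * b) (by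
    rintro h
    rw [h, map_zero, eq_comm] at h1
    exact hζ1 (sub_eq_zero.1 h1).symm)
  rw [← norm_algebraMap' L, h1, ← zpow_natCast, ← zpow_mul] at hj
  have h2 : ((1 : ℤ)) = p * j := zpow_right_injective₀ hpos hζlt.ne (by simpa using hj)
  have h3 : (p : ℤ) ∣ 1 := ⟨j, h2⟩
  exact hp.one_lt.ne' (by exact_mod_cast Int.eq_one_of_dvd_one (by positivity) h3)

variable [NormedAlgebra ℚ_[p] K] [NormedAlgebra ℚ_[p] L]

include hω hζ htop hζ1 hζlt hval in
theorem norm_trace_le_of_norm_le {y : L} {c : K} (hc : c ≠ 0) (hy : ‖y‖ ≤ ‖c‖) :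
    ‖Algebra.trace K L y‖ ≤ ‖(p : K)‖ * ‖c‖ := by
  have hp : p.Prime := Fact.out
  have hu : IsUltrametricDist L := IsUltrametricDist.of_normedAlgebra ℚ_[p]
  have huK : IsUltrametricDist K := IsUltrametricDist.of_normedAlgebra ℚ_[p]
  have hpos : 0 < ‖1 - ζ‖ := norm_pos_iff.2 (sub_ne_zero.2 hζ1.symm)
  have hirr := irreducible_X_pow_sub_C_of_norm_one_sub hω hζ hζ1 hζlt hval
  obtain ⟨f, hf, rfl⟩ := exists_aeval_one_sub_eq htop (monic_X_pow_sub_C η hp.ne_zero)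
    (by rw [natDegree_X_pow_sub_C]; exact hp.pos) (by simp [hζ]) y
  rw [natDegree_X_pow_sub_C] at hf
  have hcoeff := (norm_aeval_of_forall_norm_eq_zpow (k := K) (N := p)
    (sub_ne_zero.2 hζ1.symm) hζlt
    (by simpa only [norm_algebraMap'] using hval) hf).1
  have hle : ∀ i, i < p → ‖f.coeff i‖ ≤ ‖c‖ := by
    intro i hi
    rcases eq_or_ne (f.coeff i) 0 with h0 | h0
    · simp [h0]
    obtain ⟨a, ha⟩ := hval _ h0
    obtain ⟨b, hb⟩ := hval c hc
    have h1 := (hcoeff i).trans hy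
    rw [norm_algebraMap', ha, hb, ← zpow_natCast, ← zpow_natCast, ← zpow_mul, ← zpow_mul,
      ← zpow_add₀ hpos.ne', zpow_le_zpow_iff_right_of_lt_one₀ hpos hζlt] at h1
    rw [ha, hb]
    refine zpow_le_zpow_right_of_le_one₀ (by positivity) (pow_le_one₀ hpos.le hζlt.le) ?_
    have : (p : ℤ) * b < p * (a + 1) := by
      have : (i : ℤ) < p := by exact_mod_cast hi
      linarith
    have := lt_of_mul_lt_mul_left this (by positivity)
    omega
  have hcomp : aeval (1 - ζ) f = aeval ζ (f.comp (1 - X)) := by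
    rw [aeval_comp]
    simp
  have hdeg : (f.comp (1 - X)).natDegree < p := by
    calc _ ≤ f.natDegree * (1 - X : K[X]).natDegree := natDegree_comp_le
      _ = f.natDegree := by
        rw [← neg_sub X (1 : K[X]), natDegree_neg, ← C_1, natDegree_X_sub_C, mul_one]
      _ < _ := hf
  rw [hcomp, trace_aeval_of_pow_eq hω hirr hζ htop hdeg, norm_mul]
  gcongr
  rw [coeff_zero_eq_eval_zero, eval_comp]
  simp only [eval_sub, eval_one, eval_X, sub_zero]
  rw [eval_eq_sum_range' hf]
  refine IsUltrametricDist.norm_sum_le_of_forall_le_of_nonneg (norm_nonneg _) fun i hi => ?_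
  simpa using hle i (Finset.mem_range.1 hi)

include hω hζ htop hζ1 hζlt hval in
theorem norm_norm_one_add_sub_le {y : L} {c : K} (hc : c ≠ 0) (hc1 : ‖c‖ ≤ 1) (hy : ‖y‖ ≤ ‖c‖) :
    ‖Algebra.norm K (1 + y) - 1 - Algebra.trace K L y - Algebra.norm K y‖ ≤
      ‖(p : K)‖ * ‖c‖ ^ 2 := by
  have hu : IsUltrametricDist L := IsUltrametricDist.of_normedAlgebra ℚ_[p]
  have hirr := irreducible_X_pow_sub_C_of_norm_one_sub hω hζ hζ1 hζlt hval
  obtain ⟨h1, h2, h3, -, -⟩ := exists_generator_of_X_pow_sub_C hω hirr hζ htop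
  have : CharZero L := charZero_of_injective_algebraMap (algebraMap ℚ_[p] L).injective
  have h4 := norm_prod_one_add_sub_le (p := p) (L := L) (ι := L ≃ₐ[K] L)
    (by rw [← Nat.card_eq_fintype_card, IsGalois.card_aut_eq_finrank, h3])
    (fun j h0 hj => norm_natCast_eq_one_of_lt h0 hj) (fun σ => σ y) (norm_nonneg c) hc1 (by
      intro j hj
      simp only [← map_pow]
      rw [← trace_eq_sum_automorphisms, norm_algebraMap', ← norm_pow,
        ← map_natCast (algebraMap K L), norm_algebraMap']
      exact norm_trace_le_of_norm_le hω hζ htop hζ1 hζlt hval (pow_ne_zero _ hc)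
        (by rw [norm_pow, norm_pow]; gcongr))
  have h5 : ∀ σ : L ≃ₐ[K] L, 1 + σ y = σ (1 + y) := fun σ => by simp
  simp only [h5] at h4
  rw [← Algebra.norm_eq_prod_automorphisms, ← Algebra.norm_eq_prod_automorphisms,
    ← trace_eq_sum_automorphisms, ← map_one (algebraMap K L), ← map_sub, ← map_sub, ← map_sub,
    norm_algebraMap', ← map_natCast (algebraMap K L), norm_algebraMap', map_one] at h4
  exact h4

end

section

/-- The conductor of `F(p^{1/p^m})/F` for `F = E(ζ_{p^k})`, where `1 ≤ m ≤ k`. -/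
def rootConductor (p k m : ℕ) : ℕ :=
  if m = k then p ^ (k - 1) * (p + 1) else 2 * p ^ m

theorem rootConductor_self (p k : ℕ) : rootConductor p (k + 1) (k + 1) = p ^ k * (p + 1) := by
  simp [rootConductor]

theorem rootConductor_of_lt (p : ℕ) {k m : ℕ} (h : m < k) : rootConductor p k m = 2 * p ^ m :=
  if_neg h.ne

theorem rootConductor_le (p : ℕ) {k m : ℕ} (hp : 3 ≤ p) (h : m ≤ k) :
    rootConductor p (k + 1) (m + 1) ≤ p ^ k * (p - 1) + 2 * p ^ m ∧
      rootConductor p (k + 1) (m + 1) ≤ 2 * p ^ (m + 1) := by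
  obtain ⟨q, rfl⟩ := Nat.exists_eq_add_of_le hp
  have h1 : 3 + q - 1 = q + 2 := by omega
  rw [h1]
  have h0 : 0 < (3 + q) ^ m := by positivity
  rcases h.eq_or_lt with rfl | h
  · rw [rootConductor_self, pow_succ]
    constructor <;> nlinarith
  · rw [rootConductor_of_lt _ (by omega)]
    refine ⟨?_, le_rfl⟩
    have h2 : (3 + q) ^ (m + 1) ≤ (3 + q) ^ k := Nat.pow_le_pow_right (by omega) h
    rw [pow_succ] at h2 ⊢
    have h3 := Nat.mul_le_mul_right (q + 2) h2
    nlinarith [Nat.zero_le ((3 + q) ^ m * (3 + q) * q)]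

theorem algebraMap_norm_one_add_of_apply_eq_mul {K L : Type*} [Field K] [Field L] [Algebra K L]
    [FiniteDimensional K L] [IsGalois K L] {p : ℕ} (hp : Odd p) {τ : L ≃ₐ[K] L}
    (hτ : ∀ x, x ∈ Subgroup.zpowers τ) (hdim : Module.finrank K L = p) {ω : K}
    (hω : IsPrimitiveRoot ω p) {x : L} (hx : τ x = algebraMap K L ω * x) :
    algebraMap K L (Algebra.norm K (1 + x)) = 1 + x ^ p := by
  have h1 := congrArg (Polynomial.eval 1)
    (X_pow_sub_C_eq_prod (hω.map_of_injective (algebraMap K L).injective) (α := -x)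
      (a := (-x) ^ p) hp.pos rfl)
  rw [eval_prod] at h1
  simp only [eval_sub, eval_pow, eval_X, eval_C, one_pow, hp.neg_pow, sub_neg_eq_add] at h1
  rw [h1, norm_eq_prod_range_pow hτ, hdim]
  refine Finset.prod_congr rfl fun i _ => ?_
  have h2 : (τ ^ i) x = algebraMap K L ω ^ i * x := by
    clear * - hx
    induction i with
    | zero => simp
    | succ i ih =>
      rw [pow_succ', AlgEquiv.mul_apply, ih, map_mul, map_pow, AlgEquiv.commutes, hx]
      ring
  rw [map_add, map_one, h2]
  ring

end

section

variable {p : ℕ} [Fact p.Prime] (hp : Odd p) {K L : Type*} [NormedField K] [NormedField L]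
  [NormedAlgebra K L]
  {ω η : K} {ζ : L} (hω : IsPrimitiveRoot ω p)
  (hζ : ζ ^ p = algebraMap K L η) (htop : K⟮ζ⟯ = ⊤) (hζ1 : ζ ≠ 1) (hζlt : ‖1 - ζ‖ < 1)
  (hval : ∀ c : K, c ≠ 0 → ∃ j : ℤ, ‖c‖ = (‖1 - ζ‖ ^ p) ^ j)

include hp hω hζ htop hζ1 hζlt hval in
theorem norm_one_sub_eq_of_norm_one_sub : Algebra.norm K (1 - ζ) = 1 - η := by
  have hirr := irreducible_X_pow_sub_C_of_norm_one_sub hω hζ hζ1 hζlt hval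
  obtain ⟨h1, h2, h3, -, τ, hτ, hτζ⟩ := exists_generator_of_X_pow_sub_C hω hirr hζ htop
  apply (algebraMap K L).injective
  rw [sub_eq_add_neg, algebraMap_norm_one_add_of_apply_eq_mul hp hτ h3 hω
    (by rw [map_neg, hτζ]; ring), hp.neg_pow, hζ]
  simp [sub_eq_add_neg]

variable [NormedAlgebra ℚ_[p] K] [NormedAlgebra ℚ_[p] L] [Algebra.IsAlgebraic ℚ_[p] L]
  [IsScalarTower ℚ_[p] K L]

include hω hζ htop hζ1 hζlt hval in
theorem norm_norm_eq_pow_of_norm_one_sub (y : L) : ‖Algebra.norm K y‖ = ‖y‖ ^ p := by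
  have hirr := irreducible_X_pow_sub_C_of_norm_one_sub hω hζ hζ1 hζlt hval
  obtain ⟨h1, h2, h3, -, -⟩ := exists_generator_of_X_pow_sub_C hω hirr hζ htop
  rw [norm_norm_eq_pow_finrank_padic (p := p), h3]

include hp hω hζ htop hζ1 hζlt hval in
theorem norm_one_sub_eq_pow_of_norm_one_sub : ‖1 - η‖ = ‖1 - ζ‖ ^ p := by
  rw [← norm_one_sub_eq_of_norm_one_sub hp hω hζ htop hζ1 hζlt hval,
    norm_norm_eq_pow_of_norm_one_sub hω hζ htop hζ1 hζlt hval]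

variable {k : ℕ} (hpn : ‖(p : K)‖ = (‖1 - ζ‖ ^ p) ^ (p ^ k * (p - 1)))

include hp hω hζ htop hζ1 hζlt hval hpn in
theorem norm_norm_one_add_sub_one_le {m : ℕ} (hm : m ≤ k) {y : L}
    (hy : ‖y‖ ≤ ‖1 - ζ‖ ^ (2 * p ^ (m + 1))) :
    ‖Algebra.norm K (1 + y) - 1‖ ≤ (‖1 - ζ‖ ^ p) ^ rootConductor p (k + 1) (m + 1) := by
  have hp3 : 3 ≤ p := by
    obtain ⟨j, hj⟩ := hp
    have := (Fact.out : p.Prime).two_le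
    omega
  have huK : IsUltrametricDist K := IsUltrametricDist.of_normedAlgebra ℚ_[p]
  have hpos : 0 < ‖1 - ζ‖ := norm_pos_iff.2 (sub_ne_zero.2 hζ1.symm)
  have hη := norm_one_sub_eq_pow_of_norm_one_sub hp hω hζ htop hζ1 hζlt hval
  have hη0 : 1 - η ≠ 0 := norm_pos_iff.1 (by rw [hη]; positivity)
  obtain ⟨hf1, hf2⟩ := rootConductor_le p hp3 hm
  set T := ‖1 - ζ‖ ^ p with hT
  have hT0 : 0 < T := by positivity
  have hT1 : T ≤ 1 := pow_le_one₀ hpos.le hζlt.le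
  set c := (1 - η) ^ (2 * p ^ m) with hc
  have hcn : ‖c‖ = T ^ (2 * p ^ m) := by rw [hc, norm_pow, hη]
  have hc0 : c ≠ 0 := pow_ne_zero _ hη0
  have hc1 : ‖c‖ ≤ 1 := by rw [hcn]; exact pow_le_one₀ hT0.le hT1
  have hyc : ‖y‖ ≤ ‖c‖ := by
    rw [hcn, hT, ← pow_mul]
    refine hy.trans (le_of_eq ?_)
    congr 1
    rw [pow_succ]
    ring
  have h1 := norm_norm_one_add_sub_le hω hζ htop hζ1 hζlt hval hc0 hc1 hyc
  have h2 := norm_trace_le_of_norm_le hω hζ htop hζ1 hζlt hval hc0 hyc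
  have h3 := norm_norm_eq_pow_of_norm_one_sub hω hζ htop hζ1 hζlt hval y
  have hpc : ‖(p : K)‖ * ‖c‖ ≤ T ^ rootConductor p (k + 1) (m + 1) := by
    rw [hpn, hcn, ← pow_add]
    exact pow_le_pow_of_le_one hT0.le hT1 hf1
  have h4 : Algebra.norm K (1 + y) - 1 = (Algebra.norm K (1 + y) - 1 - Algebra.trace K L y -
    Algebra.norm K y) + (Algebra.trace K L y + Algebra.norm K y) := by ring
  rw [h4]
  refine (IsUltrametricDist.norm_add_le_max _ _).trans (max_le ?_
    ((IsUltrametricDist.norm_add_le_max _ _).trans (max_le (h2.trans hpc) ?_)))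
  · refine h1.trans (le_trans ?_ hpc)
    rw [pow_two]
    gcongr
    exact mul_le_of_le_one_left (norm_nonneg _) hc1
  · rw [h3]
    calc ‖y‖ ^ p ≤ (‖1 - ζ‖ ^ (2 * p ^ (m + 1))) ^ p := by gcongr
      _ = T ^ (2 * p ^ (m + 1)) := by rw [hT, ← pow_mul, ← pow_mul, mul_comm]
      _ ≤ _ := pow_le_pow_of_le_one hT0.le hT1 hf2

include hp hω hζ htop hζ1 hζlt hval hpn in
theorem exists_norm_norm_one_add_sub_le_self {u : K}
    (hu : ‖u - 1‖ ≤ (‖1 - ζ‖ ^ p) ^ (rootConductor p (k + 1) (k + 1) - 1)) :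
    ∃ y : L, ‖y‖ ≤ ‖1 - ζ‖ ^ (2 * p ^ (k + 1) - 1) ∧
      ‖Algebra.norm K (1 + y) - u‖ ≤ (‖1 - ζ‖ ^ p) ^ rootConductor p (k + 1) (k + 1) := by
  have hirr := irreducible_X_pow_sub_C_of_norm_one_sub hω hζ hζ1 hζlt hval
  have hp3 : 3 ≤ p := by
    obtain ⟨j, hj⟩ := hp
    have := (Fact.out : p.Prime).two_le
    omega
  have huK : IsUltrametricDist K := IsUltrametricDist.of_normedAlgebra ℚ_[p]
  have hpos : 0 < ‖1 - ζ‖ := norm_pos_iff.2 (sub_ne_zero.2 hζ1.symm)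
  have hη := norm_one_sub_eq_pow_of_norm_one_sub hp hω hζ htop hζ1 hζlt hval
  have hη0 : 1 - η ≠ 0 := norm_pos_iff.1 (by rw [hη]; positivity)
  rw [rootConductor_self] at hu ⊢
  set T := ‖1 - ζ‖ ^ p with hT
  have hT0 : 0 < T := by positivity
  have hT1 : T ≤ 1 := pow_le_one₀ hpos.le hζlt.le
  have hpn0 : 0 < ‖(p : K)‖ := by rw [hpn]; positivity
  have hpK : (p : K) ≠ 0 := norm_pos_iff.1 hpn0
  set c := (1 - η) ^ (2 * p ^ k - 1) with hc
  have hcn : ‖c‖ = T ^ (2 * p ^ k - 1) := by rw [hc, norm_pow, hη]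
  have hc0 : c ≠ 0 := pow_ne_zero _ hη0
  have hc1 : ‖c‖ ≤ 1 := by rw [hcn]; exact pow_le_one₀ hT0.le hT1
  have hpk : 0 < p ^ k := by positivity
  obtain ⟨q, hq⟩ := Nat.exists_eq_add_of_le hp3
  have hpq : p - 1 = q + 2 := by omega
  obtain ⟨P, hP⟩ : ∃ P, p ^ k = P + 1 := ⟨p ^ k - 1, by omega⟩
  have hP1 : p ^ (k + 1) = (P + 1) * (q + 3) := by rw [pow_succ, hP, hq]; ring
  set x := u - 1 with hx
  set y : L := algebraMap K L (x / p) * (1 - ζ) ^ (p - 1) with hydef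
  have hyn : ‖y‖ ≤ ‖1 - ζ‖ ^ (2 * p ^ (k + 1) - 1) := by
    rw [hydef, norm_mul, norm_algebraMap', norm_div, norm_pow, div_mul_eq_mul_div,
      div_le_iff₀ hpn0, hpn]
    calc ‖x‖ * ‖1 - ζ‖ ^ (p - 1) ≤ T ^ (p ^ k * (p + 1) - 1) * ‖1 - ζ‖ ^ (p - 1) := by gcongr
      _ = _ := by
        rw [hT, ← pow_mul, ← pow_mul, ← pow_add, ← pow_add]
        congr 1
        rw [hpq, hP1, hP]
        have h1 : (P + 1) * (p + 1) - 1 = P * (q + 4) + q + 3 := by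
          rw [hq]; apply Nat.sub_eq_of_eq_add; ring
        have h2 : 2 * ((P + 1) * (q + 3)) - 1 = 2 * P * (q + 3) + 2 * q + 5 := by
          apply Nat.sub_eq_of_eq_add; ring
        rw [h1, h2, hq]
        ring
  refine ⟨y, hyn, ?_⟩
  have hyc : ‖y‖ ≤ ‖c‖ := by
    refine hyn.trans ?_
    rw [hcn, hT, ← pow_mul]
    refine pow_le_pow_of_le_one hpos.le hζlt.le ?_
    rw [hP1, hP]
    have h1 : 2 * (P + 1) - 1 = 2 * P + 1 := by omega
    have h2 : 2 * ((P + 1) * (q + 3)) - 1 = 2 * P * (q + 3) + 2 * q + 5 := by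
      apply Nat.sub_eq_of_eq_add; ring
    rw [h1, h2, hq]
    nlinarith
  have htr : Algebra.trace K L y = x := by
    have h1 : y = (x / p) • aeval ζ ((1 - X : K[X]) ^ (p - 1)) := by
      rw [hydef, Algebra.smul_def]
      simp
    have hdeg : ((1 - X : K[X]) ^ (p - 1)).natDegree < p := by
      rw [natDegree_pow, ← neg_sub X (1 : K[X]), natDegree_neg, ← C_1, natDegree_X_sub_C, mul_one]
      omega
    rw [h1, map_smul, trace_aeval_of_pow_eq hω hirr hζ htop hdeg, coeff_zero_eq_eval_zero]
    simp
    field_simp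
  have h1 := norm_norm_one_add_sub_le hω hζ htop hζ1 hζlt hval hc0 hc1 hyc
  have h3 := norm_norm_eq_pow_of_norm_one_sub hω hζ htop hζ1 hζlt hval y
  have h4 : Algebra.norm K (1 + y) - u = (Algebra.norm K (1 + y) - 1 - Algebra.trace K L y -
    Algebra.norm K y) + Algebra.norm K y := by rw [htr, hx]; ring
  rw [h4]
  refine (IsUltrametricDist.norm_add_le_max _ _).trans (max_le (h1.trans ?_) ?_)
  · rw [hpn, hcn, ← pow_mul T, ← pow_add]
    refine pow_le_pow_of_le_one hT0.le hT1 ?_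
    rw [hP, hpq, hq]
    have h1 : 2 * (P + 1) - 1 = 2 * P + 1 := by omega
    rw [h1]
    nlinarith
  · rw [h3]
    calc ‖y‖ ^ p ≤ (‖1 - ζ‖ ^ (2 * p ^ (k + 1) - 1)) ^ p := by gcongr
      _ = T ^ (2 * p ^ (k + 1) - 1) := by rw [hT, ← pow_mul, ← pow_mul, mul_comm]
      _ ≤ _ := by
        refine pow_le_pow_of_le_one hT0.le hT1 ?_
        rw [hP1, hP]
        have h2 : 2 * ((P + 1) * (q + 3)) - 1 = 2 * P * (q + 3) + 2 * q + 5 := by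
          apply Nat.sub_eq_of_eq_add; ring
        rw [h2, hq]
        nlinarith

include hp hω hζ htop hζ1 hζlt hval hpn in
theorem exists_norm_norm_one_add_sub_le_of_lt [ProperSpace K] {m : ℕ} (hm : m + 1 ≤ k) {u : K}
    (hu : ‖u - 1‖ ≤ (‖1 - ζ‖ ^ p) ^ (2 * p ^ (m + 1) - 1)) :
    ∃ y : L, ‖y‖ ≤ ‖1 - ζ‖ ^ (2 * p ^ (m + 1) - 1) ∧
      ‖Algebra.norm K (1 + y) - u‖ ≤ (‖1 - ζ‖ ^ p) ^ (2 * p ^ (m + 1)) := by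
  have hirr := irreducible_X_pow_sub_C_of_norm_one_sub hω hζ hζ1 hζlt hval
  obtain ⟨-, -, hdim, -, -⟩ := exists_generator_of_X_pow_sub_C hω hirr hζ htop
  have hp3 : 3 ≤ p := by
    obtain ⟨j, hj⟩ := hp
    have := (Fact.out : p.Prime).two_le
    omega
  have huK : IsUltrametricDist K := IsUltrametricDist.of_normedAlgebra ℚ_[p]
  have hpos : 0 < ‖1 - ζ‖ := norm_pos_iff.2 (sub_ne_zero.2 hζ1.symm)
  have hη := norm_one_sub_eq_pow_of_norm_one_sub hp hω hζ htop hζ1 hζlt hval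
  have hη0 : 1 - η ≠ 0 := norm_pos_iff.1 (by rw [hη]; positivity)
  have hNη := norm_one_sub_eq_of_norm_one_sub hp hω hζ htop hζ1 hζlt hval
  set T := ‖1 - ζ‖ ^ p with hT
  have hT0 : 0 < T := by positivity
  have hT1 : T < 1 := pow_lt_one₀ hpos.le hζlt (by omega)
  have hpT : ‖(p : K)‖ ≤ T ^ (2 * p ^ (m + 1)) := by
    rw [hpn]
    refine pow_le_pow_of_le_one hT0.le hT1.le ?_
    have := Nat.pow_le_pow_right (n := p) (by omega) hm
    have h2 : 2 ≤ p - 1 := by omega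
    rw [mul_comm]
    exact Nat.mul_le_mul this h2
  have hplt : ‖(p : K)‖ < 1 := by
    rw [norm_natCast_prime_padic]
    exact inv_lt_one_of_one_lt₀ (by exact_mod_cast (by omega : 1 < p))
  set i := 2 * p ^ (m + 1) - 1 with hi
  have hi1 : 2 * p ^ (m + 1) = i + 1 := by
    have : 0 < p ^ (m + 1) := by positivity
    omega
  rw [hi1] at hpT ⊢
  have hηi : (1 - η) ^ i ≠ 0 := pow_ne_zero _ hη0
  set a := (u - 1) / (1 - η) ^ i with ha
  have hua : u = 1 + a * (1 - η) ^ i := by rw [ha]; field_simp; ring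
  have ha1 : ‖a‖ ≤ 1 := by
    rw [ha, norm_div, norm_pow, hη]
    exact div_le_one_of_le₀ hu (by positivity)
  obtain ⟨b, hb, hba⟩ := exists_norm_pow_sub_lt_one hplt ha1
  have hbaT : ‖b ^ p - a‖ ≤ T := by
    rcases eq_or_ne (b ^ p - a) 0 with h0 | h0
    · rw [h0, norm_zero]; exact hT0.le
    obtain ⟨j, hj⟩ := hval _ h0
    rw [hj] at hba ⊢
    have h1 : (0 : ℤ) < j := by
      by_contra hcon
      exact absurd hba (not_lt.2 (one_le_zpow_of_nonpos₀ hT0 hT1.le (not_lt.1 hcon)))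
    calc T ^ j ≤ T ^ (1 : ℤ) := zpow_le_zpow_right_of_le_one₀ hT0 hT1.le (by omega)
      _ = T := zpow_one _
  set y : L := algebraMap K L b * (1 - ζ) ^ i with hydef
  have hyn : ‖y‖ ≤ ‖1 - ζ‖ ^ i := by
    rw [hydef, norm_mul, norm_algebraMap', norm_pow]
    exact mul_le_of_le_one_left (by positivity) hb
  refine ⟨y, hyn, ?_⟩
  have hyc : ‖y‖ ≤ ‖(1 : K)‖ := by
    rw [norm_one]; exact hyn.trans (pow_le_one₀ hpos.le hζlt.le)
  have h1 := norm_norm_one_add_sub_le hω hζ htop hζ1 hζlt hval one_ne_zero norm_one.le hyc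
  have h2 := norm_trace_le_of_norm_le hω hζ htop hζ1 hζlt hval one_ne_zero hyc
  rw [norm_one, one_pow, mul_one] at h1
  rw [norm_one, mul_one] at h2
  have h3 : Algebra.norm K y = b ^ p * (1 - η) ^ i := by
    rw [hydef, map_mul, map_pow, Algebra.norm_algebraMap, hdim, hNη]
  have h4 : Algebra.norm K (1 + y) - u = ((Algebra.norm K (1 + y) - 1 - Algebra.trace K L y -
    Algebra.norm K y) + Algebra.trace K L y) + (b ^ p - a) * (1 - η) ^ i := by
    rw [hua, h3]; ring
  rw [h4]
  refine (IsUltrametricDist.norm_add_le_max _ _).trans (max_le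
    ((IsUltrametricDist.norm_add_le_max _ _).trans (max_le (h1.trans hpT) (h2.trans hpT))) ?_)
  rw [norm_mul, norm_pow, hη, pow_succ, mul_comm]
  gcongr

end

section

theorem IsNormFromAdjoin.mul {K Ω : Type} [Field K] [Field Ω] [Algebra K Ω] {ρ : Ω} {u v : K}
    (hu : IsNormFromAdjoin K ρ u) (hv : IsNormFromAdjoin K ρ v) : IsNormFromAdjoin K ρ (u * v) := by
  obtain ⟨x, rfl⟩ := hu
  obtain ⟨y, rfl⟩ := hv
  exact ⟨x * y, map_mul _ _ _⟩

theorem IsNormFromAdjoin.inv {K Ω : Type} [Field K] [Field Ω] [Algebra K Ω] {ρ : Ω} {u : K}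
    (hu0 : u ≠ 0) (hu : IsNormFromAdjoin K ρ u) : IsNormFromAdjoin K ρ u⁻¹ := by
  obtain ⟨x, rfl⟩ := hu
  refine ⟨x⁻¹, ?_⟩
  rcases eq_or_ne x 0 with rfl | hx
  · have h : Algebra.norm K (0 : K⟮ρ⟯) * Algebra.norm K (0 : K⟮ρ⟯) = Algebra.norm K (0 : K⟮ρ⟯) := by
      rw [← map_mul, mul_zero]
    rw [inv_zero, mul_eq_left₀ hu0 |>.1 h, inv_one]
  · apply eq_inv_of_mul_eq_one_left
    rw [← map_mul, inv_mul_cancel₀ hx, map_one]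

/-- The group of norms from `K(ρ)` to `K`. -/
noncomputable def normGroup (K : Type) {Ω : Type} [Field K] [Field Ω] [Algebra K Ω] (ρ : Ω) :
    Subgroup Kˣ :=
  (Units.map (Algebra.norm K (S := K⟮ρ⟯))).range

theorem mem_normGroup {K Ω : Type} [Field K] [Field Ω] [Algebra K Ω] {ρ : Ω}
    [FiniteDimensional K K⟮ρ⟯] {u : Kˣ} : u ∈ normGroup K ρ ↔ IsNormFromAdjoin K ρ (u : K) := by
  constructor
  · rintro ⟨x, rfl⟩
    exact ⟨x, rfl⟩
  · rintro ⟨x, hx⟩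
    have hx0 : x ≠ 0 := by
      rintro rfl
      rw [Algebra.norm_zero] at hx
      exact u.ne_zero hx.symm
    exact ⟨Units.mk0 x hx0, Units.ext hx⟩

theorem Algebra.norm_norm_eq_norm_norm {K K' L M : Type} [Field K] [Field K'] [Field L] [Field M]
    [Algebra K K'] [Algebra K L] [Algebra K' M] [Algebra L M] [Algebra K M] [IsScalarTower K K' M]
    [IsScalarTower K L M] [FiniteDimensional K K'] [FiniteDimensional K' M] (z : M) :
    Algebra.norm K (Algebra.norm L z) = Algebra.norm K (Algebra.norm K' z) := by
  have : FiniteDimensional K M := FiniteDimensional.trans K K' M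
  have : FiniteDimensional K L := FiniteDimensional.left K L M
  have : FiniteDimensional L M := FiniteDimensional.right K L M
  rw [Algebra.norm_norm, Algebra.norm_norm]

theorem IsNormFromAdjoin.norm {K K' Ω : Type} [Field K] [Field K'] [Field Ω] [Algebra K Ω]
    [Algebra K' Ω] [Algebra K K'] [IsScalarTower K K' Ω] [FiniteDimensional K K'] {ρ : Ω}
    (hρ : IsIntegral K ρ) {u : K'} (h : IsNormFromAdjoin K' ρ u) :
    IsNormFromAdjoin K ρ (Algebra.norm K u) := by
  obtain ⟨z, rfl⟩ := h
  have hle : K⟮ρ⟯ ≤ (K'⟮ρ⟯).restrictScalars K := by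
    rw [adjoin_simple_le_iff]
    exact mem_adjoin_simple_self K' ρ
  let φ : K⟮ρ⟯ →ₐ[K] K'⟮ρ⟯ := IntermediateField.inclusion hle
  let : Algebra K⟮ρ⟯ K'⟮ρ⟯ := φ.toRingHom.toAlgebra
  have : IsScalarTower K K⟮ρ⟯ K'⟮ρ⟯ := IsScalarTower.of_algebraMap_eq fun x => (φ.commutes x).symm
  have h1 : FiniteDimensional K' K'⟮ρ⟯ := adjoin.finiteDimensional (hρ.tower_top)
  exact ⟨Algebra.norm K⟮ρ⟯ z, Algebra.norm_norm_eq_norm_norm z⟩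

theorem isNormFromAdjoin_pow {K Ω : Type} [Field K] [Field Ω] [Algebra K Ω] {p q : ℕ}
    (hp : p ≠ 0) {ζ : K} (hζ : IsPrimitiveRoot ζ (p * q)) {c : K}
    (hirr : Irreducible (X ^ (p * q) - C c)) {ρ : Ω} (hρ : ρ ^ (p * q) = algebraMap K Ω c) {u : K}
    (h : IsNormFromAdjoin K (ρ ^ p) u) : IsNormFromAdjoin K ρ (u ^ p) := by
  obtain ⟨z, rfl⟩ := h
  have hpq : 0 < p * q := Nat.pos_of_ne_zero (ne_zero_of_irreducible_X_pow_sub_C hirr)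
  have hirr' : Irreducible (X ^ q - C c) := by
    apply of_irreducible_expand hp
    simpa [pow_mul] using hirr
  have hq : q ≠ 0 := ne_zero_of_irreducible_X_pow_sub_C hirr'
  have hintegral : IsIntegral K (ρ ^ p) :=
    ⟨X ^ q - C c, monic_X_pow_sub_C c hq, by simp [← pow_mul, hρ]⟩
  obtain ⟨f, hf⟩ : ∃ f : K[X], z = aeval (AdjoinSimple.gen K (ρ ^ p)) f :=
    (adjoin.powerBasis hintegral).exists_eq_aeval' z
  refine ⟨aeval (AdjoinSimple.gen K ρ) (expand K p f), ?_⟩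
  apply (algebraMap K Ω).injective
  rw [norm_adjoin_eq_prod hζ hirr hρ, hf, map_pow,
    norm_adjoin_eq_prod (hζ.pow hpq rfl) hirr' (by rw [← pow_mul]; exact hρ), mul_comm p q,
    prod_range_mul, ← Finset.card_range p, ← Finset.prod_const, Finset.card_range]
  refine Finset.prod_congr rfl fun j _ => Finset.prod_congr rfl fun i _ => ?_
  rw [expand_aeval, mul_pow, ← map_pow, pow_right_comm ζ, pow_add, pow_mul, ← pow_mul ζ p q,
    hζ.pow_eq_one]
  simp

theorem isNormFromAdjoin_of_pow_eq {K Ω : Type} [Field K] [Field Ω] [Algebra K Ω] {p : ℕ}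
    (hp : 0 < p) {ζ : K} (hζ : IsPrimitiveRoot ζ p) {b : K} {ρ : Ω}
    (hρ : ρ ^ p = algebraMap K Ω (b ^ p)) (u : K) : IsNormFromAdjoin K ρ u := by
  have hmem : ρ ∈ (⊥ : IntermediateField K Ω) := by
    have : NeZero p := ⟨hp.ne'⟩
    have h1 := (hζ.map_of_injective (algebraMap K Ω).injective).nthRoots_eq (n := p)
      (a := algebraMap K Ω (b ^ p)) (α := algebraMap K Ω b) (by rw [← map_pow])
    have h2 : ρ ∈ nthRoots p (algebraMap K Ω (b ^ p)) := (mem_nthRoots hp).2 hρ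
    rw [h1, Multiset.mem_map] at h2
    obtain ⟨i, hi, h⟩ := h2
    rw [mem_bot]
    exact ⟨ζ ^ i * b, by rw [map_mul, map_pow, h]⟩
  have hfin : Module.finrank K K⟮ρ⟯ = 1 := by
    rw [adjoin_simple_eq_bot_iff.2 hmem]
    exact IntermediateField.finrank_bot
  exact ⟨algebraMap K K⟮ρ⟯ u, by rw [Algebra.norm_algebraMap, hfin, pow_one]⟩

theorem irreducible_X_pow_sub_C_of_not_isNormFromAdjoin {K Ω : Type} [Field K] [Field Ω]
    [Algebra K Ω] {p : ℕ} (hp : p.Prime) (hp2 : p ≠ 2) {ζ : K} (hζ : IsPrimitiveRoot ζ p)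
    {c : K} {ρ : Ω} (hρ : ρ ^ p = algebraMap K Ω c) {u : K} (hu : ¬ IsNormFromAdjoin K ρ u)
    (m : ℕ) : Irreducible (X ^ p ^ m - C c) := by
  refine X_pow_sub_C_irreducible_of_prime_pow hp hp2 m fun b hb => hu ?_
  exact isNormFromAdjoin_of_pow_eq hp.pos hζ (hρ.trans (by rw [hb])) u

theorem index_normGroup {p : ℕ} [Fact p.Prime] (hp : Odd p) {K Ω : Type} [NormedField K]
    [NormedField Ω] [NormedAlgebra ℚ_[p] K] [NormedAlgebra ℚ_[p] Ω] [FiniteDimensional ℚ_[p] K]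
    [NormedAlgebra K Ω] [IsScalarTower ℚ_[p] K Ω] {m : ℕ} {ζ : K} (hζ : IsPrimitiveRoot ζ (p ^ m))
    {ρ : Ω} (hρ : ρ ^ p ^ m = p) (hirr : Irreducible (X ^ p ^ m - C (p : K))) :
    (normGroup K ρ).index = p ^ m := by
  obtain ⟨h1, h2, h3, h4, τ, hτ, -⟩ := exists_generator_adjoin hζ hirr (ρ := ρ) (by simpa using hρ)
  let : NormedAlgebra ℚ_[p] K⟮ρ⟯ :=
    { toAlgebra := inferInstance
      norm_smul_le := fun a x => by
        have h5 : ((a • x : K⟮ρ⟯) : Ω) = a • (x : Ω) := by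
          rw [← algebraMap_smul K a x, ← algebraMap_smul K a (x : Ω)]
          rfl
        have : ‖(a • x : K⟮ρ⟯)‖ = ‖((a • x : K⟮ρ⟯) : Ω)‖ := rfl
        rw [this, h5, norm_smul]
        rfl }
  have : FiniteDimensional ℚ_[p] K⟮ρ⟯ := FiniteDimensional.trans ℚ_[p] K K⟮ρ⟯
  have h5 := index_norm_range_eq_finrank (p := p) (K := K) (L := K⟮ρ⟯) hτ
    (ρ := AdjoinSimple.gen K ρ) ?_ ?_
  · rw [normGroup, ← h3]
    exact h5
  · rw [h3]
    exact Subtype.ext (by simpa using hρ)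
  · rw [h4, (hp.pow.add_one).neg_one_pow, one_mul]

end

section

/-- `f` is the conductor of `K(ρ)/K`, where `t` is the absolute value of a uniformizer of `K`. -/
def IsNormConductor (K : Type) {Ω : Type} [NormedField K] [Field Ω] [Algebra K Ω] (ρ : Ω)
    (t : ℝ) (f : ℕ) : Prop :=
  (∀ u : K, ‖u - 1‖ ≤ t ^ f → IsNormFromAdjoin K ρ u) ∧
    ∃ u : K, ‖u - 1‖ ≤ t ^ (f - 1) ∧ ¬ IsNormFromAdjoin K ρ u

theorem norm_le_of_norm_lt_one_of_forall_norm_eq_zpow {K : Type*} [NormedField K] {t : ℝ}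
    (ht0 : 0 < t) (ht1 : t < 1) (hval : ∀ c : K, c ≠ 0 → ∃ j : ℤ, ‖c‖ = t ^ j) {x : K}
    (hx : ‖x‖ < 1) : ‖x‖ ≤ t := by
  rcases eq_or_ne x 0 with rfl | h0
  · rw [norm_zero]; exact ht0.le
  obtain ⟨j, hj⟩ := hval _ h0
  rw [hj] at hx ⊢
  have h1 : (0 : ℤ) < j := by
    by_contra hcon
    exact absurd hx (not_lt.2 (one_le_zpow_of_nonpos₀ ht0 ht1.le (not_lt.1 hcon)))
  calc t ^ j ≤ t ^ (1 : ℤ) := zpow_le_zpow_right_of_le_one₀ ht0 ht1.le (by omega)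
    _ = t := zpow_one _

theorem norm_one_sub_lt_one_of_isPrimitiveRoot {p : ℕ} [Fact p.Prime] {K : Type*} [NormedField K]
    [NormedAlgebra ℚ_[p] K] {k : ℕ} {ζ : K} (hζ : IsPrimitiveRoot ζ (p ^ (k + 1))) :
    ‖1 - ζ‖ < 1 := by
  have : IsUltrametricDist K := IsUltrametricDist.of_normedAlgebra ℚ_[p]
  have h := norm_one_sub_pow_of_isPrimitiveRoot hζ
  rw [norm_natCast_prime_padic] at h
  by_contra hcon
  have h1 : (p : ℝ)⁻¹ < 1 :=
    inv_lt_one_of_one_lt₀ (by exact_mod_cast (Fact.out : p.Prime).one_lt)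
  rw [← h] at h1
  exact absurd (one_le_pow₀ (not_lt.1 hcon)) (not_le.2 h1)

variable {p : ℕ} [Fact p.Prime] (hp : Odd p) {K Ω : Type} [NormedField K]
  [NormedField Ω] [NormedAlgebra ℚ_[p] K] [NormedAlgebra ℚ_[p] Ω] [FiniteDimensional ℚ_[p] K]
  [NormedAlgebra K Ω] [IsScalarTower ℚ_[p] K Ω] {ω : K} (hω : IsPrimitiveRoot ω p)
  (hval : ∀ c : K, c ≠ 0 → ∃ j : ℤ, ‖c‖ = ‖1 - ω‖ ^ j) {ρ : Ω} (hρ : ρ ^ p = p)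

omit [FiniteDimensional ℚ_[p] K] in
include hω hval in
theorem irreducible_X_pow_sub_C_prime : Irreducible (X ^ p - C (p : K)) := by
  have hpp : p.Prime := Fact.out
  have hu : IsUltrametricDist K := IsUltrametricDist.of_normedAlgebra ℚ_[p]
  have hω' : IsPrimitiveRoot ω (p ^ (0 + 1)) := by simpa using hω
  have ht := norm_one_sub_pow_of_isPrimitiveRoot hω'
  rw [pow_zero, one_mul] at ht
  have hp0 : 0 < ‖(p : K)‖ := by
    rw [norm_natCast_prime_padic]; exact inv_pos.2 (by exact_mod_cast hpp.pos)
  have ht0 : 0 < ‖1 - ω‖ := by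
    refine (norm_nonneg _).lt_of_ne fun h => ?_
    rw [← h, zero_pow (by have := hpp.two_le; omega)] at ht
    exact hp0.ne ht
  have ht1 := norm_one_sub_lt_one_of_isPrimitiveRoot hω'
  refine X_pow_sub_C_irreducible_of_prime hpp fun b hb => ?_
  have hb0 : b ≠ 0 := by
    rintro rfl
    rw [zero_pow hpp.ne_zero] at hb
    rw [← hb, norm_zero] at hp0
    exact lt_irrefl _ hp0
  obtain ⟨j, hj⟩ := hval b hb0
  have h1 := congrArg norm hb
  rw [norm_pow, hj, ← ht, ← zpow_natCast, ← zpow_mul, ← zpow_natCast] at h1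
  have h2 := zpow_right_injective₀ ht0 ht1.ne h1
  push_cast [hpp.one_le] at h2
  have h3 : (p : ℤ) ∣ 1 := ⟨1 - j, by linarith⟩
  have := Int.le_of_dvd one_pos h3
  have := hpp.two_le
  omega

include hp hω hval hρ in
theorem isNormConductor_root_prime : IsNormConductor K ρ ‖1 - ω‖ (p + 1) := by
  have hpp : p.Prime := Fact.out
  have hu : IsUltrametricDist K := IsUltrametricDist.of_normedAlgebra ℚ_[p]
  have hK : ProperSpace K := FiniteDimensional.proper ℚ_[p] K
  have hirr := irreducible_X_pow_sub_C_prime hω hval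
  have hω' : IsPrimitiveRoot ω (p ^ (0 + 1)) := by simpa using hω
  have ht := norm_one_sub_pow_of_isPrimitiveRoot hω'
  rw [pow_zero, one_mul] at ht
  have hp3 : 3 ≤ p := by
    obtain ⟨j, hj⟩ := hp
    have := hpp.two_le
    omega
  have hp0 : 0 < ‖(p : K)‖ := by
    rw [norm_natCast_prime_padic]; exact inv_pos.2 (by exact_mod_cast hpp.pos)
  have ht1 := norm_one_sub_lt_one_of_isPrimitiveRoot hω'
  have ht0 : 0 < ‖1 - ω‖ := by
    refine (norm_nonneg _).lt_of_ne fun h => ?_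
    rw [← h, zero_pow (by omega)] at ht
    exact hp0.ne ht
  have hp1 : ‖(p : K)‖ < 1 := by
    rw [← ht]; exact pow_lt_one₀ ht0.le ht1 (by omega)
  have hpK : (p : K) ≠ 0 := norm_pos_iff.1 hp0
  have hlK : 1 - ω ≠ 0 := norm_pos_iff.1 ht0
  have hρ' : ρ ^ p = algebraMap K Ω (p : K) := by rw [hρ, map_natCast]
  obtain ⟨h1, h2, h3, h4, τ, hτ, hτρ⟩ := exists_generator_adjoin hω hirr hρ'
  have hpow : ∀ b : K, IsNormFromAdjoin K ρ (b ^ p) := fun b =>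
    ⟨algebraMap K K⟮ρ⟯ b, by rw [Algebra.norm_algebraMap, h3]⟩
  constructor
  · intro u hu
    obtain ⟨w, hw, -⟩ := exists_pow_eq_of_norm_sub_one_le (p := p) (r := ‖1 - ω‖ ^ 2)
      (by positivity) (pow_lt_one₀ ht0.le ht1 two_ne_zero) (u := u) (by
        rw [← pow_mul, mul_comm, pow_mul, ht]
        exact pow_lt_self_of_lt_one₀ hp0 hp1 one_lt_two) (by
        rw [← ht, ← pow_add]
        convert hu using 2
        omega)
    rw [← hw]
    exact hpow w
  by_contra! hcon
  rw [add_tsub_cancel_right] at hcon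
  set θ : K := (1 - ω) ^ p / p with hθ
  have hθn : ‖θ‖ = ‖1 - ω‖ := by
    rw [hθ, norm_div, norm_pow, div_eq_iff hp0.ne', ← ht, ← pow_succ']
    congr 1
    omega
  have hθ0 : θ ≠ 0 := norm_pos_iff.1 (hθn ▸ ht0)
  have hgen0 : AdjoinSimple.gen K ρ ≠ 0 := by
    intro h
    have := congrArg Subtype.val h
    simp only [AdjoinSimple.coe_gen, ZeroMemClass.coe_zero] at this
    rw [this, zero_pow hpp.ne_zero] at hρ'
    exact hpK ((algebraMap K Ω).injective (by rw [← hρ', map_zero]))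
  have hθN : IsNormFromAdjoin K ρ θ := by
    have h5 : IsNormFromAdjoin K ρ (p : K) :=
      ⟨_, h4.trans (by rw [hp.add_one.neg_one_pow, one_mul])⟩
    rw [hθ, div_eq_mul_inv]
    exact (hpow _).mul (h5.inv hpK)
  have hunit : ∀ i : ℕ, i < p → ∀ u : K, ‖u - 1‖ ≤ ‖1 - ω‖ ^ (p - i) → IsNormFromAdjoin K ρ u := by
    intro i
    induction i with
    | zero => exact fun _ => hcon
    | succ i ih =>
      intro hi u hu
      set s := p - (i + 1) with hs
      have hs1 : p - i = s + 1 := by omega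
      set a := (u - 1) / θ ^ s with ha
      have hθs : θ ^ s ≠ 0 := pow_ne_zero _ hθ0
      have hua : u = 1 + a * θ ^ s := by rw [ha]; field_simp; ring
      have ha1 : ‖a‖ ≤ 1 := by
        rw [ha, norm_div, norm_pow, hθn]
        exact div_le_one_of_le₀ hu (by positivity)
      obtain ⟨b, hb, hba⟩ := exists_norm_pow_sub_lt_one hp1 ha1
      replace hba := norm_le_of_norm_lt_one_of_forall_norm_eq_zpow ht0 ht1 hval hba
      set d := 1 + b ^ p * θ ^ s with hd
      have hd1 : ‖d‖ = 1 := by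
        apply norm_eq_one_of_norm_sub_one_lt
        rw [hd, add_sub_cancel_left, norm_mul, norm_pow, norm_pow, hθn]
        exact mul_lt_one_of_nonneg_of_lt_one_right (pow_le_one₀ (norm_nonneg _) hb)
          (by positivity) (pow_lt_one₀ ht0.le ht1 (by omega))
      have hd0 : d ≠ 0 := norm_pos_iff.1 (by rw [hd1]; exact one_pos)
      have hdN : IsNormFromAdjoin K ρ d := by
        have hω2 : IsPrimitiveRoot (ω⁻¹ ^ s) p := by
          refine hω.inv.pow_of_coprime s ?_
          exact (Nat.Coprime.symm <| (Nat.Prime.coprime_iff_not_dvd hpp).2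
            fun h => absurd (Nat.le_of_dvd (by omega) h) (by omega))
        have h6 := algebraMap_norm_one_add_of_apply_eq_mul hp hτ h3 hω2
          (x := algebraMap K K⟮ρ⟯ (b * (1 - ω) ^ s) * (AdjoinSimple.gen K ρ)⁻¹ ^ s) (by
            rw [map_mul τ, AlgEquiv.commutes, map_pow τ, map_inv₀ τ, hτρ, mul_inv, mul_pow, map_pow,
              map_inv₀]
            ring)
        refine ⟨_, (algebraMap K K⟮ρ⟯).injective (h6.trans ?_)⟩
        have h7 : AdjoinSimple.gen K ρ ^ p = algebraMap K K⟮ρ⟯ p := Subtype.ext hρ'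
        rw [mul_pow, ← pow_mul, mul_comm s p, pow_mul, inv_pow, h7, hd, hθ, div_pow]
        simp only [map_add, map_one, map_mul, map_pow, map_div₀]
        ring
      have hmul : d * (u / d) = u := mul_div_cancel₀ _ hd0
      rw [← hmul]
      refine hdN.mul (ih (by omega) _ ?_)
      have h8 : u / d - 1 = (a - b ^ p) * θ ^ s / d := by
        rw [div_sub_one hd0, hd]
        congr 1
        rw [hua]
        ring
      rw [h8, norm_div, hd1, div_one, norm_mul, norm_pow, hθn, hs1, pow_succ', norm_sub_rev]
      gcongr
  have hall : ∀ x : K, x ≠ 0 → IsNormFromAdjoin K ρ x := by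
    intro x hx
    obtain ⟨j, hj⟩ := hval x hx
    have hθj : IsNormFromAdjoin K ρ (θ ^ j) := by
      obtain ⟨z, hz⟩ := hθN
      have hz0 : z ≠ 0 := by
        rintro rfl
        rw [Algebra.norm_zero] at hz
        exact hθ0 hz.symm
      refine ⟨z ^ j, ?_⟩
      have := congrArg Units.val (map_zpow (Units.map (Algebra.norm K (S := K⟮ρ⟯)))
        (Units.mk0 z hz0) j)
      rw [Units.coe_map, Units.val_zpow_eq_zpow_val, Units.val_zpow_eq_zpow_val,
        Units.coe_map] at this
      simpa [hz] using this
    have hθj0 : θ ^ j ≠ 0 := zpow_ne_zero _ hθ0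
    have hmul : θ ^ j * (x / θ ^ j) = x := mul_div_cancel₀ _ hθj0
    rw [← hmul]
    refine hθj.mul ?_
    set u := x / θ ^ j with hu
    have hu1 : ‖u‖ = 1 := by
      rw [hu, norm_div, norm_zpow, hθn, hj, div_self (zpow_pos ht0 _).ne']
    obtain ⟨b, hb, hba⟩ := exists_norm_pow_sub_lt_one hp1 hu1.le
    replace hba := norm_le_of_norm_lt_one_of_forall_norm_eq_zpow ht0 ht1 hval hba
    have hb1 : ‖b ^ p‖ = 1 := by
      have h9 : b ^ p = u + (b ^ p - u) := by ring
      rw [h9, IsUltrametricDist.norm_add_eq_max_of_norm_ne_norm, max_eq_left]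
      · exact hu1
      · rw [hu1]; exact hba.trans ht1.le
      · rw [hu1]; exact (hba.trans_lt ht1).ne'
    have hb0 : b ^ p ≠ 0 := norm_pos_iff.1 (by rw [hb1]; exact one_pos)
    have hmul : b ^ p * (u / b ^ p) = u := mul_div_cancel₀ _ hb0
    rw [← hmul]
    refine (hpow b).mul (hunit (p - 1) (by omega) _ ?_)
    rw [div_sub_one hb0, norm_div, hb1, div_one, norm_sub_rev,
      show p - (p - 1) = 1 by omega, pow_one]
    exact hba
  have hidx := index_normGroup hp (m := 1) (by simpa using hω) (ρ := ρ) (by simpa using hρ)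
    (by simpa using hirr)
  have htop : normGroup K ρ = ⊤ := eq_top_iff.2 fun x _ => mem_normGroup.2 (hall _ x.ne_zero)
  rw [htop, Subgroup.index_top, pow_one] at hidx
  omega

end

section

theorem isNormFromAdjoin_pow_prime_pow_of_pow {K Ω : Type} [Field K] [Field Ω] [Algebra K Ω]
    {p : ℕ} (hp : p.Prime) (hp0 : (p : K) ≠ 0) {c : K} {u : K} (hu : u ≠ 0) {m : ℕ} :
    ∀ {ζ : K} (_ : IsPrimitiveRoot ζ (p ^ (m + 1)))
      (_ : ∀ i, Irreducible (X ^ p ^ i - C c)) {ρ : Ω} (_ : ρ ^ p ^ (m + 1) = algebraMap K Ω c)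
      (_ : IsNormFromAdjoin K ρ (u ^ p ^ m)), IsNormFromAdjoin K (ρ ^ p ^ m) u := by
  induction m with
  | zero =>
    intro ζ hζ hirr ρ hρ h
    simpa using h
  | succ m ih =>
    intro ζ hζ hirr ρ hρ h
    rw [pow_succ' p (m + 1)] at hζ hρ
    rw [pow_succ, pow_mul] at h
    have h1 := isNormFromAdjoin_pow_of_pow hp hp0 hζ (by rw [← pow_succ']; exact hirr _) hρ
      (pow_ne_zero _ hu) h
    have h2 := ih (hζ.pow (Nat.mul_pos hp.pos (pow_pos hp.pos _)) rfl) hirr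
      (by rw [← pow_mul]; exact hρ) h1
    rwa [← pow_mul, ← pow_succ'] at h2

theorem eq_of_le_of_pow_notMem {G : Type*} [CommGroup G] {p m : ℕ} (hp : p.Prime)
    {H A : Subgroup G} (hHA : H ≤ A) (hH : H.index = p ^ (m + 1)) {w : G} (hw : w ^ p ^ m ∉ A) :
    H = A := by
  obtain ⟨i, hi, hA⟩ := (Nat.dvd_prime_pow hp).1 (hH ▸ Subgroup.index_dvd_of_le hHA)
  have him : i = m + 1 := by
    by_contra hne
    apply hw
    obtain ⟨j, rfl⟩ := Nat.exists_eq_add_of_le (show i ≤ m by omega)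
    rw [pow_add, pow_mul]
    refine Subgroup.pow_mem _ ?_ _
    rw [← hA]
    exact Subgroup.pow_index_mem A w
  have h1 := Subgroup.relIndex_mul_index hHA
  rw [hA, hH, him] at h1
  have h2 : H.relIndex A = 1 :=
    Nat.eq_of_mul_eq_mul_right (pow_pos hp.pos (m + 1)) (by rw [h1, one_mul])
  exact le_antisymm hHA (Subgroup.relIndex_eq_one.1 h2)

theorem one_lt_rootConductor {p : ℕ} (hp : 3 ≤ p) (k m : ℕ) :
    1 < rootConductor p (k + 1) (m + 1) := by
  rw [rootConductor]
  split_ifs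
  · have : 0 < p ^ (k + 1 - 1) := by positivity
    nlinarith
  · have : 0 < p ^ (m + 1) := by positivity
    omega

variable {p : ℕ} [Fact p.Prime] (hp : Odd p) {K L Ω : Type} [NormedField K] [NormedField L]
  [NormedField Ω] [NormedAlgebra K L] [NormedAlgebra K Ω] [NormedAlgebra L Ω] [IsScalarTower K L Ω]
  [NormedAlgebra ℚ_[p] K] [NormedAlgebra ℚ_[p] L] [NormedAlgebra ℚ_[p] Ω]
  [FiniteDimensional ℚ_[p] K] [FiniteDimensional ℚ_[p] L] [IsScalarTower ℚ_[p] K L]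
  [IsScalarTower ℚ_[p] K Ω] [IsScalarTower ℚ_[p] L Ω] {k : ℕ} {η : K} {ζ : L}
  (hη : IsPrimitiveRoot η (p ^ (k + 1))) (hζ : ζ ^ p = algebraMap K L η)
  (htop : K⟮ζ⟯ = ⊤) (hζ1 : ζ ≠ 1) (hζlt : ‖1 - ζ‖ < 1)
  (hval : ∀ c : K, c ≠ 0 → ∃ j : ℤ, ‖c‖ = (‖1 - ζ‖ ^ p) ^ j)

include hp hη hζ htop hζ1 hζlt hval

omit [NormedAlgebra L Ω] [IsScalarTower K L Ω] [NormedAlgebra ℚ_[p] Ω] [IsScalarTower ℚ_[p] K Ω]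
  [IsScalarTower ℚ_[p] L Ω] in
theorem exists_lift_of_norm_sub_one_le {m : ℕ} (hm : m ≤ k) {ρ : Ω}
    (hUB : ∀ u : K, ‖u - 1‖ ≤ (‖1 - ζ‖ ^ p) ^ rootConductor p (k + 1) (m + 1) →
      IsNormFromAdjoin K ρ u) {u : K}
    (hu : ‖u - 1‖ ≤ (‖1 - ζ‖ ^ p) ^ (rootConductor p (k + 1) (m + 1) - 1))
    (hun : ¬ IsNormFromAdjoin K ρ u) :
    ∃ w : L, ‖w - 1‖ ≤ ‖1 - ζ‖ ^ (2 * p ^ (m + 1) - 1) ∧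
      ¬ IsNormFromAdjoin K ρ (Algebra.norm K w) := by
  have hpp : p.Prime := Fact.out
  have hp3 : 3 ≤ p := by
    obtain ⟨j, hj⟩ := hp
    have := hpp.two_le
    omega
  have huK : IsUltrametricDist K := IsUltrametricDist.of_normedAlgebra ℚ_[p]
  have hK : ProperSpace K := FiniteDimensional.proper ℚ_[p] K
  have hω := hη.pow (pow_pos hpp.pos _) (pow_succ p k)
  have hpos : 0 < ‖1 - ζ‖ := norm_pos_iff.2 (sub_ne_zero.2 hζ1.symm)
  have hpn : ‖(p : K)‖ = (‖1 - ζ‖ ^ p) ^ (p ^ k * (p - 1)) := by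
    rw [← norm_one_sub_eq_pow_of_norm_one_sub hp hω hζ htop hζ1 hζlt hval,
      norm_one_sub_pow_of_isPrimitiveRoot hη]
  set T := ‖1 - ζ‖ ^ p with hT
  have hT0 : 0 < T := by positivity
  have hT1 : T < 1 := pow_lt_one₀ hpos.le hζlt (by omega)
  obtain ⟨y, hy, hyu⟩ : ∃ y : L, ‖y‖ ≤ ‖1 - ζ‖ ^ (2 * p ^ (m + 1) - 1) ∧
      ‖Algebra.norm K (1 + y) - u‖ ≤ T ^ rootConductor p (k + 1) (m + 1) := by
    rcases hm.eq_or_lt with rfl | hm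
    · exact exists_norm_norm_one_add_sub_le_self hp hω hζ htop hζ1 hζlt hval hpn hu
    · rw [rootConductor_of_lt p (by omega)] at hu ⊢
      exact exists_norm_norm_one_add_sub_le_of_lt hp hω hζ htop hζ1 hζlt hval hpn hm hu
  refine ⟨1 + y, by rwa [add_sub_cancel_left], fun hN => hun ?_⟩
  have hf := one_lt_rootConductor hp3 k m
  have hu1 : ‖u‖ = 1 := norm_eq_one_of_norm_sub_one_lt
    (hu.trans_lt (pow_lt_one₀ hT0.le hT1 (by omega)))
  set z := Algebra.norm K (1 + y) with hz
  have hz1 : ‖z‖ = 1 := by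
    apply norm_eq_one_of_norm_sub_one_lt
    rw [← sub_add_sub_cancel z u 1]
    refine (IsUltrametricDist.norm_add_le_max _ _).trans_lt (max_lt ?_ ?_)
    · exact hyu.trans_lt (pow_lt_one₀ hT0.le hT1 (by omega))
    · exact hu.trans_lt (pow_lt_one₀ hT0.le hT1 (by omega))
  have hz0 : z ≠ 0 := norm_pos_iff.1 (by rw [hz1]; exact one_pos)
  rw [← mul_div_cancel₀ u hz0]
  refine hN.mul (hUB _ ?_)
  rwa [div_sub_one hz0, norm_div, hz1, div_one, norm_sub_rev]

theorem isNormConductor_of_norm_one_sub {m : ℕ} (hm : m ≤ k) {ρ : Ω} (hρ : ρ ^ p ^ (m + 1) = p)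
    (h1 : IsNormConductor K (ρ ^ p ^ m) (‖1 - ζ‖ ^ p) (rootConductor p (k + 1) 1))
    (h : IsNormConductor K ρ (‖1 - ζ‖ ^ p) (rootConductor p (k + 1) (m + 1))) :
    IsNormConductor L ρ ‖1 - ζ‖ (2 * p ^ (m + 1)) := by
  have hpp : p.Prime := Fact.out
  have hp2 : p ≠ 2 := by rintro rfl; exact absurd hp (by decide)
  have : CharZero K := charZero_of_injective_algebraMap (algebraMap ℚ_[p] K).injective
  have : CharZero L := charZero_of_injective_algebraMap (algebraMap ℚ_[p] L).injective
  have hω := hη.pow (pow_pos hpp.pos _) (pow_succ p k)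
  have hpn : ‖(p : K)‖ = (‖1 - ζ‖ ^ p) ^ (p ^ k * (p - 1)) := by
    have huK : IsUltrametricDist K := IsUltrametricDist.of_normedAlgebra ℚ_[p]
    rw [← norm_one_sub_eq_pow_of_norm_one_sub hp hω hζ htop hζ1 hζlt hval,
      norm_one_sub_pow_of_isPrimitiveRoot hη]
  have hfin : FiniteDimensional K L :=
    (exists_generator_of_X_pow_sub_C hω
      (irreducible_X_pow_sub_C_of_norm_one_sub hω hζ hζ1 hζlt hval) hζ htop).1
  have hηm : IsPrimitiveRoot (η ^ p ^ (k - m)) (p ^ (m + 1)) :=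
    hη.pow (pow_pos hpp.pos _) (by rw [← pow_add]; congr 1; omega)
  have hintegral : ∀ i, IsIntegral K (ρ ^ i) := fun i => IsIntegral.pow
    ⟨X ^ p ^ (m + 1) - C (p : K), monic_X_pow_sub_C _ (pow_pos hpp.pos _).ne', by simp [hρ]⟩ i
  have hρ1 : (ρ ^ p ^ m) ^ p = p := by rw [← pow_mul, ← pow_succ, hρ]
  obtain ⟨hUB1, u1, hu1, hun1⟩ := h1
  obtain ⟨hUB, u, hu, hun⟩ := h
  obtain ⟨w1, -, hwn1⟩ := exists_lift_of_norm_sub_one_le hp hη hζ htop hζ1 hζlt hval (m := 0)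
    (Nat.zero_le _) hUB1 hu1 hun1
  obtain ⟨w, hw, hwn⟩ := exists_lift_of_norm_sub_one_le hp hη hζ htop hζ1 hζlt hval hm hUB hu hun
  refine ⟨?_, w, hw, fun hN => hwn (IsNormFromAdjoin.norm (by simpa using hintegral 1) hN)⟩
  have hirrK : ∀ i, Irreducible (X ^ p ^ i - C (p : K)) :=
    irreducible_X_pow_sub_C_of_not_isNormFromAdjoin hpp hp2 hω (by simpa using hρ1) hun1
  have hirrL : ∀ i, Irreducible (X ^ p ^ i - C (p : L)) :=
    irreducible_X_pow_sub_C_of_not_isNormFromAdjoin hpp hp2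
      (hω.map_of_injective (algebraMap K L).injective) (by simpa using hρ1)
      fun hN => hwn1 (IsNormFromAdjoin.norm (hintegral _) hN)
  have hw10 : w1 ≠ 0 := by
    rintro rfl
    refine hwn1 (IsNormFromAdjoin.norm (hintegral _) ⟨0, ?_⟩)
    have : FiniteDimensional L L⟮ρ ^ p ^ m⟯ := adjoin.finiteDimensional (hintegral _).tower_top
    exact Algebra.norm_zero
  have : FiniteDimensional K K⟮ρ⟯ := adjoin.finiteDimensional (by simpa using hintegral 1)
  have : FiniteDimensional L L⟮ρ⟯ :=
    adjoin.finiteDimensional ((by simpa using hintegral 1 : IsIntegral K ρ).tower_top)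
  have heq : normGroup L ρ = (normGroup K ρ).comap (Units.map (Algebra.norm K (S := L))) := by
    refine eq_of_le_of_pow_notMem hpp (w := Units.mk0 w1 hw10) (m := m) (fun x hx => ?_) ?_ ?_
    · rw [mem_normGroup] at hx
      rw [Subgroup.mem_comap, mem_normGroup]
      exact IsNormFromAdjoin.norm (by simpa using hintegral 1) hx
    · exact index_normGroup hp (hηm.map_of_injective (algebraMap K L).injective) hρ (hirrL _)
    · rw [Subgroup.mem_comap, mem_normGroup, map_pow]
      intro hN
      refine hwn1 (isNormFromAdjoin_pow_prime_pow_of_pow hpp (Nat.cast_ne_zero.2 hpp.ne_zero) ?_ hηm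
        hirrK (by simpa using hρ) hN)
      exact (Units.map (Algebra.norm K (S := L)) (Units.mk0 w1 hw10)).ne_zero
  intro x hx
  have huL : IsUltrametricDist L := IsUltrametricDist.of_normedAlgebra ℚ_[p]
  have hx0 : x ≠ 0 := by
    refine norm_pos_iff.1 ?_
    rw [norm_eq_one_of_norm_sub_one_lt]
    · exact one_pos
    · refine hx.trans_lt (pow_lt_one₀ (norm_nonneg _) hζlt ?_)
      have : 0 < p ^ (m + 1) := pow_pos hpp.pos _
      omega
  have hmem : Units.mk0 x hx0 ∈ normGroup L ρ := by
    rw [heq, Subgroup.mem_comap, mem_normGroup]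
    refine hUB _ ?_
    have := norm_norm_one_add_sub_one_le hp hω hζ htop hζ1 hζlt hval hpn hm (y := x - 1) hx
    rwa [add_sub_cancel] at this
  exact mem_normGroup.1 hmem

end

section

theorem isNormConductor_root_self {p : ℕ} [Fact p.Prime] (hp : Odd p) {K Ω : Type} [NormedField K]
    [NormedField Ω] [NormedAlgebra K Ω] [NormedAlgebra ℚ_[p] K] [FiniteDimensional ℚ_[p] K]
    {k : ℕ} {η : K} (hη : IsPrimitiveRoot η (p ^ (k + 2)))
    (hirr : Irreducible (X ^ p ^ (k + 2) - C (p : K))) {ρ : Ω} (hρ : ρ ^ p ^ (k + 2) = p)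
    (h : IsNormConductor K (ρ ^ p) ‖1 - η‖ (2 * p ^ (k + 1))) :
    IsNormConductor K ρ ‖1 - η‖ (p ^ (k + 1) * (p + 1)) := by
  have hpp : p.Prime := Fact.out
  have hu : IsUltrametricDist K := IsUltrametricDist.of_normedAlgebra ℚ_[p]
  have hK : ProperSpace K := FiniteDimensional.proper ℚ_[p] K
  have : CharZero K := charZero_of_injective_algebraMap (algebraMap ℚ_[p] K).injective
  obtain ⟨q, hq⟩ : ∃ q, p = q + 3 := Nat.exists_eq_add_of_le' (by
    obtain ⟨j, hj⟩ := hp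
    have := hpp.two_le
    omega)
  have ht := norm_one_sub_pow_of_isPrimitiveRoot (k := k + 1) hη
  have ht1 := norm_one_sub_lt_one_of_isPrimitiveRoot (k := k + 1) hη
  have hp0 : 0 < ‖(p : K)‖ := by
    rw [norm_natCast_prime_padic]; exact inv_pos.2 (by exact_mod_cast hpp.pos)
  have hpk : 1 < p ^ (k + 1) := Nat.one_lt_pow (by omega) hpp.one_lt
  have hexp : p ^ (k + 1) * (p - 1) ≠ 0 := by
    rw [hq, show q + 3 - 1 = q + 2 by omega]; positivity
  have ht0 : 0 < ‖1 - η‖ := by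
    refine (norm_nonneg _).lt_of_ne fun h => ?_
    rw [← h, zero_pow hexp] at ht
    exact hp0.ne ht
  have hp1 : ‖(p : K)‖ < 1 := by rw [← ht]; exact pow_lt_one₀ ht0.le ht1 hexp
  obtain ⟨P, hP⟩ : ∃ P, p ^ (k + 1) = P + 2 := ⟨p ^ (k + 1) - 2, by omega⟩
  have hpsub : p - 1 = q + 2 := by omega
  have hpow : p ^ (k + 2) = p * p ^ (k + 1) := pow_succ' p (k + 1)
  rw [hpow] at hη hirr hρ
  have hρ' : ρ ^ (p * p ^ (k + 1)) = algebraMap K Ω (p : K) := by rw [hρ, map_natCast]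
  obtain ⟨hUB, u, hu1, hun⟩ := h
  constructor
  · intro x hx
    obtain ⟨w, rfl, hw⟩ := exists_pow_eq_of_norm_sub_one_le (p := p)
      (r := ‖1 - η‖ ^ (2 * p ^ (k + 1))) (by positivity)
      (pow_lt_one₀ ht0.le ht1 (by omega)) (u := x) (by
        rw [← ht, ← pow_mul]
        refine pow_lt_pow_right_of_lt_one₀ ht0 ht1 ?_
        rw [hP, hpsub]
        nlinarith) (by
        rw [← ht, ← pow_add]
        convert hx using 2
        rw [hP, hpsub, hq]
        ring)
    exact isNormFromAdjoin_pow hpp.ne_zero hη hirr hρ' (hUB _ hw)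
  · have hu2 : ‖u - 1‖ < 1 := hu1.trans_lt (pow_lt_one₀ ht0.le ht1 (by omega))
    have hu0 : u ≠ 0 := norm_pos_iff.1 (by rw [norm_eq_one_of_norm_sub_one_lt hu2]; exact one_pos)
    refine ⟨u ^ p, ?_, fun hN => hun (isNormFromAdjoin_pow_of_pow hpp
      (Nat.cast_ne_zero.2 hpp.ne_zero) hη hirr hρ' hu0 hN)⟩
    refine (norm_pow_sub_one_le hu2 ?_).trans ?_
    · calc ‖u - 1‖ ^ (p - 1) ≤ (‖1 - η‖ ^ (2 * p ^ (k + 1) - 1)) ^ (p - 1) := by gcongr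
        _ < _ := by
          rw [← ht, ← pow_mul]
          refine pow_lt_pow_right_of_lt_one₀ ht0 ht1 ?_
          rw [hP, hpsub, show 2 * (P + 2) - 1 = 2 * P + 3 by omega]
          nlinarith
    · calc _ ≤ ‖(p : K)‖ * ‖1 - η‖ ^ (2 * p ^ (k + 1) - 1) := by gcongr
        _ = _ := by
          rw [← ht, ← pow_add]
          congr 1
          rw [hP, hpsub, hq, show 2 * (P + 2) - 1 = 2 * P + 3 by omega]
          symm
          apply Nat.sub_eq_of_eq_add
          ring

end

section

theorem exists_norm_eq_norm_one_sub_zpow {p : ℕ} [Fact p.Prime] {E K : Type*} [Field E]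
    [NormedField K] [NormedAlgebra ℚ_[p] K] [Algebra E K] {k : ℕ} {ζ : K}
    (hζ : IsPrimitiveRoot ζ (p ^ (k + 1))) (htop : E⟮ζ⟯ = ⊤)
    (hunr : ∀ x : E, x ≠ 0 → ∃ j : ℤ, ‖algebraMap E K x‖ = ‖(p : K)‖ ^ j) (c : K) (hc : c ≠ 0) :
    ∃ j : ℤ, ‖c‖ = ‖1 - ζ‖ ^ j := by
  have hpp : p.Prime := Fact.out
  have hu : IsUltrametricDist K := IsUltrametricDist.of_normedAlgebra ℚ_[p]
  have hζ1 : ζ ≠ 1 := hζ.ne_one (Nat.one_lt_pow (by omega) hpp.one_lt)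
  have hdeg : (cyclotomic (p ^ (k + 1)) E).natDegree = p ^ k * (p - 1) := by
    rw [natDegree_cyclotomic, Nat.totient_prime_pow_succ hpp]
  have hpos : 0 < p ^ (k + 1) := pow_pos hpp.pos _
  have hroot : aeval ζ (cyclotomic (p ^ (k + 1)) E) = 0 := by
    rw [aeval_def, eval₂_eq_eval_map, map_cyclotomic]
    exact hζ.isRoot_cyclotomic hpos
  obtain ⟨f, hf, rfl⟩ := exists_aeval_one_sub_eq htop (cyclotomic.monic (p ^ (k + 1)) E)
    (by rw [hdeg]; exact Nat.mul_pos (pow_pos hpp.pos _) (Nat.sub_pos_of_lt hpp.one_lt)) hroot c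
  refine (norm_aeval_of_forall_norm_eq_zpow (sub_ne_zero.2 hζ1.symm)
    (norm_one_sub_lt_one_of_isPrimitiveRoot hζ) (N := p ^ k * (p - 1)) ?_ (hdeg ▸ hf)).2 ?_
  · rw [norm_one_sub_pow_of_isPrimitiveRoot hζ]
    exact hunr
  · rintro rfl
    exact hc (map_zero _)

theorem norm_one_sub_pow_prime_of_isPrimitiveRoot {p : ℕ} [Fact p.Prime] {K : Type*}
    [NormedField K] [IsUltrametricDist K] {k : ℕ} {ζ : K}
    (hζ : IsPrimitiveRoot ζ (p ^ (k + 2))) : ‖1 - ζ ^ p‖ = ‖1 - ζ‖ ^ p := by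
  have hpp : p.Prime := Fact.out
  have h1 := norm_one_sub_pow_of_isPrimitiveRoot (k := k + 1) hζ
  have h2 := norm_one_sub_pow_of_isPrimitiveRoot (k := k)
    (hζ.pow (pow_pos hpp.pos _) (pow_succ' p (k + 1)))
  have hexp : p ^ k * (p - 1) ≠ 0 :=
    (Nat.mul_pos (pow_pos hpp.pos _) (Nat.sub_pos_of_lt hpp.one_lt)).ne'
  refine (pow_left_inj₀ (norm_nonneg _) (by positivity) hexp).1 ?_
  rw [h2, ← h1, ← pow_mul]
  congr 1
  ring

theorem isNormConductor_root {p : ℕ} [Fact p.Prime] (hp : Odd p) {E Ω : Type} [Field E]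
    [Algebra ℚ_[p] E] [NormedField Ω] [NormedAlgebra ℚ_[p] Ω] (k : ℕ) :
    ∀ {K : Type} [NormedField K] [NormedAlgebra ℚ_[p] K] [FiniteDimensional ℚ_[p] K]
      [NormedAlgebra K Ω] [IsScalarTower ℚ_[p] K Ω] [Algebra E K] [IsScalarTower ℚ_[p] E K] {ζ : K}
      (_ : IsPrimitiveRoot ζ (p ^ (k + 1))) (_ : E⟮ζ⟯ = ⊤)
      (_ : ∀ x : E, x ≠ 0 → ∃ j : ℤ, ‖algebraMap E K x‖ = ‖(p : K)‖ ^ j) {m : ℕ} (_ : m ≤ k) {ρ : Ω}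
      (_ : ρ ^ p ^ (m + 1) = p), IsNormConductor K ρ ‖1 - ζ‖ (rootConductor p (k + 1) (m + 1)) := by
  have hpp : p.Prime := Fact.out
  have hp2 : p ≠ 2 := by rintro rfl; exact absurd hp (by decide)
  induction k with
  | zero =>
    intro K _ _ _ _ _ _ _ ζ hζ htop hunr m hm ρ hρ
    obtain rfl : m = 0 := by omega
    have hval := exists_norm_eq_norm_one_sub_zpow hζ htop hunr
    have := isNormConductor_root_prime hp (by simpa using hζ) hval (by simpa using hρ)
    rw [rootConductor_self, pow_zero, one_mul]
    exact this
  | succ k ih =>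
    intro L _ _ _ _ _ _ _ ζ hζ htop hunr
    have hL : IsUltrametricDist L := IsUltrametricDist.of_normedAlgebra ℚ_[p]
    let K := E⟮ζ ^ p⟯
    let : NormedAlgebra ℚ_[p] K :=
      { toAlgebra := inferInstance
        norm_smul_le := fun a x => by
          have h5 : ((a • x : K) : L) = a • (x : L) := by
            rw [← algebraMap_smul E a x, ← algebraMap_smul E a (x : L)]
            rfl
          have : ‖(a • x : K)‖ = ‖((a • x : K) : L)‖ := rfl
          rw [this, h5, norm_smul]
          rfl }
    let : NormedAlgebra K L :=
      { toAlgebra := inferInstance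
        norm_smul_le := fun a x => by
          rw [Algebra.smul_def, norm_mul]
          rfl }
    let : NormedAlgebra K Ω :=
      { toAlgebra := inferInstance
        norm_smul_le := fun a x => by
          have h5 : a • x = (a : L) • x := rfl
          rw [h5, norm_smul]
          rfl }
    have hKL : IsScalarTower K L Ω := IsScalarTower.of_algebraMap_eq fun x => rfl
    have hQKL : IsScalarTower ℚ_[p] K L := IsScalarTower.of_algebraMap_eq fun x => by
      rw [IsScalarTower.algebraMap_apply ℚ_[p] E L, IsScalarTower.algebraMap_apply ℚ_[p] E K]
      rfl
    have hQKΩ : IsScalarTower ℚ_[p] K Ω := IsScalarTower.of_algebraMap_eq fun x => by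
      rw [IsScalarTower.algebraMap_apply ℚ_[p] L Ω, IsScalarTower.algebraMap_apply ℚ_[p] K L]
      rfl
    have hfin : FiniteDimensional ℚ_[p] K := FiniteDimensional.left ℚ_[p] K L
    have hQEK : IsScalarTower ℚ_[p] E K := inferInstance
    have hη : IsPrimitiveRoot (AdjoinSimple.gen E (ζ ^ p)) (p ^ (k + 1)) := by
      refine IsPrimitiveRoot.of_map_of_injective (f := algebraMap K L) ?_ (algebraMap K L).injective
      exact hζ.pow (pow_pos hpp.pos _) (pow_succ' p (k + 1))
    have hnorm : ‖1 - AdjoinSimple.gen E (ζ ^ p)‖ = ‖1 - ζ‖ ^ p :=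
      norm_one_sub_pow_prime_of_isPrimitiveRoot hζ
    have hunrK : ∀ x : E, x ≠ 0 → ∃ j : ℤ, ‖algebraMap E K x‖ = ‖(p : K)‖ ^ j := fun x hx => by
      rw [norm_natCast_prime_padic, ← norm_natCast_prime_padic (L := L)]
      exact hunr x hx
    have htopK := adjoin_gen_eq_top E (ζ ^ p)
    have hval := exists_norm_eq_norm_one_sub_zpow hη htopK hunrK
    rw [hnorm] at hval
    have htopL : K⟮ζ⟯ = ⊤ := by
      have h1 : E⟮ζ⟯ ≤ (K⟮ζ⟯).restrictScalars E := by
        rw [adjoin_simple_le_iff]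
        exact mem_adjoin_simple_self K ζ
      rw [htop] at h1
      exact eq_top_iff.2 fun x _ => h1 (mem_top (x := x))
    have hζ1 : ζ ≠ 1 := hζ.ne_one (Nat.one_lt_pow (by omega) hpp.one_lt)
    have hζlt := norm_one_sub_lt_one_of_isPrimitiveRoot (k := k + 1) hζ
    have hmain : ∀ {m : ℕ} (_ : m ≤ k) {ρ : Ω} (_ : ρ ^ p ^ (m + 1) = p),
        IsNormConductor L ρ ‖1 - ζ‖ (rootConductor p (k + 2) (m + 1)) := by
      intro m hm ρ hρ
      rw [rootConductor_of_lt p (by omega)]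
      refine isNormConductor_of_norm_one_sub hp hη rfl htopL hζ1 hζlt hval hm hρ ?_ ?_
      · rw [← hnorm]
        exact ih hη htopK hunrK (Nat.zero_le _)
          (by rw [← pow_mul, zero_add, pow_one, ← pow_succ, hρ])
      · rw [← hnorm]
        exact ih hη htopK hunrK hm hρ
    intro m hm ρ hρ
    rcases hm.eq_or_lt with rfl | hm
    · rw [rootConductor_self]
      have h1 := hmain le_rfl (ρ := ρ ^ p) (by rw [← pow_mul, ← pow_succ', hρ])
      rw [rootConductor_of_lt p (by omega)] at h1
      obtain ⟨-, u, -, hun⟩ := hmain (Nat.zero_le _) (ρ := ρ ^ p ^ (k + 1))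
        (by rw [← pow_mul, zero_add, pow_one, ← pow_succ, hρ])
      refine isNormConductor_root_self hp hζ ?_ hρ h1
      refine irreducible_X_pow_sub_C_of_not_isNormFromAdjoin hpp hp2
        (hζ.pow (pow_pos hpp.pos _) (pow_succ p (k + 1))) ?_ hun _
      rw [← pow_mul, ← pow_succ, hρ, map_natCast]
    · exact hmain (by omega) hρ

end

section

theorem exists_pow_prime_pow_eq_of_norm_sub_one_le {p : ℕ} [Fact p.Prime] (hp : 3 ≤ p) {L : Type*}
    [NormedField L] [IsUltrametricDist L] [ProperSpace L] (hp0 : (p : L) ≠ 0)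
    (hp1 : ‖(p : L)‖ < 1) (j : ℕ) :
    ∀ {u : L}, ‖u - 1‖ ≤ ‖(p : L)‖ ^ (j + 1) → ∃ w : L, w ^ p ^ j = u := by
  have hpos : 0 < ‖(p : L)‖ := norm_pos_iff.2 hp0
  induction j with
  | zero => exact fun {u} _ => ⟨u, by simp⟩
  | succ j ih =>
    intro u hu
    obtain ⟨w, rfl, hw⟩ := exists_pow_eq_of_norm_sub_one_le (p := p) (r := ‖(p : L)‖ ^ (j + 1))
      (by positivity) (pow_lt_one₀ hpos.le hp1 (by omega)) (u := u) (by
        rw [← pow_mul]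
        refine pow_lt_self_of_lt_one₀ hpos hp1 ?_
        have : 2 ≤ p - 1 := by omega
        nlinarith) (by rwa [← pow_succ'])
    obtain ⟨z, rfl⟩ := ih hw
    exact ⟨z, by rw [pow_succ, pow_mul]⟩

theorem AddValuation.exists_eq_intCast {F : Type*} [Field F] (v : AddValuation F (WithTop ℤ))
    {x : F} (hx : x ≠ 0) : ∃ j : ℤ, v x = j := by
  have h : v x ≠ ⊤ := fun h => hx ((AddValuation.top_iff v).1 h)
  exact ⟨(v x).untop h, (WithTop.coe_untop _ h).symm⟩

theorem AddValuation.map_pow_eq_intCast {F : Type*} [Field F] {v : AddValuation F (WithTop ℤ)}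
    {x : F} {j : ℤ} (hx : v x = j) (n : ℕ) : v (x ^ n) = ((n * j : ℤ) : WithTop ℤ) := by
  rw [AddValuation.map_pow, hx, ← WithTop.coe_nsmul, nsmul_eq_mul]

theorem AddValuation.map_mul_eq_intCast {F : Type*} [Field F] {v : AddValuation F (WithTop ℤ)}
    {x y : F} {i j : ℤ} (hx : v x = i) (hy : v y = j) : v (x * y) = ((i + j : ℤ) : WithTop ℤ) := by
  rw [AddValuation.map_mul, hx, hy, ← WithTop.coe_add]

theorem AddValuation.map_inv_eq_intCast {F : Type*} [Field F] {v : AddValuation F (WithTop ℤ)}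
    {x : F} {j : ℤ} (hx : v x = j) : v x⁻¹ = ((-j : ℤ) : WithTop ℤ) := by
  have hx0 : x ≠ 0 := by
    rintro rfl
    rw [AddValuation.map_zero] at hx
    exact WithTop.top_ne_coe hx
  obtain ⟨i, hi⟩ := v.exists_eq_intCast (inv_ne_zero hx0)
  have h := AddValuation.map_mul_eq_intCast hx hi
  rw [mul_inv_cancel₀ hx0, AddValuation.map_one] at h
  have h1 : (0 : ℤ) = j + i := WithTop.coe_injective h
  rw [hi]
  congr 1
  omega

theorem AddValuation.map_zpow_eq_intCast {F : Type*} [Field F] {v : AddValuation F (WithTop ℤ)}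
    {x : F} {j : ℤ} (hx : v x = j) (n : ℤ) : v (x ^ n) = ((n * j : ℤ) : WithTop ℤ) := by
  cases n with
  | ofNat n => simpa using AddValuation.map_pow_eq_intCast hx n
  | negSucc n =>
    rw [zpow_negSucc, AddValuation.map_inv_eq_intCast (AddValuation.map_pow_eq_intCast hx (n + 1))]
    congr 1
    rw [Int.negSucc_eq]
    push_cast
    ring

variable {p : ℕ} [Fact p.Prime] (hp : Odd p) {F : Type*} [NormedField F] [NormedAlgebra ℚ_[p] F]
  [FiniteDimensional ℚ_[p] F] {v : AddValuation F (WithTop ℤ)} {e : ℤ} (he : 0 < e)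
  (hvp : v (p : F) = e)

include hp he hvp in
theorem AddValuation.nonneg_of_norm_le_one {x : F} (hx : ‖x‖ ≤ 1) : 0 ≤ v x := by
  have hpp : p.Prime := Fact.out
  have hp3 : 3 ≤ p := by
    obtain ⟨j, hj⟩ := hp
    have := hpp.two_le
    omega
  have hu : IsUltrametricDist F := IsUltrametricDist.of_normedAlgebra ℚ_[p]
  have hF : ProperSpace F := FiniteDimensional.proper ℚ_[p] F
  have hp0 : 0 < ‖(p : F)‖ := by
    rw [norm_natCast_prime_padic]; exact inv_pos.2 (by exact_mod_cast hpp.pos)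
  have hp1 : ‖(p : F)‖ < 1 := by
    rw [norm_natCast_prime_padic]
    exact inv_lt_one_of_one_lt₀ (by exact_mod_cast hpp.one_lt)
  rcases eq_or_ne x 0 with rfl | hx0
  · rw [AddValuation.map_zero]; exact le_top
  obtain ⟨b, hb⟩ := v.exists_eq_intCast hx0
  rw [hb]
  by_contra hcon
  have hb0 : b < 0 := by
    by_contra h
    exact hcon (WithTop.coe_le_coe.2 (not_lt.1 h))
  obtain ⟨a, ha⟩ := Int.eq_ofNat_of_zero_le (show 0 ≤ -b by omega)
  have ha0 : (0 : ℤ) < a := by omega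
  set s : ℤ := e * (a + 1) with hs
  have hs0 : 0 ≤ s := by positivity
  obtain ⟨N, hN⟩ := Int.eq_ofNat_of_zero_le (show 0 ≤ s / a + 1 by positivity)
  have h1 := Int.emod_add_mul_ediv s a
  have h2 := Int.emod_nonneg s ha0.ne'
  have h3 := Int.emod_lt_of_pos s ha0
  set u : F := 1 + p ^ (a + 1) * x ^ N with hu'
  have hvz : v ((p : F) ^ (a + 1) * x ^ N) = ((s + N * b : ℤ) : WithTop ℤ) := by
    rw [AddValuation.map_mul_eq_intCast (AddValuation.map_pow_eq_intCast hvp _)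
      (AddValuation.map_pow_eq_intCast hb _), hs]
    congr 1
    push_cast
    ring
  have hsN : s + N * b = s % a - a := by
    have : (N : ℤ) = s / a + 1 := hN.symm
    rw [this, show b = -a by omega]
    linarith
  have hvu : v u = ((s % a - a : ℤ) : WithTop ℤ) := by
    rw [hu', AddValuation.map_add_eq_of_lt_right, hvz, hsN]
    rw [hvz, AddValuation.map_one, hsN]
    exact WithTop.coe_lt_coe.2 (by omega)
  obtain ⟨w, hw⟩ := exists_pow_prime_pow_eq_of_norm_sub_one_le hp3 (norm_pos_iff.1 hp0) hp1 a
    (u := u) (by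
      rw [hu', add_sub_cancel_left, norm_mul, norm_pow, norm_pow]
      exact mul_le_of_le_one_right (by positivity) (pow_le_one₀ (norm_nonneg _) hx))
  have hw0 : w ≠ 0 := by
    rintro rfl
    rw [zero_pow (pow_pos hpp.pos _).ne'] at hw
    rw [← hw, AddValuation.map_zero] at hvu
    exact WithTop.top_ne_coe hvu
  obtain ⟨c, hc⟩ := v.exists_eq_intCast hw0
  rw [← hw, AddValuation.map_pow_eq_intCast hc] at hvu
  have h4 : ((p ^ a : ℕ) : ℤ) * c = s % a - a := WithTop.coe_injective hvu
  have h5 : (a : ℤ) < ((p ^ a : ℕ) : ℤ) := by exact_mod_cast Nat.lt_pow_self hpp.one_lt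
  have h6 : ((p ^ a : ℕ) : ℤ) ∣ a - s % a := ⟨-c, by linarith⟩
  have h7 := Int.le_of_dvd (by omega) h6
  omega

include hp he hvp in
theorem AddValuation.norm_eq_one_iff {x : F} (hx0 : x ≠ 0) : v x = 0 ↔ ‖x‖ = 1 := by
  have hpp : p.Prime := Fact.out
  have hp1 : ‖(p : F)‖ < 1 := by
    rw [norm_natCast_prime_padic]
    exact inv_lt_one_of_one_lt₀ (by exact_mod_cast hpp.one_lt)
  have hp0 : 0 < ‖(p : F)‖ := by
    rw [norm_natCast_prime_padic]; exact inv_pos.2 (by exact_mod_cast hpp.pos)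
  have hnn : ∀ {x : F} {j : ℤ}, v x = j → ‖x‖ ≤ 1 → 0 ≤ j := fun {x j} hx h => by
    have := AddValuation.nonneg_of_norm_le_one hp he hvp h
    rw [hx] at this
    exact WithTop.coe_le_coe.1 this
  have hpos : ∀ {x : F} {j : ℤ}, v x = j → ‖x‖ < 1 → 0 < j := fun {x j} hx h => by
    obtain ⟨N, hN⟩ := exists_pow_lt_of_lt_one hp0 h
    have h1 : v (x ^ N * (p : F)⁻¹) = ((N * j + -e : ℤ) : WithTop ℤ) :=
      AddValuation.map_mul_eq_intCast (AddValuation.map_pow_eq_intCast hx N)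
        (AddValuation.map_inv_eq_intCast hvp)
    have h2 := hnn h1 (by
      rw [norm_mul, norm_pow, norm_inv, ← div_eq_mul_inv]
      exact div_le_one_of_le₀ hN.le hp0.le)
    by_contra hcon
    have : (N : ℤ) * j ≤ 0 := mul_nonpos_of_nonneg_of_nonpos (by positivity) (not_lt.1 hcon)
    omega
  obtain ⟨j, hj⟩ := v.exists_eq_intCast hx0
  rw [hj]
  constructor
  · intro h
    obtain rfl : j = 0 := WithTop.coe_injective h
    rcases lt_trichotomy ‖x‖ 1 with h1 | h1 | h1
    · exact absurd (hpos hj h1) (lt_irrefl _)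
    · exact h1
    · have := hpos (AddValuation.map_inv_eq_intCast hj)
        (by rw [norm_inv]; exact inv_lt_one_of_one_lt₀ h1)
      omega
  · intro h
    have h1 := hnn hj h.le
    have h2 := hnn (AddValuation.map_inv_eq_intCast hj) (by rw [norm_inv, h, inv_one])
    obtain rfl : j = 0 := by omega
    rfl

include hp he hvp in
theorem AddValuation.norm_eq_zpow_of_eq_intCast {π : F} (hπ : v π = (1 : ℤ)) {x : F} {j : ℤ}
    (hx : v x = j) : ‖x‖ = ‖π‖ ^ j := by
  have hne : ∀ {x : F} {j : ℤ}, v x = j → x ≠ 0 := by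
    rintro x j hx rfl
    rw [AddValuation.map_zero] at hx
    exact WithTop.top_ne_coe hx
  have h1 : v (x * (π ^ j)⁻¹) = 0 := by
    rw [AddValuation.map_mul_eq_intCast hx
      (AddValuation.map_inv_eq_intCast (AddValuation.map_zpow_eq_intCast hπ j)), mul_one,
      add_neg_cancel]
    rfl
  have hπj : π ^ j ≠ 0 := zpow_ne_zero _ (hne hπ)
  rw [AddValuation.norm_eq_one_iff hp he hvp (mul_ne_zero (hne hx) (inv_ne_zero hπj)), norm_mul,
    norm_inv, ← div_eq_mul_inv, div_eq_one_iff_eq (norm_ne_zero_iff.2 hπj), norm_zpow] at h1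
  exact h1

end

section

theorem exists_pow_eq_and_adjoin_eq {F Ω : Type*} [Field F] [Field Ω] [Algebra F Ω] {p m a : ℕ}
    (hp : p.Prime) {ζ : F} (hζ : IsPrimitiveRoot ζ (p ^ (m + a))) {c : F} (hc : c ≠ 0) {β : ℤ}
    (hβ : ¬ (p : ℤ) ∣ β) {y : Ω} (hy : y ^ p ^ (m + a) = algebraMap F Ω (c ^ (p ^ a * β : ℤ))) :
    ∃ ρ : Ω, ρ ^ p ^ m = algebraMap F Ω c ∧ F⟮y⟯ = F⟮ρ⟯ := by
  have hpa : NeZero (p ^ a) := ⟨(pow_pos hp.pos a).ne'⟩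
  set C := algebraMap F Ω c with hC
  set Z := algebraMap F Ω ζ with hZ
  have hC0 : C ≠ 0 := (_root_.map_ne_zero _).2 hc
  have hZζ : IsPrimitiveRoot Z (p ^ (m + a)) := hζ.map_of_injective (algebraMap F Ω).injective
  have hZ0 : Z ≠ 0 := hZζ.ne_zero (pow_pos hp.pos _).ne'
  rw [map_zpow₀] at hy
  have hy0 : y ≠ 0 := by
    rintro rfl
    rw [zero_pow (pow_pos hp.pos _).ne'] at hy
    exact zpow_ne_zero _ hC0 hy.symm
  have h1 : (y ^ p ^ m / C ^ β) ^ p ^ a = 1 := by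
    rw [div_pow, ← pow_mul, ← pow_add, hy, mul_comm, zpow_mul, ← zpow_natCast (C ^ β)]
    push_cast
    exact div_self (zpow_ne_zero _ (zpow_ne_zero _ hC0))
  obtain ⟨i, -, hi⟩ := (hZζ.pow (pow_pos hp.pos _) (pow_add p m a)).eq_pow_of_pow_eq_one h1
  set y' := y / Z ^ i with hy'
  have hy'0 : y' ≠ 0 := div_ne_zero hy0 (pow_ne_zero _ hZ0)
  have h2 : y' ^ (p ^ m : ℤ) = C ^ β := by
    rw [eq_div_iff (zpow_ne_zero _ hC0)] at hi
    have h3 : y' ^ (p ^ m : ℕ) = C ^ β := by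
      rw [hy', div_pow, ← hi, ← pow_mul, ← pow_mul, mul_comm i]
      field_simp
    rw [← h3, ← zpow_natCast]
    push_cast
    rfl
  have hcop : IsCoprime β ((p : ℤ) ^ m) := by
    refine IsCoprime.pow_right ?_
    exact ((Nat.prime_iff_prime_int.1 hp).coprime_iff_not_dvd.2 hβ).symm
  obtain ⟨s, t, hst⟩ := hcop
  set ρ := y' ^ s * C ^ t with hρ
  have h4 : ρ ^ β = y' := by
    have h5 : ρ ^ β = y' ^ (s * β) * (C ^ β) ^ t := by
      rw [hρ, mul_zpow, ← zpow_mul, ← zpow_mul, ← zpow_mul, mul_comm β t]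
    rw [h5, ← h2, ← zpow_mul, mul_comm _ t, ← zpow_add₀ hy'0, hst, zpow_one]
  refine ⟨ρ, ?_, ?_⟩
  · rw [← zpow_natCast, hρ, mul_zpow, ← zpow_mul, mul_comm s, zpow_mul]
    push_cast
    rw [h2, ← zpow_mul, ← zpow_mul, ← zpow_add₀ hC0, mul_comm β, hst, zpow_one]
  · have hyy : y = y' * Z ^ i := by rw [hy', div_mul_cancel₀ _ (pow_ne_zero _ hZ0)]
    apply le_antisymm
    · rw [adjoin_simple_le_iff, hyy, ← h4]
      exact mul_mem (zpow_mem (mem_adjoin_simple_self F ρ) _)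
        (pow_mem (IntermediateField.algebraMap_mem _ ζ) _)
    · rw [adjoin_simple_le_iff, hρ]
      refine mul_mem (zpow_mem (div_mem (mem_adjoin_simple_self F y)
        (pow_mem (IntermediateField.algebraMap_mem _ ζ) _)) _)
        (zpow_mem (IntermediateField.algebraMap_mem _ c) _)

end

section

theorem IsNormConductor.isLeast {p : ℕ} [Fact p.Prime] (hp : Odd p) {F Ω : Type} [NormedField F]
    [NormedAlgebra ℚ_[p] F] [FiniteDimensional ℚ_[p] F] [Field Ω] [Algebra F Ω]
    {v : AddValuation F (WithTop ℤ)} {e : ℤ} (he : 0 < e) (hvp : v (p : F) = e) {π : F}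
    (hπ : v π = (1 : ℤ)) (hπ0 : π ≠ 0) (hπ1 : ‖π‖ < 1) {ρ : Ω} {f : ℕ} (hf : 1 < f)
    (h : IsNormConductor F ρ ‖π‖ f) :
    IsLeast {f : ℕ | ∀ u : F, v u = 0 → ((f : ℤ) : WithTop ℤ) ≤ v (u - 1) →
      IsNormFromAdjoin F ρ u} f := by
  have huF : IsUltrametricDist F := IsUltrametricDist.of_normedAlgebra ℚ_[p]
  have hpos : 0 < ‖π‖ := norm_pos_iff.2 hπ0
  have hle : ∀ (x : F) (g : ℕ), ((g : ℤ) : WithTop ℤ) ≤ v x ↔ ‖x‖ ≤ ‖π‖ ^ g := by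
    intro x g
    rcases eq_or_ne x 0 with rfl | hx
    · simp
    obtain ⟨j, hj⟩ := v.exists_eq_intCast hx
    rw [hj, AddValuation.norm_eq_zpow_of_eq_intCast hp he hvp hπ hj, ← zpow_natCast,
      WithTop.coe_le_coe, zpow_le_zpow_iff_right_of_lt_one₀ hpos hπ1]
  obtain ⟨hUB, u, hu, hun⟩ := h
  refine ⟨fun x _ hx => hUB x ((hle _ _).1 hx), fun g hg => ?_⟩
  by_contra hcon
  have hu1 : ‖u‖ = 1 := norm_eq_one_of_norm_sub_one_lt
    (hu.trans_lt (pow_lt_one₀ hpos.le hπ1 (by omega)))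
  have hu0 : u ≠ 0 := norm_pos_iff.1 (by rw [hu1]; exact one_pos)
  refine hun (hg u ((AddValuation.norm_eq_one_iff hp he hvp hu0).2 hu1) ((hle _ _).2 ?_))
  exact hu.trans (pow_le_pow_of_le_one hpos.le hπ1.le (by omega))

theorem isLeast_rootConductor {p k m a : ℕ} [Fact p.Prime] (hp : Odd p) {E F Ω : Type} [Field E]
    [Algebra ℚ_[p] E] [NormedField F] [NormedAlgebra ℚ_[p] F] [FiniteDimensional ℚ_[p] F]
    [NormedField Ω] [NormedAlgebra ℚ_[p] Ω] [NormedAlgebra F Ω] [IsScalarTower ℚ_[p] F Ω]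
    [Algebra E F] [IsScalarTower ℚ_[p] E F] {ζ : F} (hζ : IsPrimitiveRoot ζ (p ^ (k + 1)))
    (htop : E⟮ζ⟯ = ⊤) {v : AddValuation F (WithTop ℤ)} (hv1 : v (1 - ζ) = (1 : ℤ)) {e : ℤ}
    (he : 0 < e) (hvp : v (p : F) = e)
    (hunr : ∀ x : E, x ≠ 0 → ∃ j : ℤ, v (algebraMap E F x) = ((e * j : ℤ) : WithTop ℤ))
    (hkm : k + 1 = m + 1 + a) {β : ℤ} (hβ : ¬ (p : ℤ) ∣ β) {y : Ω}
    (hy : y ^ p ^ (k + 1) = algebraMap F Ω ((p : F) ^ (p ^ a * β : ℤ))) :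
    IsLeast {f : ℕ | ∀ u : F, v u = 0 → ((f : ℤ) : WithTop ℤ) ≤ v (u - 1) →
      IsNormFromAdjoin F y u} (rootConductor p (k + 1) (m + 1)) := by
  have hpp : p.Prime := Fact.out
  have hp3 : 3 ≤ p := by
    obtain ⟨j, hj⟩ := hp
    have := hpp.two_le
    omega
  have : CharZero F := charZero_of_injective_algebraMap (algebraMap ℚ_[p] F).injective
  rw [hkm] at hy
  obtain ⟨ρ, hρ, hyρ⟩ := exists_pow_eq_and_adjoin_eq hpp (hkm ▸ hζ)
    (Nat.cast_ne_zero.2 hpp.ne_zero) hβ hy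
  have hunr' : ∀ x : E, x ≠ 0 → ∃ j : ℤ, ‖algebraMap E F x‖ = ‖(p : F)‖ ^ j := by
    intro x hx
    obtain ⟨j, hj⟩ := hunr x hx
    refine ⟨j, ?_⟩
    rw [AddValuation.norm_eq_zpow_of_eq_intCast hp he hvp hv1 hj,
      AddValuation.norm_eq_zpow_of_eq_intCast hp he hvp hv1 hvp, zpow_mul]
  have hmain := isNormConductor_root hp k hζ htop hunr' (m := m) (by omega) (ρ := ρ)
    (by rw [hρ, map_natCast])
  have h := hmain.isLeast hp he hvp hv1
    (sub_ne_zero.2 (hζ.ne_one (Nat.one_lt_pow (by omega) hpp.one_lt)).symm)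
    (norm_one_sub_lt_one_of_isPrimitiveRoot hζ) (one_lt_rootConductor hp3 k m)
  have heq : ∀ u : F, IsNormFromAdjoin F y u ↔ IsNormFromAdjoin F ρ u := fun u => by
    unfold IsNormFromAdjoin
    rw [hyρ]
  simpa only [heq] using h

theorem finiteDimensional_of_adjoin_eq_top {k E F : Type*} [Field k] [Field E] [Field F]
    [Algebra k E] [Algebra E F] [Algebra k F] [IsScalarTower k E F] [FiniteDimensional k E]
    {x : F} (hx : IsIntegral E x) (hF : E⟮x⟯ = ⊤) : FiniteDimensional k F := by
  have h1 : FiniteDimensional E E⟮x⟯ := adjoin.finiteDimensional hx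
  rw [hF] at h1
  have h2 : FiniteDimensional E F := IntermediateField.topEquiv.toLinearEquiv.finiteDimensional
  exact FiniteDimensional.trans k E F

end

end

/-- For a nonzero integer `α` with `a = v_p(α) ≤ n - 1`, the conductor of
`F((p^α)^{1/p^n})/F` is `p^{n-1}(p+1)` if `a = 0` and `2·p^{n-a}` if `1 ≤ a ≤ n-1`. -/
theorem conductor_of_p_pow (p n : ℕ) [Fact p.Prime] (hp : Odd p) (hn : 1 ≤ n)
    (E F : Type) [Field E] [Field F] [Algebra ℚ_[p] E] [Algebra E F]
    [Algebra ℚ_[p] F] [IsScalarTower ℚ_[p] E F] [FiniteDimensional ℚ_[p] E]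
    (ζ : F) (hζ : IsPrimitiveRoot ζ (p ^ n))
    (hF : IntermediateField.adjoin E {ζ} = ⊤)
    (v : AddValuation F (WithTop ℤ))
    (hv1 : v (1 - ζ) = (1 : WithTop ℤ))
    (hvp : v ((p : F)) = (((p : ℤ) ^ (n - 1) * ((p : ℤ) - 1) : ℤ) : WithTop ℤ))
    (hunram : ∀ x : E, x ≠ 0 →
      ∃ k : ℤ, v (algebraMap E F x) = ((((p : ℤ) ^ (n - 1) * ((p : ℤ) - 1)) * k : ℤ) : WithTop ℤ))
    (α : ℤ) (hα : α ≠ 0) (hα' : padicValInt p α ≤ n - 1)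
    (y : AlgebraicClosure F)
    (hy : y ^ (p ^ n) = algebraMap F (AlgebraicClosure F) ((p : F) ^ α)) :
    (padicValInt p α = 0 → IsLeast (condSet v y) (p ^ (n - 1) * (p + 1))) ∧
      (1 ≤ padicValInt p α →
        IsLeast (condSet v y) (2 * p ^ (n - padicValInt p α))) := by
  have hpp : p.Prime := Fact.out
  obtain ⟨k, rfl⟩ : ∃ k, n = k + 1 := ⟨n - 1, by omega⟩
  have hfin : FiniteDimensional ℚ_[p] F :=
    finiteDimensional_of_adjoin_eq_top ((hζ.isIntegral (pow_pos hpp.pos _)).tower_top) hF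
  let : NormedField F := spectralNorm.normedField ℚ_[p] F
  let : NormedAlgebra ℚ_[p] F := spectralNorm.normedAlgebra ℚ_[p] F
  have halg : Algebra.IsAlgebraic ℚ_[p] (AlgebraicClosure F) := Algebra.IsAlgebraic.trans ℚ_[p] F _
  let : NormedField (AlgebraicClosure F) := spectralNorm.normedField ℚ_[p] (AlgebraicClosure F)
  let : NormedAlgebra ℚ_[p] (AlgebraicClosure F) :=
    spectralNorm.normedAlgebra ℚ_[p] (AlgebraicClosure F)
  let : NormedAlgebra F (AlgebraicClosure F) :=
    spectralNorm.normedAlgebra' (K := ℚ_[p]) F (AlgebraicClosure F)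
  obtain ⟨β, hαβ⟩ : ((p : ℤ) ^ padicValInt p α) ∣ α := padicValInt_dvd α
  have hβ : ¬ (p : ℤ) ∣ β := by
    rintro ⟨γ, rfl⟩
    have h1 : (p : ℤ) ^ (padicValInt p α + 1) ∣ α := ⟨γ, by rw [pow_succ, mul_assoc]; exact hαβ⟩
    have h2 := (padicValInt_dvd_iff _ α).1 h1
    omega
  have he : (0 : ℤ) < (p : ℤ) ^ k * ((p : ℤ) - 1) :=
    mul_pos (pow_pos (by exact_mod_cast hpp.pos) _) (sub_pos.2 (by exact_mod_cast hpp.one_lt))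
  set a := padicValInt p α with ha
  obtain ⟨m, hm⟩ : ∃ m, k + 1 = m + 1 + a := ⟨k - a, by omega⟩
  have h := isLeast_rootConductor (E := E) hp hζ hF hv1 he hvp hunram hm hβ (y := y) (by
    rw [hy, hαβ])
  constructor
  · intro ha0
    obtain rfl : k = m := by omega
    rw [rootConductor_self] at h
    exact h
  · intro ha1
    rw [rootConductor_of_lt p (by omega)] at h
    have hma : k + 1 - a = m + 1 := by omega
    rw [hma]
    exact h
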